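/- Suppose the nonlinearities satisfy F_1^{11,αβ}X_αX_β = 0, F_2^{11,αβ}X_αX_β = F_2^{12,αβ}X_αX_β = 0, and F_3^{11,αβ}X_αX_β = F_3^{12,αβ}X_αX_β = 0 for all X ∈ 𝒩^{(1)}, together with F_2^{13,αβ} = F_3^{13,αβ} = 0 for all α,β. Then there exist positive constants C_KS, C_31, C_32, C_33 (independent of the solution and of t) such that every smooth local solution u = (u_1,u_2,u_3) of the system on (0,T)×ℝ³, compactly supported in x for each fixed t, satisfies for μ = 3,4 and all t ∈ (0,T): ℳ_μ(u(t)) ≤ C_KS 𝒩_μ(u(t)) + C_31 ⟨⟨u(t)⟩⟩ 𝒩_μ(u(t)) + C_32 ⟨⟨u(t)⟩⟩² 𝒩_3(u(t)) + C_33 ⟨⟨u(t)⟩⟩ ℳ_μ(u(t)). -/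

import Mathlib

open MeasureTheory Real Set

noncomputable section

namespace MultiSpeedWave

/-- Physical space `ℝ³` with the Euclidean norm. -/
abbrev Sp : Type := EuclideanSpace ℝ (Fin 3)

/-- A space-time point `(t, x)`. -/
abbrev Pt : Type := ℝ × Sp

/-- A scalar field on space-time. -/
abbrev Fn : Type := Pt → ℝ

/-- Time derivative `∂_t`. -/
def pt (v : Fn) : Fn := fun p => fderiv ℝ v p (1, 0)

/-- Spatial derivative `∂_j`. -/
def px (j : Fin 3) (v : Fn) : Fn := fun p => fderiv ℝ v p (0, EuclideanSpace.single j 1)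

/-- Space-time derivative `∂_α` (`α = 0` is time). -/
def pd (α : Fin 4) : Fn → Fn := Fin.cases pt px α

/-- Rotation `Ω_{ij} = x_i ∂_j − x_j ∂_i` (0-based indices). -/
def om (i j : Fin 3) (v : Fn) : Fn := fun p => p.2 i * px j v p - p.2 j * px i v p

/-- Scaling vector field `S = t ∂_t + x·∇`. -/
def sOp (v : Fn) : Fn := fun p => p.1 * pt v p + ∑ j : Fin 3, p.2 j * px j v p

/-- The seven generators `Z_1,…,Z_7 = ∂_1,∂_2,∂_3,Ω_{12},Ω_{23},Ω_{13},S`. -/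
def Zop : Fin 7 → Fn → Fn := ![px 0, px 1, px 2, om 0 1, om 1 2, om 0 2, sOp]

/-- `Z^a` for a multi-index `a`. -/
def Zmulti (a : Fin 7 → ℕ) (v : Fn) : Fn :=
  (List.finRange 7).foldr (fun i w => (Zop i)^[a i] w) v

/-- `∂_x^a` for a spatial multi-index `a`, acting on space-time functions. -/
def pxMulti (a : Fin 3 → ℕ) (v : Fn) : Fn :=
  (List.finRange 3).foldr (fun i w => (px i)^[a i] w) v

/-- `Ω^b = Ω_{12}^{b₁} Ω_{23}^{b₂} Ω_{13}^{b₃}`. -/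
def omMulti (b : Fin 3 → ℕ) (v : Fn) : Fn :=
  (om 0 1)^[b 0] ((om 1 2)^[b 1] ((om 0 2)^[b 2] v))

/-- All multi-indices of length `n` and total degree `≤ m`. -/
def idxSet (n m : ℕ) : Finset (Fin n → ℕ) :=
  (Fintype.piFinset fun _ => Finset.range (m+1)).filter fun a => ∑ i, a i ≤ m

/-- The Japanese bracket `⟨ρ⟩ = (1+ρ²)^{1/2}`. -/
def jb (ρ : ℝ) : ℝ := Real.sqrt (1 + ρ^2)

/-- The d'Alembertian `□_c = ∂_t² − c²Δ`. -/
def boxOp (c : ℝ) (v : Fn) : Fn :=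
  fun p => pt (pt v) p - c^2 * ∑ j : Fin 3, px j (px j v) p

/-- Energy `E(v(t);c)`. -/
def energy (c : ℝ) (v : Fn) (t : ℝ) : ℝ :=
  (1/2) * ∫ x : Sp, ((pt v (t,x))^2 + c^2 * ∑ j : Fin 3, (px j v (t,x))^2)

/-- Generalized energy `N_κ(v(t);c)`. -/
def Nnorm (κ : ℕ) (c : ℝ) (v : Fn) (t : ℝ) : ℝ :=
  Real.sqrt (∑ a ∈ idxSet 7 (κ-1), energy c (Zmulti a v) t)

/-- `L²(ℝ³)` norm. -/
def L2 (f : Sp → ℝ) : ℝ := Real.sqrt (∫ x : Sp, (f x)^2)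

/-- The auxiliary norm `M₂(v(t);c)`. -/
def M2 (c : ℝ) (v : Fn) (t : ℝ) : ℝ :=
  ∑ α : Fin 4, ∑ j : Fin 3, L2 (fun x => jb (c*t - ‖x‖) * pd α (px j v) (t,x))

/-- The auxiliary norm `M_μ(v(t);c)`. -/
def Mmu (μ : ℕ) (c : ℝ) (v : Fn) (t : ℝ) : ℝ :=
  ∑ a ∈ idxSet 7 (μ-2), M2 c (Zmulti a v) t

/-- The good derivative `T_j^{(c)} = c ∂_j + (x_j/|x|) ∂_t`. -/
def Tder (c : ℝ) (j : Fin 3) (v : Fn) : Fn :=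
  fun p => c * px j v p + (p.2 j / ‖p.2‖) * pt v p

/-- `|T^{(c)} v|`. -/
def Tnorm (c : ℝ) (v : Fn) (p : Pt) : ℝ := Real.sqrt (∑ j : Fin 3, (Tder c j v p)^2)

/-- `|∂v|` (full space-time gradient). -/
def pdNorm (v : Fn) (p : Pt) : ℝ := Real.sqrt (∑ α : Fin 4, (pd α v p)^2)

/-- `|∂_x v|` (spatial gradient). -/
def pxNorm (v : Fn) (p : Pt) : ℝ := Real.sqrt (∑ j : Fin 3, (px j v p)^2)

/-- `L^∞(ℝ³)` norm. -/
def Linf (f : Sp → ℝ) : ℝ := ⨆ x : Sp, |f x|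

/-- `L⁶(ℝ³)` norm. -/
def L6 (f : Sp → ℝ) : ℝ := (∫ x : Sp, |f x|^6) ^ ((1:ℝ)/6)

/-- The unit sphere `S²`. -/
abbrev S2 := Metric.sphere (0 : Sp) 1

/-- Surface measure on the unit sphere. -/
def sphMeas : Measure S2 := (volume : Measure Sp).toSphere

/-- `‖f(r·)‖_{L⁴(S²)}`. -/
def L4sph (f : Sp → ℝ) (r : ℝ) : ℝ :=
  (∫ ω : S2, |f (r • (ω : Sp))|^4 ∂sphMeas) ^ ((1:ℝ)/4)

/-- Mixed norm `‖f‖_{L_r^∞ L_ω^4}`. -/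
def LinfrL4 (f : Sp → ℝ) : ℝ := ⨆ r : Set.Ioi (0:ℝ), L4sph f (r : ℝ)

/-- Spatial derivative for functions of `x` only. -/
def dxj (j : Fin 3) (f : Sp → ℝ) : Sp → ℝ := fun x => fderiv ℝ f x (EuclideanSpace.single j 1)

/-- `∂_x^a` for functions of `x` only. -/
def dxMulti (a : Fin 3 → ℕ) (f : Sp → ℝ) : Sp → ℝ :=
  (List.finRange 3).foldr (fun i w => (dxj i)^[a i] w) f

/-- The null condition for coefficients `{H^{αβ}}` relative to the cone `𝒩^{(c)}`. -/
def nullCond (c : ℝ) (H : Fin 4 → Fin 4 → ℝ) : Prop :=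
  ∀ X : Fin 4 → ℝ, (X 0)^2 = c^2 * ((X 1)^2 + (X 2)^2 + (X 3)^2) →
    ∑ α : Fin 4, ∑ β : Fin 4, H α β * X α * X β = 0

/-- The quadratic form `H^{αβ}(∂_α v)(∂_β w)`. -/
def nullQ (H : Fin 4 → Fin 4 → ℝ) (v w : Fn) : Fn :=
  fun p => ∑ α : Fin 4, ∑ β : Fin 4, H α β * pd α v p * pd β w p

/-- Coefficients `F_i^{jk,αβ}` of the quadratic part. -/
abbrev Coef := Fin 3 → Fin 3 → Fin 3 → Fin 4 → Fin 4 → ℝ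

/-- The speeds `c₁ = c₂ = 1`, `c₃ = c₀`. -/
def cspeed (c0 : ℝ) : Fin 3 → ℝ := ![1, 1, c0]

/-- Evaluation of a cubic remainder at the gradients of `u`. -/
def cubicEval (P : MvPolynomial (Fin 3 × Fin 4) ℝ) (u : Fin 3 → Fn) : Fn :=
  fun p => MvPolynomial.eval (fun q => pd q.2 (u q.1) p) P

/-- Every monomial has degree at least 3. -/
def CubicLike (P : MvPolynomial (Fin 3 × Fin 4) ℝ) : Prop :=
  ∀ m ∈ P.support, 3 ≤ m.sum fun _ e => e

/-- The right-hand side `F_i(∂u)`. -/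
def rhs (F : Coef) (Cub : Fin 3 → MvPolynomial (Fin 3 × Fin 4) ℝ)
    (u : Fin 3 → Fn) (i : Fin 3) : Fn :=
  fun p => (∑ j : Fin 3, ∑ k : Fin 3, ∑ α : Fin 4, ∑ β : Fin 4,
      F i j k α β * pd α (u j) p * pd β (u k) p) + cubicEval (Cub i) u p

/-- `u` solves the system for times in `s`. -/
def IsSolutionOn (c0 : ℝ) (F : Coef) (Cub : Fin 3 → MvPolynomial (Fin 3 × Fin 4) ℝ)
    (u : Fin 3 → Fn) (s : Set ℝ) : Prop :=
  ∀ i : Fin 3, ∀ t ∈ s, ∀ x : Sp, boxOp (cspeed c0 i) (u i) (t,x) = rhs F Cub u i (t,x)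

/-- `F_i^{jk} = 0` for `j > k`. -/
def LowerTri (F : Coef) : Prop :=
  ∀ (i j k : Fin 3), (k : ℕ) < (j : ℕ) → ∀ (α β : Fin 4), F i j k α β = 0

/-- Structural condition (C1). -/
def CondC1 (F : Coef) : Prop := nullCond 1 (F 0 0 0)

/-- Structural condition (C2). -/
def CondC2 (F : Coef) : Prop :=
  nullCond 1 (F 1 0 0) ∧ nullCond 1 (F 1 0 1) ∧ nullCond 1 (F 1 1 1)

/-- Structural condition (C3). -/
def CondC3 (c0 : ℝ) (F : Coef) : Prop := nullCond c0 (F 2 2 2)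

/-- Structural condition (C4). -/
def CondC4 (F : Coef) : Prop := ∀ (α β : Fin 4), F 1 0 2 α β = 0

/-- Structural condition (C5). -/
def CondC5 (F : Coef) : Prop := ∀ (α β : Fin 4), F 2 0 2 α β = 0

/-- Structural condition (C6). -/
def CondC6 (F : Coef) : Prop := nullCond 1 (F 2 0 0) ∧ nullCond 1 (F 2 0 1)

/-- The data norm `‖(f,g)‖_D`. -/
def dataNorm (f g : Fin 3 → Sp → ℝ) : ℝ :=
  ∑ i : Fin 3,
    ((∑ a ∈ (idxSet 3 4).filter (fun a => 1 ≤ ∑ j, a j),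
        L2 (fun x => jb ‖x‖ ^ ((∑ j, a j) - 1) * dxMulti a (f i) x))
      + ∑ a ∈ idxSet 3 3, L2 (fun x => jb ‖x‖ ^ (∑ j, a j) * dxMulti a (g i) x))

/-- The weights `σ₁ = δ`, `σ₂ = σ₃ = 0`. -/
def sig (δ : ℝ) : Fin 3 → ℝ := ![δ, 0, 0]

/-- Weighted `L^∞` norm of a gradient. -/
def wInf (w : Sp → ℝ) (v : Fn) (t : ℝ) : ℝ := Linf fun x => w x * pdNorm v (t,x)

/-- Weighted `L_r^∞ L_ω^4` norm of a gradient. -/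
def wL4 (w : Sp → ℝ) (v : Fn) (t : ℝ) : ℝ := LinfrL4 fun x => w x * pdNorm v (t,x)

/-- Weighted `L⁶` norm of a gradient. -/
def wL6 (w : Sp → ℝ) (v : Fn) (t : ℝ) : ℝ := L6 fun x => w x * pdNorm v (t,x)

/-- The collection of weighted pointwise norms `⟨⟨u(t)⟩⟩`. -/
def bigBracket (c0 δ : ℝ) (u : Fin 3 → Fn) (t : ℝ) : ℝ :=
  (∑ i : Fin 3, jb t ^ (-(sig δ i)) *
     wInf (fun x => ‖x‖ * Real.sqrt (jb (cspeed c0 i * t - ‖x‖))) (u i) t)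
  + (∑ i : Fin 3, ∑ a ∈ idxSet 7 1, jb t ^ (-(sig δ i) - δ) *
     wInf (fun x => ‖x‖ * Real.sqrt (jb (cspeed c0 i * t - ‖x‖))) (Zmulti a (u i)) t)
  + (∑ i : Fin 3, ∑ a ∈ idxSet 7 1, jb t ^ (-(sig δ i)) *
     (wL4 (fun x => Real.sqrt ‖x‖ * jb (cspeed c0 i * t - ‖x‖)) (Zmulti a (u i)) t
      + ∑ j : Fin 7, LinfrL4 fun x => Real.sqrt ‖x‖ * Zop j (Zmulti a (u i)) (t,x)))
  + (∑ i : Fin 3, ∑ a ∈ idxSet 7 2, jb t ^ (-(sig δ i) - δ) *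
     (wL4 (fun x => Real.sqrt ‖x‖ * jb (cspeed c0 i * t - ‖x‖)) (Zmulti a (u i)) t
      + ∑ j : Fin 7, LinfrL4 fun x => Real.sqrt ‖x‖ * Zop j (Zmulti a (u i)) (t,x)))
  + (∑ i : Fin 3, ∑ a ∈ idxSet 7 1, jb t ^ (-(sig δ i)) *
     wL4 (fun x => ‖x‖) (Zmulti a (u i)) t)
  + (∑ i : Fin 3, jb t ^ (-(sig δ i)) *
     wInf (fun x => jb (cspeed c0 i * t - ‖x‖)) (u i) t)
  + (jb t ^ (-δ) * ∑ i : Fin 3, ∑ a ∈ idxSet 7 1, jb t ^ (-(sig δ i)) *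
     wInf (fun x => jb (cspeed c0 i * t - ‖x‖)) (Zmulti a (u i)) t)
  + (∑ i : Fin 3, ∑ a ∈ idxSet 7 1, jb t ^ (-(sig δ i)) *
     wL6 (fun x => jb (cspeed c0 i * t - ‖x‖)) (Zmulti a (u i)) t)

/-- `⟨⟨u⟩⟩_T = sup_{0<t<T} ⟨⟨u(t)⟩⟩`. -/
def bigBracketSup (c0 δ T : ℝ) (u : Fin 3 → Fn) : ℝ :=
  ⨆ t : Set.Ioo (0:ℝ) T, bigBracket c0 δ u t

/-- `sup_{0<t<T} f(t)`. -/
def supIoo (T : ℝ) (f : ℝ → ℝ) : ℝ := ⨆ t : Set.Ioo (0:ℝ) T, f t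

/-- `𝒩_κ(u(t))`. -/
def calN (c0 δ : ℝ) (κ : ℕ) (u : Fin 3 → Fn) (t : ℝ) : ℝ :=
  jb t ^ (-δ) * Nnorm κ 1 (u 0) t + Nnorm κ 1 (u 1) t + Nnorm κ c0 (u 2) t

/-- `ℳ_κ(u(t))`. -/
def calM (c0 δ : ℝ) (κ : ℕ) (u : Fin 3 → Fn) (t : ℝ) : ℝ :=
  jb t ^ (-δ) * Mmu κ 1 (u 0) t + Mmu κ 1 (u 1) t + Mmu κ c0 (u 2) t

/-- The ghost-weight quantity `G(v(t);c)` (with parameter `η`). -/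
def Gnorm (η c : ℝ) (v : Fn) (t : ℝ) : ℝ :=
  Real.sqrt (∑ a ∈ idxSet 7 3, ∑ j : Fin 3,
    ∫ x : Sp, jb (c*t - ‖x‖) ^ (-1 - 2*η) * (Tder c j (Zmulti a v) (t,x))^2)

/-- The Keel–Smith–Sogge type local-energy norm `L(v(t))`. -/
def Lnorm (v : Fn) (t : ℝ) : ℝ :=
  Real.sqrt (∑ a ∈ idxSet 7 3,
    ((∫ x : Sp, (‖x‖ ^ (-(5:ℝ)/4) * Zmulti a v (t,x))^2) +
     ∑ α : Fin 4, ∫ x : Sp, (‖x‖ ^ (-(1:ℝ)/4) * pd α (Zmulti a v) (t,x))^2))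

/-- A smooth local solution on `(0,T)×ℝ³`, compactly supported in `x`. -/
def LocalSolution (c0 : ℝ) (F : Coef) (Cub : Fin 3 → MvPolynomial (Fin 3 × Fin 4) ℝ)
    (T : ℝ) (u : Fin 3 → Fn) : Prop :=
  (∀ i, ContDiff ℝ (⊤ : ℕ∞) (u i)) ∧
  (∀ i t, HasCompactSupport fun x => u i (t, x)) ∧
  IsSolutionOn c0 F Cub u (Set.Ioo 0 T)

/-- A global solution of the Cauchy problem with data `(f,g)`. -/
def IsGlobalSolution (c0 : ℝ) (F : Coef) (Cub : Fin 3 → MvPolynomial (Fin 3 × Fin 4) ℝ)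
    (f g : Fin 3 → Sp → ℝ) (u : Fin 3 → Fn) : Prop :=
  (∀ i, ContDiff ℝ (⊤ : ℕ∞) (u i)) ∧
  IsSolutionOn c0 F Cub u (Set.Ioi 0) ∧
  (∀ i x, u i (0, x) = f i x ∧ pt (u i) (0, x) = g i x)

end MultiSpeedWave
namespace MultiSpeedWave

/-- Smooth scalar fields. -/
abbrev Sm (v : Fn) : Prop := ContDiff ℝ (⊤ : ℕ∞) v

/-- The coordinate directions of space-time. -/
def ev : Fin 4 → Pt := Fin.cases (1, 0) (fun j => (0, EuclideanSpace.single j 1))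

lemma pd_apply (α : Fin 4) (v : Fn) (p : Pt) : pd α v p = fderiv ℝ v p (ev α) := by
  refine Fin.cases rfl (fun j => rfl) α

lemma px_eq_pd (j : Fin 3) : px j = pd j.succ := rfl

lemma pt_eq_pd : pt = pd 0 := rfl

lemma Sm.diff {v : Fn} (h : Sm v) : Differentiable ℝ v := h.differentiable (by simp)

lemma Sm.diffAt {v : Fn} (h : Sm v) (p : Pt) : DifferentiableAt ℝ v p := h.diff p

lemma Sm.pd {v : Fn} (h : Sm v) (α : Fin 4) : Sm (pd α v) := by
  have h1 : ContDiff ℝ (⊤ : ℕ∞) (fderiv ℝ v) := h.fderiv_right (by simp)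
  have h2 : MultiSpeedWave.pd α v = fun p => fderiv ℝ v p (ev α) := by
    funext p; exact pd_apply α v p
  rw [h2]
  exact h1.clm_apply contDiff_const

lemma Sm.pdc {v : Fn} (h : Sm v) (α : Fin 4) : Continuous (MultiSpeedWave.pd α v) :=
  (h.pd α).continuous

lemma pd_add {v w : Fn} (hv : Sm v) (hw : Sm w) (α : Fin 4) (p : Pt) :
    pd α (fun q => v q + w q) p = pd α v p + pd α w p := by
  simp only [pd_apply]
  rw [fderiv_fun_add (hv.diffAt p) (hw.diffAt p)]; rfl

lemma pd_mul {v w : Fn} (hv : Sm v) (hw : Sm w) (α : Fin 4) (p : Pt) :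
    pd α (fun q => v q * w q) p = pd α v p * w p + v p * pd α w p := by
  simp only [pd_apply]
  rw [fderiv_fun_mul (hv.diffAt p) (hw.diffAt p)]
  simp [mul_comm, add_comm]

lemma pd_const (α : Fin 4) (c : ℝ) (p : Pt) : pd α (fun _ => c) p = 0 := by
  simp [pd_apply]

lemma pd_const_mul {v : Fn} (hv : Sm v) (α : Fin 4) (c : ℝ) (p : Pt) :
    pd α (fun q => c * v q) p = c * pd α v p := by
  simp only [pd_apply]
  rw [fderiv_const_mul (hv.diffAt p)]; rfl

lemma pd_sum {ι : Type*} (s : Finset ι) {v : ι → Fn} (hv : ∀ i ∈ s, Sm (v i)) (α : Fin 4) (p : Pt) :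
    pd α (fun q => ∑ i ∈ s, v i q) p = ∑ i ∈ s, pd α (v i) p := by
  simp only [pd_apply]
  rw [fderiv_fun_sum (fun i hi => (hv i hi).diffAt p)]
  simp

lemma pd_congr {v w : Fn} {p : Pt} (h : v =ᶠ[nhds p] w) (α : Fin 4) : pd α v p = pd α w p := by
  simp only [pd_apply, h.fderiv_eq]

lemma pd_comm {v : Fn} (hv : Sm v) (α β : Fin 4) (p : Pt) :
    pd α (pd β v) p = pd β (pd α v) p := by
  have h1 : Differentiable ℝ (fderiv ℝ v) :=
    (hv.fderiv_right (m := (⊤ : ℕ∞)) (by simp)).differentiable (by simp)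
  have key : ∀ α β : Fin 4, pd α (pd β v) p = fderiv ℝ (fderiv ℝ v) p (ev α) (ev β) := by
    intro α β
    have h2 : pd β v = fun p => fderiv ℝ v p (ev β) := by funext p; exact pd_apply β v p
    rw [pd_apply, h2, fderiv_clm_apply (h1 p) (by fun_prop)]
    simp
  rw [key, key]
  exact (hv.contDiffAt.isSymmSndFDerivAt (by simpa using (WithTop.coe_le_coe.2 (le_top : (2 : ℕ∞) ≤ ⊤)))) _ _

/-- The space-time coordinates. -/
def xc : Fin 4 → Fn := Fin.cases (fun p => p.1) (fun j p => p.2 j)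

lemma xc_zero (p : Pt) : xc 0 p = p.1 := rfl
lemma xc_succ (j : Fin 3) (p : Pt) : xc j.succ p = p.2 j := rfl

lemma Sm.xc (β : Fin 4) : Sm (xc β) := by
  refine Fin.cases ?_ (fun j => ?_) β
  · exact contDiff_fst
  · change ContDiff ℝ _ (fun p : Pt => p.2 j)
    fun_prop

lemma pd_xc (α β : Fin 4) (p : Pt) : pd α (xc β) p = if α = β then 1 else 0 := by
  rw [pd_apply]
  refine Fin.cases ?_ (fun j => ?_) β
  · have h : fderiv ℝ (xc 0) p = ContinuousLinearMap.fst ℝ ℝ Sp := fderiv_fst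
    rw [h]
    refine Fin.cases ?_ (fun k => ?_) α
    · simp [ev]
    · simp [ev]
  · have h : fderiv ℝ (xc j.succ) p
        = (EuclideanSpace.proj j).comp (ContinuousLinearMap.snd ℝ ℝ Sp) :=
      ((EuclideanSpace.proj j).comp (ContinuousLinearMap.snd ℝ ℝ Sp)).fderiv
    rw [h]
    refine Fin.cases ?_ (fun k => ?_) α
    · simp [ev, (Fin.succ_ne_zero j).symm]
    · simp [ev, Fin.succ_inj, eq_comm]

/-- Linear parts of the generators, over the integers. -/
def zA (l : Fin 7) (α β : Fin 4) : ℤ :=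
  match l, α, β with
  | 3, 2, 1 => 1
  | 3, 1, 2 => -1
  | 4, 3, 2 => 1
  | 4, 2, 3 => -1
  | 5, 3, 1 => 1
  | 5, 1, 3 => -1
  | 6, 0, 0 => 1
  | 6, 1, 1 => 1
  | 6, 2, 2 => 1
  | 6, 3, 3 => 1
  | _, _, _ => 0

/-- Constant parts of the generators, over the integers. -/
def zb (l : Fin 7) (α : Fin 4) : ℤ :=
  match l, α with
  | 0, 1 => 1
  | 1, 2 => 1
  | 2, 3 => 1
  | _, _ => 0

/-- The coefficient functions of the generators. -/
def zc (l : Fin 7) (α : Fin 4) : Fn := fun p => zb l α + ∑ β : Fin 4, (zA l α β : ℝ) * xc β p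

lemma Zop_eq (l : Fin 7) (v : Fn) (p : Pt) : Zop l v p = ∑ α : Fin 4, zc l α p * pd α v p := by
  have e1 : (1 : Fin 4) = Fin.succ (0 : Fin 3) := rfl
  have e2 : (2 : Fin 4) = Fin.succ (1 : Fin 3) := rfl
  have e3 : (3 : Fin 4) = Fin.succ (2 : Fin 3) := rfl
  have x1 : xc 1 p = p.2 0 := rfl
  have x2 : xc 2 p = p.2 1 := rfl
  have x3 : xc 3 p = p.2 2 := rfl
  have d1 : px 0 v p = pd 1 v p := rfl
  have d2 : px 1 v p = pd 2 v p := rfl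
  have d3 : px 2 v p = pd 3 v p := rfl
  have d0 : pt v p = pd 0 v p := rfl
  fin_cases l <;>
  simp [Zop, zc, zA, zb, om, sOp, Fin.sum_univ_four, Fin.sum_univ_three, xc_zero, x1, x2, x3, d0,
    d1, d2, d3] <;> ring

lemma Sm.zc (l : Fin 7) (α : Fin 4) : Sm (zc l α) := by
  unfold MultiSpeedWave.zc
  exact contDiff_const.add (ContDiff.sum fun β _ => contDiff_const.mul (Sm.xc β))

lemma pd_zc (β : Fin 4) (l : Fin 7) (α : Fin 4) (p : Pt) : pd β (zc l α) p = zA l α β := by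
  unfold zc
  rw [pd_add contDiff_const
    (ContDiff.sum fun β _ => contDiff_const.mul (Sm.xc β)), pd_const,
    pd_sum _ (fun β _ => contDiff_const.mul (Sm.xc β))]
  simp only [pd_const_mul (Sm.xc _), pd_xc]
  simp

lemma Zop_fun (l : Fin 7) (v : Fn) : Zop l v = fun p => ∑ α : Fin 4, zc l α p * pd α v p := by
  funext p; exact Zop_eq l v p

lemma Sm.Zop {v : Fn} (h : Sm v) (l : Fin 7) : Sm (Zop l v) := by
  rw [Zop_fun]
  exact ContDiff.sum fun α _ => (Sm.zc l α).mul (h.pd α)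

lemma pd_Zop {v : Fn} (h : Sm v) (β : Fin 4) (l : Fin 7) (p : Pt) :
    pd β (Zop l v) p = Zop l (pd β v) p + ∑ α : Fin 4, (zA l α β : ℝ) * pd α v p := by
  rw [Zop_fun, pd_sum _ (fun α _ => (Sm.zc l α).mul (h.pd α)), Zop_eq, ← Finset.sum_add_distrib]
  refine Finset.sum_congr rfl fun α _ => ?_
  rw [pd_mul (Sm.zc l α) (h.pd α), pd_zc, pd_comm h]
  ring

lemma Zop_pd {v : Fn} (h : Sm v) (β : Fin 4) (l : Fin 7) (p : Pt) :
    Zop l (pd β v) p = pd β (Zop l v) p - ∑ α : Fin 4, (zA l α β : ℝ) * pd α v p := by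
  rw [pd_Zop h]; ring

lemma Zop_add {v w : Fn} (hv : Sm v) (hw : Sm w) (l : Fin 7) (p : Pt) :
    Zop l (fun q => v q + w q) p = Zop l v p + Zop l w p := by
  simp only [Zop_eq, pd_add hv hw, ← Finset.sum_add_distrib, mul_add]

lemma Zop_mul {v w : Fn} (hv : Sm v) (hw : Sm w) (l : Fin 7) (p : Pt) :
    Zop l (fun q => v q * w q) p = Zop l v p * w p + v p * Zop l w p := by
  simp only [Zop_eq, pd_mul hv hw, Finset.sum_mul, Finset.mul_sum, ← Finset.sum_add_distrib]
  exact Finset.sum_congr rfl fun α _ => by ring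

lemma Zop_const_mul {v : Fn} (hv : Sm v) (l : Fin 7) (c : ℝ) (p : Pt) :
    Zop l (fun q => c * v q) p = c * Zop l v p := by
  simp only [Zop_eq, pd_const_mul hv, Finset.mul_sum]
  exact Finset.sum_congr rfl fun α _ => by ring

lemma Zop_const (l : Fin 7) (c : ℝ) (p : Pt) : Zop l (fun _ => c) p = 0 := by
  simp [Zop_eq, pd_const]

lemma Zop_sum {ι : Type*} (s : Finset ι) {v : ι → Fn} (hv : ∀ i ∈ s, Sm (v i)) (l : Fin 7)
    (p : Pt) : Zop l (fun q => ∑ i ∈ s, v i q) p = ∑ i ∈ s, Zop l (v i) p := by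
  simp only [Zop_eq, pd_sum s hv, Finset.mul_sum]
  exact Finset.sum_comm

lemma Zop_congr {v w : Fn} {p : Pt} (h : v =ᶠ[nhds p] w) (l : Fin 7) : Zop l v p = Zop l w p := by
  simp only [Zop_eq, pd_congr h]

/-- Structure constants of the algebra of generators. -/
def zs (l m k : Fin 7) : ℤ :=
  let cA : Fin 4 → Fin 4 → ℤ := fun α γ =>
    (zA l 0 γ * zA m α 0 + zA l 1 γ * zA m α 1 + zA l 2 γ * zA m α 2 + zA l 3 γ * zA m α 3)
    - (zA m 0 γ * zA l α 0 + zA m 1 γ * zA l α 1 + zA m 2 γ * zA l α 2 + zA m 3 γ * zA l α 3)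
  let cb : Fin 4 → ℤ := fun α =>
    (zb l 0 * zA m α 0 + zb l 1 * zA m α 1 + zb l 2 * zA m α 2 + zb l 3 * zA m α 3)
    - (zb m 0 * zA l α 0 + zb m 1 * zA l α 1 + zb m 2 * zA l α 2 + zb m 3 * zA l α 3)
  match k with
  | 0 => cb 1
  | 1 => cb 2
  | 2 => cb 3
  | 3 => cA 2 1
  | 4 => cA 3 2
  | 5 => cA 3 1
  | 6 => cA 0 0

lemma zs_A : ∀ (l m : Fin 7) (α γ : Fin 4),
    (zA l 0 γ * zA m α 0 + zA l 1 γ * zA m α 1 + zA l 2 γ * zA m α 2 + zA l 3 γ * zA m α 3)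
    - (zA m 0 γ * zA l α 0 + zA m 1 γ * zA l α 1 + zA m 2 γ * zA l α 2 + zA m 3 γ * zA l α 3)
    = zs l m 0 * zA 0 α γ + zs l m 1 * zA 1 α γ + zs l m 2 * zA 2 α γ + zs l m 3 * zA 3 α γ
    + zs l m 4 * zA 4 α γ + zs l m 5 * zA 5 α γ + zs l m 6 * zA 6 α γ := by
  decide +kernel

lemma zs_b : ∀ (l m : Fin 7) (α : Fin 4),
    (zb l 0 * zA m α 0 + zb l 1 * zA m α 1 + zb l 2 * zA m α 2 + zb l 3 * zA m α 3)
    - (zb m 0 * zA l α 0 + zb m 1 * zA l α 1 + zb m 2 * zA l α 2 + zb m 3 * zA l α 3)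
    = zs l m 0 * zb 0 α + zs l m 1 * zb 1 α + zs l m 2 * zb 2 α + zs l m 3 * zb 3 α
    + zs l m 4 * zb 4 α + zs l m 5 * zb 5 α + zs l m 6 * zb 6 α := by
  decide +kernel

lemma zc_bracket (l m : Fin 7) (α : Fin 4) (p : Pt) :
    ∑ β : Fin 4, zc l β p * (zA m α β : ℝ) - ∑ β : Fin 4, zc m β p * (zA l α β : ℝ)
      = ∑ k : Fin 7, (zs l m k : ℝ) * zc k α p := by
  have hA : ∀ γ, _ := fun γ => congrArg (fun z : ℤ => (z : ℝ)) (zs_A l m α γ)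
  have hb := congrArg (fun z : ℤ => (z : ℝ)) (zs_b l m α)
  push_cast at hA hb
  simp only [zc, Fin.sum_univ_four, Fin.sum_univ_seven]
  linear_combination hb + xc 0 p * hA 0 + xc 1 p * hA 1 + xc 2 p * hA 2 + xc 3 p * hA 3

lemma Zop_comm {v : Fn} (h : Sm v) (l m : Fin 7) (p : Pt) :
    Zop l (Zop m v) p = Zop m (Zop l v) p + ∑ k : Fin 7, (zs l m k : ℝ) * Zop k v p := by
  have key : ∀ l m : Fin 7, Zop l (Zop m v) p = ∑ β : Fin 4, ∑ α : Fin 4,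
      (zc l β p * zc m α p * pd β (pd α v) p) +
      ∑ α : Fin 4, (∑ β : Fin 4, zc l β p * (zA m α β : ℝ)) * pd α v p := by
    intro l m
    rw [Zop_eq]
    simp only [pd_Zop h, Zop_eq, mul_add, Finset.sum_add_distrib, Finset.mul_sum, Finset.sum_mul]
    congr 1
    · refine Finset.sum_congr rfl fun β _ => Finset.sum_congr rfl fun α _ => ?_
      rw [pd_comm h]; ring
    · rw [Finset.sum_comm]
      refine Finset.sum_congr rfl fun β _ => Finset.sum_congr rfl fun α _ => ?_
      ring
  have hs : ∑ k : Fin 7, (zs l m k : ℝ) * Zop k v p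
      = ∑ α : Fin 4, (∑ k : Fin 7, (zs l m k : ℝ) * zc k α p) * pd α v p := by
    simp only [Zop_eq, Finset.mul_sum, Finset.sum_mul]
    rw [Finset.sum_comm]
    refine Finset.sum_congr rfl fun β _ => Finset.sum_congr rfl fun α _ => ?_
    ring
  rw [hs, key l m, key m l]
  simp only [← zc_bracket, sub_mul, Finset.sum_sub_distrib]
  have : ∑ β : Fin 4, ∑ α : Fin 4, zc l β p * zc m α p * pd β (pd α v) p
      = ∑ β : Fin 4, ∑ α : Fin 4, zc m β p * zc l α p * pd β (pd α v) p := by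
    rw [Finset.sum_comm]
    refine Finset.sum_congr rfl fun β _ => Finset.sum_congr rfl fun α _ => ?_
    rw [pd_comm h]; ring
  rw [this]; ring

/-- The deficiency of a generator with respect to the wave operators. -/
def zdef (l : Fin 7) : ℝ := if l = 6 then 2 else 0

lemma boxOp_eq (c : ℝ) (v : Fn) (p : Pt) :
    boxOp c v p = pd 0 (pd 0 v) p - c ^ 2 * ∑ j : Fin 3, pd j.succ (pd j.succ v) p := rfl

lemma Sm.boxOp {v : Fn} (h : Sm v) (c : ℝ) : Sm (boxOp c v) :=
  ((h.pd 0).pd 0).sub (contDiff_const.mul (ContDiff.sum fun j _ => (h.pd j.succ).pd j.succ))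

lemma pd_pd_Zop {v : Fn} (h : Sm v) (β : Fin 4) (l : Fin 7) (p : Pt) :
    pd β (pd β (Zop l v)) p = Zop l (pd β (pd β v)) p
      + 2 * ∑ α : Fin 4, (zA l α β : ℝ) * pd α (pd β v) p := by
  have e : pd β (Zop l v)
      = fun p => Zop l (pd β v) p + ∑ α : Fin 4, (zA l α β : ℝ) * pd α v p := by
    funext p; exact pd_Zop h β l p
  rw [e, pd_add ((h.pd β).Zop l) (ContDiff.sum fun α _ => contDiff_const.mul (h.pd α)),
    pd_Zop (h.pd β), pd_sum _ (fun α _ => contDiff_const.mul (h.pd α))]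
  simp only [pd_const_mul (h.pd _), pd_comm h β]
  ring

lemma boxOp_Zop {v : Fn} (h : Sm v) (c : ℝ) (l : Fin 7) (p : Pt) :
    boxOp c (Zop l v) p = Zop l (boxOp c v) p + zdef l * boxOp c v p := by
  have e : boxOp c v
      = fun p => pd 0 (pd 0 v) p + (-c ^ 2) * ∑ j : Fin 3, pd j.succ (pd j.succ v) p := by
    funext p; rw [boxOp_eq]; ring
  have e2 : Zop l (boxOp c v) p
      = Zop l (pd 0 (pd 0 v)) p - c ^ 2 * ∑ j : Fin 3, Zop l (pd j.succ (pd j.succ v)) p := by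
    rw [e, Zop_add ((h.pd 0).pd 0)
      (contDiff_const.mul (ContDiff.sum fun j _ => (h.pd _).pd _)),
      Zop_const_mul (ContDiff.sum fun j _ => (h.pd _).pd _), Zop_sum _ fun j _ => (h.pd _).pd _]
    ring
  rw [e2, boxOp_eq, boxOp_eq]
  simp only [pd_pd_Zop h, Fin.sum_univ_three]
  have c01 := pd_comm h 1 0 p
  have c02 := pd_comm h 2 0 p
  have c03 := pd_comm h 3 0 p
  have c12 := pd_comm h 2 1 p
  have c13 := pd_comm h 3 1 p
  have c23 := pd_comm h 3 2 p
  have e1 : Fin.succ (0 : Fin 3) = (1 : Fin 4) := rfl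
  have e2 : Fin.succ (1 : Fin 3) = (2 : Fin 4) := rfl
  have e3 : Fin.succ (2 : Fin 3) = (3 : Fin 4) := rfl
  simp only [e1, e2, e3, Fin.sum_univ_four, c01, c02, c03, c12, c13, c23]
  fin_cases l <;> simp [zA, zdef] <;> first | ring1 | (left; ring1)

/-- The Minkowski metric. -/
def eta (α β : Fin 4) : ℤ := if α = β then (if α = 0 then 1 else -1) else 0

/-- The symmetric part of `H` is a multiple of the Minkowski metric. -/
def IsNull (H : Fin 4 → Fin 4 → ℝ) : Prop :=
  ∃ lam : ℝ, ∀ α β : Fin 4, H α β + H β α = lam * eta α β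

lemma isNull_of_nullCond {H : Fin 4 → Fin 4 → ℝ} (h : nullCond 1 H) : IsNull H := by
  have h' : ∀ a b c d : ℝ, a ^ 2 = b ^ 2 + c ^ 2 + d ^ 2 →
      ∑ α : Fin 4, ∑ β : Fin 4, H α β * ![a, b, c, d] α * ![a, b, c, d] β = 0 := by
    intro a b c d e
    apply h
    simpa using e
  simp only [Fin.sum_univ_four, Matrix.cons_val_zero, Matrix.cons_val_one, Matrix.cons_val] at h'
  have a1 := h' 1 1 0 0 (by norm_num)
  have a2 := h' 1 (-1) 0 0 (by norm_num)
  have b1 := h' 1 0 1 0 (by norm_num)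
  have b2 := h' 1 0 (-1) 0 (by norm_num)
  have c1 := h' 1 0 0 1 (by norm_num)
  have c2 := h' 1 0 0 (-1) (by norm_num)
  have d1 := h' 5 3 4 0 (by norm_num)
  have d2 := h' 5 3 0 4 (by norm_num)
  have d3 := h' 5 0 3 4 (by norm_num)
  refine ⟨2 * H 0 0, fun α β => ?_⟩
  fin_cases α <;> fin_cases β <;> simp [eta] <;> linarith

/-- The coefficients of the commutator of a generator with a bilinear form. -/
def dH (l : Fin 7) (H : Fin 4 → Fin 4 → ℝ) (α β : Fin 4) : ℝ :=
  -∑ γ : Fin 4, ((zA l α γ : ℝ) * H γ β + (zA l β γ : ℝ) * H α γ)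

lemma IsNull.dH {H : Fin 4 → Fin 4 → ℝ} (h : IsNull H) (l : Fin 7) : IsNull (dH l H) := by
  obtain ⟨lam, h⟩ := h
  have key : ∃ s : ℤ, ∀ α β : Fin 4, zA l α 0 * eta 0 β + zA l α 1 * eta 1 β + zA l α 2 * eta 2 β
      + zA l α 3 * eta 3 β + (zA l β 0 * eta 0 α + zA l β 1 * eta 1 α + zA l β 2 * eta 2 α
      + zA l β 3 * eta 3 α) = s * eta α β := by
    refine ⟨if l = 6 then 2 else 0, ?_⟩
    revert l
    decide +kernel
  obtain ⟨s, hs⟩ := key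
  refine ⟨-lam * s, fun α β => ?_⟩
  have hs' := congrArg (fun z : ℤ => (z : ℝ)) (hs α β)
  push_cast at hs'
  simp only [MultiSpeedWave.dH, Fin.sum_univ_four]
  linear_combination (-lam) * hs' - (zA l α 0 : ℝ) * h 0 β - (zA l α 1 : ℝ) * h 1 β
    - (zA l α 2 : ℝ) * h 2 β - (zA l α 3 : ℝ) * h 3 β
    - (zA l β 0 : ℝ) * h 0 α - (zA l β 1 : ℝ) * h 1 α
    - (zA l β 2 : ℝ) * h 2 α - (zA l β 3 : ℝ) * h 3 α

lemma dH_zero {H : Fin 4 → Fin 4 → ℝ} (h : ∀ α β, H α β = 0) (l : Fin 7) (α β : Fin 4) :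
    dH l H α β = 0 := by
  simp [dH, h]

lemma Sm.nullQ {v w : Fn} (hv : Sm v) (hw : Sm w) (H : Fin 4 → Fin 4 → ℝ) : Sm (nullQ H v w) :=
  ContDiff.sum fun α _ => ContDiff.sum fun β _ =>
    (contDiff_const.mul (hv.pd α)).mul (hw.pd β)

lemma Zop_nullQ {v w : Fn} (hv : Sm v) (hw : Sm w) (H : Fin 4 → Fin 4 → ℝ) (l : Fin 7) (p : Pt) :
    Zop l (nullQ H v w) p
      = nullQ H (Zop l v) w p + nullQ H v (Zop l w) p + nullQ (dH l H) v w p := by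
  have e : nullQ H v w = fun p => ∑ α : Fin 4, ∑ β : Fin 4, H α β * (pd α v p * pd β w p) := by
    funext p; simp only [nullQ, mul_assoc]
  have s1 : ∀ α β : Fin 4, Sm (fun p => pd α v p * pd β w p) := fun α β =>
    (hv.pd α).mul (hw.pd β)
  rw [e, Zop_sum _ fun α _ => ContDiff.sum fun β _ => contDiff_const.mul (s1 α β)]
  have e2 : ∀ α : Fin 4, Zop l (fun p => ∑ β : Fin 4, H α β * (pd α v p * pd β w p)) p
      = ∑ β : Fin 4, H α β * (Zop l (pd α v) p * pd β w p + pd α v p * Zop l (pd β w) p) := by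
    intro α
    rw [Zop_sum _ fun β _ => contDiff_const.mul (s1 α β)]
    refine Finset.sum_congr rfl fun β _ => ?_
    rw [Zop_const_mul (s1 α β), Zop_mul (hv.pd α) (hw.pd β)]
  simp only [e2]
  simp only [Zop_pd hv, Zop_pd hw, nullQ, dH, Fin.sum_univ_four]
  ring

lemma mem_idxSet {n m : ℕ} {a : Fin n → ℕ} : a ∈ idxSet n m ↔ ∑ i, a i ≤ m := by
  unfold idxSet
  simp only [Finset.mem_filter, Fintype.mem_piFinset, Finset.mem_range, and_iff_right_iff_imp]
  intro h i
  have := Finset.single_le_sum (f := a) (fun i _ => Nat.zero_le _) (Finset.mem_univ i)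
  omega

lemma Zmulti_eq (a : Fin 7 → ℕ) (v : Fn) : Zmulti a v = (Zop 0)^[a 0] ((Zop 1)^[a 1]
    ((Zop 2)^[a 2] ((Zop 3)^[a 3] ((Zop 4)^[a 4] ((Zop 5)^[a 5] ((Zop 6)^[a 6] v)))))) := by
  rfl

lemma Zmulti_zero (v : Fn) : Zmulti 0 v = v := by
  simp [Zmulti_eq]

lemma Zmulti_succ (a : Fin 7 → ℕ) (i : Fin 7) (h : ∀ j < i, a j = 0) (v : Fn) :
    Zmulti (a + Pi.single i 1) v = Zop i (Zmulti a v) := by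
  fin_cases i
  all_goals
    have h0 : ∀ j, j < _ → a j = 0 := h
    simp only [Zmulti_eq]
    simp [Fin.forall_fin_succ] at h0
    simp [h0, Function.iterate_succ_apply']

lemma exists_split (a : Fin 7 → ℕ) (h : a ≠ 0) :
    ∃ (i : Fin 7) (b : Fin 7 → ℕ), a = b + Pi.single i 1 ∧ ∀ j < i, b j = 0 := by
  have h1 : ∃ i, a i ≠ 0 := by
    by_contra! hc
    exact h (funext hc)
  obtain ⟨i, hi, hmin⟩ := WellFounded.has_min (wellFounded_lt (α := Fin 7)) {i | a i ≠ 0} h1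
  refine ⟨i, Function.update a i (a i - 1), ?_, fun j hj => ?_⟩
  · funext j
    by_cases hj : j = i
    · subst hj
      have : a j ≠ 0 := hi
      simp; omega
    · simp [hj]
  · rw [Function.update_of_ne hj.ne]
    by_contra hc
    exact hmin j hc hj

lemma sum_add_single (b : Fin 7 → ℕ) (i : Fin 7) :
    ∑ j, (b + Pi.single i 1 : Fin 7 → ℕ) j = ∑ j, b j + 1 := by
  simp [Finset.sum_add_distrib, Pi.single_apply]

lemma Sm.Zmulti {v : Fn} (h : Sm v) (a : Fin 7 → ℕ) : Sm (Zmulti a v) := by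
  obtain ⟨n, hn⟩ : ∃ n, ∑ j, a j = n := ⟨_, rfl⟩
  induction n generalizing a with
  | zero =>
    have : a = 0 := by
      funext j
      exact (Finset.sum_eq_zero_iff.1 hn) j (Finset.mem_univ j)
    rw [this, Zmulti_zero]; exact h
  | succ n ih =>
    have : a ≠ 0 := by rintro rfl; simp at hn
    obtain ⟨i, b, rfl, hb⟩ := exists_split a this
    rw [Zmulti_succ b i hb]
    rw [sum_add_single] at hn
    exact (ih b (by omega)).Zop i

/-- Applying a generator to an ordered product gives a combination of ordered products. -/
lemma Zop_Zmulti (m : ℕ) : ∀ (i : Fin 7) (a : Fin 7 → ℕ), ∑ j, a j ≤ m →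
    ∃ s : (Fin 7 → ℕ) → ℝ, ∀ v : Fn, Sm v →
      ∀ p, Zop i (Zmulti a v) p = ∑ b ∈ idxSet 7 (m + 1), s b * Zmulti b v p := by
  have single : ∀ (m : ℕ) (b : Fin 7 → ℕ), ∑ j, b j ≤ m → ∃ s : (Fin 7 → ℕ) → ℝ, ∀ v : Fn,
      ∀ p, Zmulti b v p = ∑ b ∈ idxSet 7 m, s b * Zmulti b v p := by
    intro m b hb
    refine ⟨fun c => if c = b then 1 else 0, fun v p => ?_⟩
    simp [mem_idxSet, hb]
  induction m with
  | zero =>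
    intro i a ha
    have : a = 0 := by
      funext j
      exact (Finset.sum_eq_zero_iff.1 (Nat.le_zero.1 ha)) j (Finset.mem_univ j)
    subst this
    obtain ⟨s, hs⟩ := single (0 + 1) (0 + Pi.single i 1) (by rw [sum_add_single]; simp)
    refine ⟨s, fun v _ p => ?_⟩
    rw [← hs, Zmulti_succ 0 i (by simp)]
  | succ m ih =>
    intro i
    induction i using WellFoundedLT.induction with
    | _ i ihi =>
    intro a ha
    by_cases hord : ∀ j < i, a j = 0
    · obtain ⟨s, hs⟩ := single (m + 1 + 1) (a + Pi.single i 1) (by rw [sum_add_single]; omega)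
      refine ⟨s, fun v _ p => ?_⟩
      rw [← hs, Zmulti_succ a i hord]
    · push Not at hord
      obtain ⟨j0, hj0, hj0'⟩ := hord
      have hne : a ≠ 0 := by rintro rfl; simp at hj0'
      obtain ⟨k, a', rfl, hk⟩ := exists_split a hne
      have hki : k < i := by
        by_contra hc
        have hj : j0 < k := lt_of_lt_of_le hj0 (not_lt.1 hc)
        apply hj0'
        simp [hk j0 hj, hj.ne]
      rw [sum_add_single] at ha
      obtain ⟨s, hs⟩ := ih i a' (by omega)
      choose s2 hs2 using fun l : Fin 7 => ih l a' (by omega)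
      have h3 : ∀ b : Fin 7 → ℕ, ∃ s : (Fin 7 → ℕ) → ℝ, b ∈ idxSet 7 (m + 1) → ∀ v : Fn, Sm v →
          ∀ p, Zop k (Zmulti b v) p = ∑ b ∈ idxSet 7 (m + 1 + 1), s b * Zmulti b v p := by
        intro b
        by_cases hb : b ∈ idxSet 7 (m + 1)
        · obtain ⟨s, hs⟩ := ihi k hki b (mem_idxSet.1 hb)
          exact ⟨s, fun _ => hs⟩
        · exact ⟨0, fun h => absurd h hb⟩
      choose s3 hs3 using h3
      have h4 : ∀ b : Fin 7 → ℕ, ∃ s : (Fin 7 → ℕ) → ℝ, b ∈ idxSet 7 (m + 1) → ∀ v : Fn,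
          ∀ p, Zmulti b v p = ∑ b ∈ idxSet 7 (m + 1 + 1), s b * Zmulti b v p := by
        intro b
        by_cases hb : b ∈ idxSet 7 (m + 1)
        · obtain ⟨s, hs⟩ := single (m + 1 + 1) b (by have := mem_idxSet.1 hb; omega)
          exact ⟨s, fun _ => hs⟩
        · exact ⟨0, fun h => absurd h hb⟩
      choose s4 hs4 using h4
      refine ⟨fun b => ∑ c ∈ idxSet 7 (m + 1), s c * s3 c b
        + ∑ l : Fin 7, (zs i k l : ℝ) * ∑ c ∈ idxSet 7 (m + 1), s2 l c * s4 c b,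
        fun v hv p => ?_⟩
      rw [Zmulti_succ a' k hk, Zop_comm (hv.Zmulti a')]
      have e1 : Zop i (Zmulti a' v) = fun p => ∑ b ∈ idxSet 7 (m + 1), s b * Zmulti b v p := by
        funext p; exact hs v hv p
      have e2 : Zop k (Zop i (Zmulti a' v)) p
          = ∑ c ∈ idxSet 7 (m + 1), s c * ∑ b ∈ idxSet 7 (m + 1 + 1), s3 c b * Zmulti b v p := by
        rw [e1, Zop_sum _ fun b _ => contDiff_const.mul (hv.Zmulti b)]
        refine Finset.sum_congr rfl fun c hc => ?_
        rw [Zop_const_mul (hv.Zmulti c), hs3 c hc v hv]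
      have e3 : ∀ l : Fin 7, Zop l (Zmulti a' v) p
          = ∑ c ∈ idxSet 7 (m + 1), s2 l c * ∑ b ∈ idxSet 7 (m + 1 + 1), s4 c b * Zmulti b v p := by
        intro l
        rw [hs2 l v hv]
        refine Finset.sum_congr rfl fun c hc => ?_
        rw [← hs4 c hc]
      rw [e2]
      simp only [e3, add_mul, Finset.sum_add_distrib, Finset.sum_mul, Finset.mul_sum]
      congr 1
      · rw [Finset.sum_comm]
        exact Finset.sum_congr rfl fun b _ => Finset.sum_congr rfl fun c _ => by ring
      · symm
        rw [Finset.sum_comm]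
        refine Finset.sum_congr rfl fun l _ => ?_
        rw [Finset.sum_comm]
        exact Finset.sum_congr rfl fun c _ => Finset.sum_congr rfl fun b _ => by ring

/-- Spatial supports near time `t` stay in a fixed ball. -/
def SC (t : ℝ) (v : Fn) : Prop :=
  ∃ R : ℝ, ∀ᶠ s in nhds t, ∀ x : Sp, R < ‖x‖ → v (s, x) = 0

lemma SC.pd {t : ℝ} {v : Fn} (h : SC t v) (α : Fin 4) : SC t (pd α v) := by
  obtain ⟨R, hR⟩ := h
  refine ⟨R, hR.eventually_nhds.mono fun s hs x hx => ?_⟩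
  have h1 : ∀ᶠ y in nhds x, R < ‖y‖ := continuous_norm.continuousAt.eventually (lt_mem_nhds hx)
  have h2 : v =ᶠ[nhds (s, x)] fun _ => 0 := by
    rw [nhds_prod_eq]
    filter_upwards [hs.prod_mk h1] with p hp
    exact hp.1 p.2 hp.2
  rw [pd_congr h2, pd_const]

lemma SC.mono {t : ℝ} {v w : Fn} (h : SC t v) (hw : ∀ p, v p = 0 → w p = 0) : SC t w := by
  obtain ⟨R, hR⟩ := h
  exact ⟨R, hR.mono fun s hs x hx => hw _ (hs x hx)⟩

lemma SC.mul_right {t : ℝ} {v : Fn} (h : SC t v) (w : Fn) : SC t (fun p => v p * w p) :=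
  h.mono fun p hp => by simp [hp]

lemma SC.mul_left {t : ℝ} {v : Fn} (h : SC t v) (w : Fn) : SC t (fun p => w p * v p) :=
  h.mono fun p hp => by simp [hp]

lemma SC.add {t : ℝ} {v w : Fn} (hv : SC t v) (hw : SC t w) : SC t (fun p => v p + w p) := by
  obtain ⟨R, hR⟩ := hv
  obtain ⟨R', hR'⟩ := hw
  refine ⟨max R R', (hR.and hR').mono fun s hs x hx => ?_⟩
  simp [hs.1 x (lt_of_le_of_lt (le_max_left _ _) hx),
    hs.2 x (lt_of_le_of_lt (le_max_right _ _) hx)]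

lemma SC.zero (t : ℝ) : SC t (fun _ => 0) := ⟨0, Filter.Eventually.of_forall fun _ _ _ => rfl⟩

lemma SC.sum {t : ℝ} {ι : Type*} (s : Finset ι) {v : ι → Fn} (hv : ∀ i ∈ s, SC t (v i)) :
    SC t (fun p => ∑ i ∈ s, v i p) := by
  classical
  induction s using Finset.induction_on with
  | empty => simpa using SC.zero t
  | insert a s ha ih =>
    simp only [Finset.sum_insert ha]
    exact (hv a (Finset.mem_insert_self a s)).add
      (ih fun i hi => hv i (Finset.mem_insert_of_mem hi))

lemma SC.Zop {t : ℝ} {v : Fn} (h : SC t v) (l : Fin 7) : SC t (Zop l v) := by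
  rw [Zop_fun]
  exact SC.sum _ fun α _ => (h.pd α).mul_left _

lemma SC.Zmulti {t : ℝ} {v : Fn} (h : SC t v) (a : Fin 7 → ℕ) : SC t (Zmulti a v) := by
  obtain ⟨n, hn⟩ : ∃ n, ∑ j, a j = n := ⟨_, rfl⟩
  induction n generalizing a with
  | zero =>
    have : a = 0 := by
      funext j
      exact (Finset.sum_eq_zero_iff.1 hn) j (Finset.mem_univ j)
    rw [this, Zmulti_zero]; exact h
  | succ n ih =>
    have : a ≠ 0 := by rintro rfl; simp at hn
    obtain ⟨i, b, rfl, hb⟩ := exists_split a this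
    rw [Zmulti_succ b i hb]
    rw [sum_add_single] at hn
    exact (ih b (by omega)).Zop i

lemma hasCompactSupport_of_ball {f : Sp → ℝ} {R : ℝ} (h : ∀ x, R < ‖x‖ → f x = 0) :
    HasCompactSupport f :=
  HasCompactSupport.intro (isCompact_closedBall (0 : Sp) R) fun x hx => h x (by
    simpa using hx)

lemma SC.hcs {t : ℝ} {v : Fn} (h : SC t v) : HasCompactSupport fun x => v (t, x) := by
  obtain ⟨R, hR⟩ := h
  exact hasCompactSupport_of_ball hR.self_of_nhds

lemma continuous_slice {v : Fn} (h : Continuous v) (t : ℝ) : Continuous fun x : Sp => v (t, x) :=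
  h.comp (by fun_prop)

lemma SC.integrable {t : ℝ} {v : Fn} (h : SC t v) (hv : Continuous v) :
    Integrable fun x : Sp => v (t, x) :=
  (continuous_slice hv t).integrable_of_hasCompactSupport h.hcs

lemma hasFDerivAt_slice {v : Fn} (h : Sm v) (t : ℝ) (x : Sp) :
    HasFDerivAt (fun y : Sp => v (t, y))
      ((fderiv ℝ v (t, x)).comp (ContinuousLinearMap.inr ℝ ℝ Sp)) x :=
  (h.diffAt (t, x)).hasFDerivAt.comp x (hasFDerivAt_prodMk_right t x)

lemma hasDerivAt_time {v : Fn} (h : Sm v) (t : ℝ) (x : Sp) :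
    HasDerivAt (fun s => v (s, x)) (pd 0 v (t, x)) t := by
  have h1 : HasDerivAt (fun s : ℝ => (s, x)) ((1 : ℝ), (0 : Sp)) t :=
    (hasDerivAt_id t).prodMk (hasDerivAt_const t x)
  exact (h.diffAt (t, x)).hasFDerivAt.comp_hasDerivAt t h1

lemma integral_px {v : Fn} (h : Sm v) {t : ℝ} (hs : SC t v) (j : Fin 3) :
    ∫ x : Sp, pd j.succ v (t, x) = 0 := by
  have hd : ∀ x, pd j.succ v (t, x)
      = fderiv ℝ (fun y : Sp => v (t, y)) x (EuclideanSpace.single j 1) := by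
    intro x
    rw [(hasFDerivAt_slice h t x).fderiv]
    rfl
  have i1 := (hs.pd j.succ).integrable (h.pdc _)
  have i0 := hs.integrable h.continuous
  have := integral_mul_fderiv_eq_neg_fderiv_mul_of_integrable (μ := (volume : Measure Sp))
    (f := fun _ => (1 : ℝ)) (g := fun y : Sp => v (t, y)) (v := EuclideanSpace.single j 1)
    (by simp) (by simpa [hd] using i1) (by simpa using i0) (by fun_prop)
    (fun x _ => (hasFDerivAt_slice h t x).differentiableAt)
  simpa [hd] using this

lemma hasDerivAt_integral {v : Fn} (h : Sm v) {t : ℝ} (hs : SC t v) :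
    HasDerivAt (fun s => ∫ x : Sp, v (s, x)) (∫ x : Sp, pd 0 v (t, x)) t := by
  obtain ⟨R, hR⟩ := id hs
  obtain ⟨R', hR'⟩ := hs.pd 0
  obtain ⟨ε, hε, hb⟩ := Metric.eventually_nhds_iff_ball.1 (hR.and hR')
  have hK : IsCompact (Metric.closedBall t (ε / 2) ×ˢ Metric.closedBall (0 : Sp) R') :=
    (isCompact_closedBall _ _).prod (isCompact_closedBall _ _)
  obtain ⟨C, hC⟩ := hK.exists_bound_of_continuousOn (h.pdc 0).continuousOn
  have hsub : Metric.ball t (ε / 2) ⊆ Metric.ball t ε := Metric.ball_subset_ball (by linarith)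
  refine (hasDerivAt_integral_of_dominated_loc_of_deriv_le (F := fun s x => v (s, x))
    (F' := fun s x => pd 0 v (s, x))
    (bound := (Metric.closedBall (0 : Sp) R').indicator fun _ => C) (s := Metric.ball t (ε / 2))
    (Metric.ball_mem_nhds _ (by positivity)) ?_ (hs.integrable h.continuous) ?_ ?_ ?_ ?_).2
  · exact Filter.Eventually.of_forall fun s =>
      (continuous_slice h.continuous s).aestronglyMeasurable
  · exact (continuous_slice (h.pdc 0) t).aestronglyMeasurable
  · refine Filter.Eventually.of_forall fun x s hs => ?_
    by_cases hx : ‖x‖ ≤ R'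
    · rw [Set.indicator_of_mem (by simpa using hx)]
      exact hC (s, x) ⟨Metric.ball_subset_closedBall hs, by simpa using hx⟩
    · rw [Set.indicator_of_notMem (by simpa using hx), (hb s (hsub hs)).2 x (not_le.1 hx)]
      simp
  · exact (integrable_indicator_iff measurableSet_closedBall).2
      (integrableOn_const (isCompact_closedBall _ _).measure_lt_top.ne)
  · exact Filter.Eventually.of_forall fun x s _ => hasDerivAt_time h s x

/-- Polynomials without low order terms are small near the origin. -/
lemma eval_bound (P : MvPolynomial (Fin 3 × Fin 4) ℝ) (n : ℕ)
    (hP : ∀ m ∈ P.support, n ≤ m.sum fun _ e => e) (K : ℝ) :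
    ∃ C, 0 ≤ C ∧ ∀ (U : Fin 3 × Fin 4 → ℝ) (a : ℝ), 0 ≤ a → a ≤ K → (∀ q, |U q| ≤ a) →
      |MvPolynomial.eval U P| ≤ C * a ^ n := by
  refine ⟨∑ m ∈ P.support, |P.coeff m| * (max 1 K) ^ (m.sum fun _ e => e), by positivity, ?_⟩
  intro U a ha haK hU
  rw [MvPolynomial.eval_eq, Finset.sum_mul]
  refine (Finset.abs_sum_le_sum_abs _ _).trans (Finset.sum_le_sum fun m hm => ?_)
  rw [abs_mul, mul_assoc]
  refine mul_le_mul_of_nonneg_left ?_ (abs_nonneg _)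
  have h1 : |∏ i ∈ m.support, U i ^ m i| ≤ a ^ (m.sum fun _ e => e) := by
    rw [Finset.abs_prod, Finsupp.sum, ← Finset.prod_pow_eq_pow_sum]
    refine Finset.prod_le_prod (fun _ _ => abs_nonneg _) fun i _ => ?_
    rw [abs_pow]
    exact pow_le_pow_left₀ (abs_nonneg _) (hU i) _
  refine h1.trans ?_
  obtain ⟨k, hk⟩ := Nat.exists_eq_add_of_le (hP m hm)
  rw [hk, pow_add, mul_comm]
  gcongr ?_ * _
  calc a ^ k ≤ (max 1 K) ^ k := pow_le_pow_left₀ ha (haK.trans (le_max_right _ _)) _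
    _ ≤ (max 1 K) ^ (n + k) := pow_le_pow_right₀ (le_max_left _ _) (by omega)

lemma pd_comp {φ : ℝ → ℝ} {v : Fn} (hφ : Differentiable ℝ φ) (hv : Sm v) (α : Fin 4) (p : Pt) :
    pd α (fun q => φ (v q)) p = deriv φ (v p) * pd α v p := by
  simp only [pd_apply]
  have := ((hφ (v p)).hasDerivAt.hasFDerivAt.comp p (hv.diffAt p).hasFDerivAt).fderiv
  have e : (φ ∘ v) = fun q => φ (v q) := rfl
  rw [← e, this]
  simp [mul_comm]

lemma pd_sub {v w : Fn} (hv : Sm v) (hw : Sm w) (α : Fin 4) (p : Pt) :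
    pd α (fun q => v q - w q) p = pd α v p - pd α w p := by
  simp only [pd_apply]
  rw [fderiv_fun_sub (hv.diffAt p) (hw.diffAt p)]; rfl

lemma pd_sq {v : Fn} (hv : Sm v) (α : Fin 4) (p : Pt) :
    pd α (fun q => v q ^ 2) p = 2 * v p * pd α v p := by
  simp only [pow_two, pd_mul hv hv]; ring

lemma norm_sq_sp (x : Sp) : ‖x‖ ^ 2 = ∑ k : Fin 3, x k ^ 2 := by
  rw [EuclideanSpace.norm_sq_eq]
  simp

/-- The smoothed distance to `y`. -/
def br (y : Sp) : Fn := fun p => Real.sqrt (1 + ∑ k : Fin 3, (xc k.succ p - y k) ^ 2)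

lemma br_eq (y : Sp) (p : Pt) : br y p = Real.sqrt (1 + ‖p.2 - y‖ ^ 2) := by
  rw [norm_sq_sp]; rfl

lemma br_sq (y : Sp) (p : Pt) : br y p ^ 2 = 1 + ‖p.2 - y‖ ^ 2 := by
  rw [br_eq, Real.sq_sqrt (by positivity)]

lemma br_pos (y : Sp) (p : Pt) : 0 < br y p := by
  rw [br_eq]; positivity

lemma norm_le_br (y : Sp) (p : Pt) : ‖p.2 - y‖ ≤ br y p := by
  rw [br_eq]; exact Real.le_sqrt_of_sq_le (by linarith)

lemma br_le (y : Sp) (p : Pt) : br y p ≤ 1 + ‖p.2 - y‖ := by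
  rw [br_eq]; exact (Real.sqrt_le_left (by positivity)).2 (by nlinarith [norm_nonneg (p.2 - y)])

lemma Sm.br (y : Sp) : Sm (br y) := by
  refine ContDiff.sqrt (f := fun p : Pt => 1 + ∑ k : Fin 3, (MultiSpeedWave.xc k.succ p - y k) ^ 2)
    (contDiff_const.add (ContDiff.sum fun k _ => ((Sm.xc _).sub contDiff_const).pow 2)) fun p => ?_
  positivity

lemma pd_br_mul (y : Sp) (α : Fin 4) (p : Pt) :
    br y p * pd α (br y) p = ∑ k : Fin 3, (p.2 k - y k) * if α = k.succ then 1 else 0 := by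
  have s1 : ∀ k : Fin 3, Sm (fun q => xc k.succ q - y k) := fun k => (Sm.xc _).sub contDiff_const
  have h1 : (fun q => br y q ^ 2) = fun q => 1 + ∑ k : Fin 3, (xc k.succ q - y k) ^ 2 := by
    funext q
    rw [br_sq, norm_sq_sp]; rfl
  have h2 := congrArg (fun f => pd α f p) h1
  simp only [pd_sq (Sm.br y)] at h2
  rw [pd_add contDiff_const (ContDiff.sum fun k _ => (s1 k).pow 2), pd_const,
    pd_sum _ (fun k _ => (s1 k).pow 2)] at h2
  have h3 : ∀ k : Fin 3, pd α (fun q => (xc k.succ q - y k) ^ 2) p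
      = 2 * ((p.2 k - y k) * if α = k.succ then 1 else 0) := by
    intro k
    rw [pd_sq (s1 k), pd_sub (Sm.xc _) contDiff_const, pd_xc, pd_const, xc_succ]
    ring
  simp only [h3, ← Finset.mul_sum] at h2
  linarith

lemma pd_br_zero (y : Sp) (p : Pt) : pd 0 (br y) p = 0 := by
  have h := pd_br_mul y 0 p
  simp only [(Fin.succ_ne_zero _).symm, if_false, mul_zero, Finset.sum_const_zero, mul_eq_zero] at h
  exact h.resolve_left (br_pos y p).ne'

lemma pd_br_succ (y : Sp) (j : Fin 3) (p : Pt) :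
    pd j.succ (br y) p = (p.2 j - y j) / br y p := by
  have h := pd_br_mul y j.succ p
  simp only [Fin.succ_inj, mul_ite, mul_one, mul_zero, Finset.sum_ite_eq, Finset.mem_univ,
    if_true] at h
  rw [eq_div_iff (br_pos y p).ne', ← h, mul_comm]

lemma sum_pd_br_sq (y : Sp) (p : Pt) : ∑ j : Fin 3, pd j.succ (br y) p ^ 2 ≤ 1 := by
  simp only [pd_br_succ, div_pow, ← Finset.sum_div]
  rw [div_le_one (pow_pos (br_pos y p) 2), br_sq, norm_sq_sp]
  simp

/-- The size of the space-time gradient of the triple. -/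
def gradSize (u : Fin 3 → Fn) (p : Pt) : ℝ :=
  Real.sqrt (∑ q : Fin 3 × Fin 4, pd q.2 (u q.1) p ^ 2)

lemma gradSize_nonneg (u : Fin 3 → Fn) (p : Pt) : 0 ≤ gradSize u p := Real.sqrt_nonneg _

lemma gradSize_sq (u : Fin 3 → Fn) (p : Pt) :
    gradSize u p ^ 2 = ∑ q : Fin 3 × Fin 4, pd q.2 (u q.1) p ^ 2 :=
  Real.sq_sqrt (by positivity)

lemma pd_le_gradSize (u : Fin 3 → Fn) (p : Pt) (q : Fin 3 × Fin 4) :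
    |pd q.2 (u q.1) p| ≤ gradSize u p :=
  Real.abs_le_sqrt (Finset.single_le_sum (f := fun q : Fin 3 × Fin 4 => pd q.2 (u q.1) p ^ 2)
    (fun _ _ => sq_nonneg _) (Finset.mem_univ q))

lemma gradSize_continuous {u : Fin 3 → Fn} (hu : ∀ i, Sm (u i)) : Continuous (gradSize u) :=
  (continuous_finsetSum _ fun q _ => ((hu q.1).pdc q.2).pow 2).sqrt

lemma rhs_bound (F : Coef) (Cub : Fin 3 → MvPolynomial (Fin 3 × Fin 4) ℝ)
    (hC : ∀ i, CubicLike (Cub i)) (K : ℝ) :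
    ∃ C, 0 ≤ C ∧ ∀ (u : Fin 3 → Fn) (p : Pt), gradSize u p ≤ K → ∀ i,
      |rhs F Cub u i p| ≤ C * gradSize u p := by
  choose C hC0 hC using fun i => eval_bound (Cub i) 1
    (fun m hm => le_trans (by norm_num) (hC i m hm)) K
  obtain ⟨A, hA0, hA⟩ : ∃ A, 0 ≤ A ∧ ∀ i, ∑ j : Fin 3, ∑ k : Fin 3, ∑ α : Fin 4, ∑ β : Fin 4,
      |F i j k α β| ≤ A := by
    have hn : ∀ i, 0 ≤ ∑ j : Fin 3, ∑ k : Fin 3, ∑ α : Fin 4, ∑ β : Fin 4, |F i j k α β| := by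
      intro i
      exact Finset.sum_nonneg fun _ _ => Finset.sum_nonneg fun _ _ => Finset.sum_nonneg
        fun _ _ => Finset.sum_nonneg fun _ _ => abs_nonneg _
    exact ⟨_, Finset.sum_nonneg fun i _ => hn i, fun i =>
      Finset.single_le_sum (fun i _ => hn i) (Finset.mem_univ i)⟩
  refine ⟨A * |K| + ∑ i, C i, add_nonneg (mul_nonneg hA0 (abs_nonneg K))
    (Finset.sum_nonneg fun i _ => hC0 i), ?_⟩
  intro u p hK i
  set g := gradSize u p with hg
  have hg0 : 0 ≤ g := gradSize_nonneg u p
  have h1 : |cubicEval (Cub i) u p| ≤ (∑ i, C i) * g := by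
    have := hC i (fun q => pd q.2 (u q.1) p) g hg0 hK (pd_le_gradSize u p)
    rw [pow_one] at this
    exact this.trans (mul_le_mul_of_nonneg_right
      (Finset.single_le_sum (fun i _ => hC0 i) (Finset.mem_univ i)) hg0)
  have h2 : |∑ j : Fin 3, ∑ k : Fin 3, ∑ α : Fin 4, ∑ β : Fin 4,
      F i j k α β * pd α (u j) p * pd β (u k) p| ≤ A * (g * g) := by
    refine le_trans ?_ (mul_le_mul_of_nonneg_right (hA i) (mul_nonneg hg0 hg0))
    simp only [Finset.sum_mul]
    refine (Finset.abs_sum_le_sum_abs _ _).trans (Finset.sum_le_sum fun j _ => ?_)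
    refine (Finset.abs_sum_le_sum_abs _ _).trans (Finset.sum_le_sum fun k _ => ?_)
    refine (Finset.abs_sum_le_sum_abs _ _).trans (Finset.sum_le_sum fun α _ => ?_)
    refine (Finset.abs_sum_le_sum_abs _ _).trans (Finset.sum_le_sum fun β _ => ?_)
    rw [abs_mul, abs_mul, mul_assoc]
    have a1 := pd_le_gradSize u p (j, α)
    have a2 := pd_le_gradSize u p (k, β)
    gcongr
  have h3 : g * g ≤ |K| * g := mul_le_mul_of_nonneg_right (hK.trans (le_abs_self K)) hg0
  calc |rhs F Cub u i p| ≤ A * (g * g) + (∑ i, C i) * g := (abs_add_le _ _).trans (add_le_add h2 h1)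
    _ ≤ A * (|K| * g) + (∑ i, C i) * g := by gcongr
    _ = _ := by ring

/-- The truncation function of a backward cone, with `s = ±1` the direction of time. -/
def cone (K s t1 τ2 : ℝ) (y : Sp) : Fn := fun p => (K * (τ2 - s * (p.1 - t1)) + 2) - br y p

lemma Sm.cone (K s t1 τ2 : ℝ) (y : Sp) : Sm (cone K s t1 τ2 y) := by
  refine ContDiff.sub ?_ (Sm.br y)
  fun_prop

lemma pd_cone_zero (K s t1 τ2 : ℝ) (y : Sp) (p : Pt) : pd 0 (cone K s t1 τ2 y) p = -K * s := by
  have s1 : Sm (fun p : Pt => K * (τ2 - s * (p.1 - t1)) + 2) := by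
    unfold Sm; fun_prop
  have e : (fun p : Pt => K * (τ2 - s * (p.1 - t1)) + 2)
      = fun p => (K * (τ2 + s * t1) + 2) + (-K * s) * xc 0 p := by
    funext p; rw [xc_zero]; ring
  have := pd_sub s1 (Sm.br y) 0 p
  rw [pd_br_zero, e, pd_add contDiff_const (contDiff_const.mul (Sm.xc _)), pd_const,
    pd_const_mul (Sm.xc _), pd_xc] at this
  change pd 0 (cone K s t1 τ2 y) p = _ at this
  simpa using this

lemma pd_cone_succ (K s t1 τ2 : ℝ) (y : Sp) (j : Fin 3) (p : Pt) :
    pd j.succ (cone K s t1 τ2 y) p = -pd j.succ (br y) p := by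
  have s1 : Sm (fun p : Pt => K * (τ2 - s * (p.1 - t1)) + 2) := by
    unfold Sm; fun_prop
  have e : (fun p : Pt => K * (τ2 - s * (p.1 - t1)) + 2)
      = fun p => (K * (τ2 + s * t1) + 2) + (-K * s) * xc 0 p := by
    funext p; rw [xc_zero]; ring
  have := pd_sub s1 (Sm.br y) j.succ p
  rw [e, pd_add contDiff_const (contDiff_const.mul (Sm.xc _)), pd_const,
    pd_const_mul (Sm.xc _), pd_xc] at this
  change pd j.succ (cone K s t1 τ2 y) p = _ at this
  simpa [Fin.succ_ne_zero] using this

/-- The energy density of the triple. -/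
def eden (c0 : ℝ) (u : Fin 3 → Fn) : Fn := fun p =>
  ∑ i : Fin 3, (1 / 2 : ℝ) * (pd 0 (u i) p ^ 2
    + cspeed c0 i ^ 2 * ∑ j : Fin 3, pd j.succ (u i) p ^ 2)

lemma Sm.eden (c0 : ℝ) {u : Fin 3 → Fn} (hu : ∀ i, Sm (u i)) : Sm (eden c0 u) :=
  ContDiff.sum fun i _ => contDiff_const.mul ((((hu i).pd 0).pow 2).add
    (contDiff_const.mul (ContDiff.sum fun j _ => ((hu i).pd j.succ).pow 2)))

lemma pd_eden (c0 : ℝ) {u : Fin 3 → Fn} (hu : ∀ i, Sm (u i)) (α : Fin 4) (p : Pt) :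
    pd α (eden c0 u) p = ∑ i : Fin 3, (pd 0 (u i) p * pd α (pd 0 (u i)) p
      + cspeed c0 i ^ 2 * ∑ j : Fin 3, pd j.succ (u i) p * pd α (pd j.succ (u i)) p) := by
  unfold eden
  have s1 : ∀ i, Sm fun p => ∑ j : Fin 3, pd j.succ (u i) p ^ 2 := fun i =>
    ContDiff.sum fun j _ => ((hu i).pd j.succ).pow 2
  have s2 : ∀ i, Sm fun p => pd 0 (u i) p ^ 2 := fun i => ((hu i).pd 0).pow 2
  have s3 : ∀ i, Sm fun p => cspeed c0 i ^ 2 * ∑ j : Fin 3, pd j.succ (u i) p ^ 2 := fun i =>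
    contDiff_const.mul (s1 i)
  rw [pd_sum _ fun i _ => contDiff_const.mul ((s2 i).add (s3 i))]
  refine Finset.sum_congr rfl fun i _ => ?_
  rw [pd_const_mul ((s2 i).add (s3 i)), pd_add (s2 i) (s3 i), pd_const_mul (s1 i),
    pd_sum _ fun j _ => ((hu i).pd j.succ).pow 2, pd_sq ((hu i).pd 0)]
  simp only [pd_sq ((hu i).pd _), mul_assoc, ← Finset.mul_sum]
  ring

lemma cspeed_pos {c0 : ℝ} (hc : 0 < c0) (i : Fin 3) : 0 < cspeed c0 i := by
  fin_cases i <;> simp [cspeed, hc]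

lemma eden_nonneg (c0 : ℝ) (u : Fin 3 → Fn) (p : Pt) : 0 ≤ eden c0 u p :=
  Finset.sum_nonneg fun i _ => by positivity

lemma gradSize_le_eden {c0 : ℝ} (hc : 0 < c0) :
    ∃ C, 0 ≤ C ∧ ∀ (u : Fin 3 → Fn) (p : Pt), gradSize u p ^ 2 ≤ C * eden c0 u p := by
  refine ⟨2 * (1 + (c0 ^ 2)⁻¹), by positivity, fun u p => ?_⟩
  have key : ∀ i, ∑ α : Fin 4, pd α (u i) p ^ 2 ≤ 2 * (1 + (c0 ^ 2)⁻¹) * ((1 / 2 : ℝ)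
      * (pd 0 (u i) p ^ 2 + cspeed c0 i ^ 2 * ∑ j : Fin 3, pd j.succ (u i) p ^ 2)) := by
    intro i
    have h1 : 1 ≤ (1 + (c0 ^ 2)⁻¹) * cspeed c0 i ^ 2 := by
      have : 0 < (c0 ^ 2)⁻¹ := by positivity
      have e : (c0 ^ 2)⁻¹ * c0 ^ 2 = 1 := inv_mul_cancel₀ (by positivity)
      fin_cases i <;> simp [cspeed] <;> nlinarith [sq_nonneg c0]
    have h2 : 0 ≤ ∑ j : Fin 3, pd j.succ (u i) p ^ 2 := by positivity
    have h3 : 0 ≤ (c0 ^ 2)⁻¹ := by positivity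
    rw [Fin.sum_univ_succ]
    nlinarith [sq_nonneg (pd 0 (u i) p), mul_le_mul_of_nonneg_right h1 h2,
      mul_nonneg h3 (sq_nonneg (pd 0 (u i) p))]
  rw [gradSize_sq, Fintype.sum_prod_type, eden, Finset.mul_sum]
  exact Finset.sum_le_sum fun i _ => key i

lemma flux_bound {c K : ℝ} (hc : 0 < c) (hK : c ≤ K) (a : ℝ) (b X : Fin 3 → ℝ)
    (hX : ∑ j, X j ^ 2 ≤ 1) :
    |c ^ 2 * (a * ∑ j, X j * b j)| ≤ K * ((1 / 2 : ℝ) * (a ^ 2 + c ^ 2 * ∑ j, b j ^ 2)) := by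
  have h1 : (∑ j, X j * b j) ^ 2 ≤ ∑ j, b j ^ 2 := by
    have := Finset.sum_mul_sq_le_sq_mul_sq Finset.univ X b
    have h0 : 0 ≤ ∑ j, b j ^ 2 := by positivity
    nlinarith
  set y := ∑ j, X j * b j
  have h2 : |c ^ 2 * (a * y)| ≤ c * ((1 / 2 : ℝ) * (a ^ 2 + c ^ 2 * y ^ 2)) := by
    rw [abs_le]
    constructor <;> nlinarith [mul_nonneg hc.le (sq_nonneg (a + c * y)),
      mul_nonneg hc.le (sq_nonneg (a - c * y))]
  refine h2.trans ?_
  have : c ^ 2 * y ^ 2 ≤ c ^ 2 * ∑ j, b j ^ 2 := mul_le_mul_of_nonneg_left h1 (sq_nonneg c)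
  have hK0 : 0 ≤ K := hc.le.trans hK
  gcongr

/-- A local form of uniqueness: vanishing Cauchy data propagate along the cone. -/
lemma propagation {c0 : ℝ} (hc0 : 0 < c0) {F : Coef}
    {Cub : Fin 3 → MvPolynomial (Fin 3 × Fin 4) ℝ} (hC : ∀ i, CubicLike (Cub i))
    {I : Set ℝ} {u : Fin 3 → Fn} (hu : ∀ i, Sm (u i)) (hsol : IsSolutionOn c0 F Cub u I)
    {s t1 τ2 K : ℝ} (hs : s ^ 2 = 1) (hτ : 0 ≤ τ2) (hK1 : 1 ≤ K) (hK : c0 ≤ K) (y : Sp)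
    (hI : ∀ τ ∈ Icc 0 τ2, t1 + s * τ ∈ I)
    (h0 : ∀ x : Sp, ‖x - y‖ < K * τ2 + 2 → ∀ i α, pd α (u i) (t1, x) = 0) (i : Fin 3) (α : Fin 4) :
    pd α (u i) (t1 + s * τ2, y) = 0 := by
  set φ : ℝ → ℝ := expNegInvGlue with hφ
  have hφs : ContDiff ℝ (⊤ : ℕ∞) φ := expNegInvGlue.contDiff
  have hφd : Differentiable ℝ φ := hφs.differentiable (by simp)
  have hφ' : ∀ z, 0 ≤ deriv φ z := fun z => expNegInvGlue.monotone.deriv_nonneg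
  set X : Fn := cone K s t1 τ2 y with hX
  have sX : Sm X := Sm.cone ..
  have sφ : Sm fun p => φ (X p) := hφs.comp sX
  set e : Fn := eden c0 u with he
  have se : Sm e := Sm.eden c0 hu
  set G : Fn := fun p => φ (X p) * e p with hG
  have sG : Sm G := sφ.mul se
  have hKi : ∀ i, cspeed c0 i ≤ K := by
    intro i; fin_cases i <;> simp [cspeed, hK1, hK]
  -- supports
  have scφ : ∀ t, SC t fun p => φ (X p) := by
    intro t
    refine ⟨K * (τ2 - s * (t - t1)) + 3 + ‖y‖, ?_⟩
    have : ∀ᶠ r in nhds t, K * (τ2 - s * (r - t1)) + 2 < K * (τ2 - s * (t - t1)) + 3 := by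
      have hc : Continuous fun r : ℝ => K * (τ2 - s * (r - t1)) + 2 := by fun_prop
      exact hc.continuousAt.eventually (gt_mem_nhds (by linarith))
    filter_upwards [this] with r hr x hx
    refine expNegInvGlue.zero_of_nonpos ?_
    have h1 := norm_le_br y (r, x)
    have h2 := norm_sub_norm_le x y
    simp only [hX, cone] at *
    linarith
  have scG : ∀ t, SC t G := fun t => (scφ t).mul_right _
  have sW : ∀ i (j : Fin 3), Sm fun p => φ (X p) * (pd 0 (u i) p * pd j.succ (u i) p) := fun i j =>
    sφ.mul (((hu i).pd 0).mul ((hu i).pd j.succ))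
  set E : ℝ → ℝ := fun t => ∫ x : Sp, G (t, x) with hE
  have hE' : ∀ t, HasDerivAt E (∫ x : Sp, pd 0 G (t, x)) t := fun t => hasDerivAt_integral sG (scG t)
  -- the corrected derivative
  set D : Fn := fun p => s * pd 0 G p - ∑ i : Fin 3, ∑ j : Fin 3, s * cspeed c0 i ^ 2 *
    pd j.succ (fun q => φ (X q) * (pd 0 (u i) q * pd j.succ (u i) q)) p with hD
  have hDint : ∀ t, s * ∫ x : Sp, pd 0 G (t, x) = ∫ x : Sp, D (t, x) := by
    intro t
    have i1 := ((scG t).pd 0).integrable (sG.pdc 0)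
    have i2 : ∀ i (j : Fin 3), Integrable fun x : Sp => s * cspeed c0 i ^ 2 *
        pd j.succ (fun q => φ (X q) * (pd 0 (u i) q * pd j.succ (u i) q)) (t, x) := fun i j =>
      ((((scφ t).mul_right _).pd j.succ).integrable ((sW i j).pdc _)).const_mul _
    simp only [hD]
    rw [integral_sub (i1.const_mul s) (integrable_finsetSum _ fun i _ =>
      integrable_finsetSum _ fun j _ => i2 i j), integral_const_mul,
      integral_finsetSum _ fun i _ => integrable_finsetSum _ fun j _ => i2 i j]
    have : ∀ i, ∫ x : Sp, ∑ j : Fin 3, s * cspeed c0 i ^ 2 *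
        pd j.succ (fun q => φ (X q) * (pd 0 (u i) q * pd j.succ (u i) q)) (t, x) = 0 := by
      intro i
      rw [integral_finsetSum _ fun j _ => i2 i j]
      refine Finset.sum_eq_zero fun j _ => ?_
      rw [integral_const_mul, integral_px (sW i j) ((scφ t).mul_right _), mul_zero]
    simp [this]
  -- pointwise formula
  have hDeq : ∀ p, D p = -K * (deriv φ (X p) * e p) + s * (deriv φ (X p) * ∑ i : Fin 3,
      cspeed c0 i ^ 2 * (pd 0 (u i) p * ∑ j : Fin 3, pd j.succ (br y) p * pd j.succ (u i) p))
      + s * (φ (X p) * ∑ i : Fin 3, pd 0 (u i) p * boxOp (cspeed c0 i) (u i) p) := by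
    intro p
    have w : ∀ i (j : Fin 3), pd j.succ (fun q => φ (X q) * (pd 0 (u i) q * pd j.succ (u i) q)) p
        = -(deriv φ (X p) * pd j.succ (br y) p) * (pd 0 (u i) p * pd j.succ (u i) p)
        + φ (X p) * (pd 0 (pd j.succ (u i)) p * pd j.succ (u i) p
          + pd 0 (u i) p * pd j.succ (pd j.succ (u i)) p) := by
      intro i j
      rw [pd_mul sφ (((hu i).pd 0).mul ((hu i).pd j.succ)), pd_comp hφd sX,
        pd_mul ((hu i).pd 0) ((hu i).pd j.succ), hX, pd_cone_succ, pd_comm (hu i) j.succ 0]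
      ring
    have g : pd 0 G p = deriv φ (X p) * (-K * s) * e p + φ (X p) * pd 0 e p := by
      rw [hG, pd_mul sφ se, pd_comp hφd sX, hX, pd_cone_zero]
    simp only [hD, w, g]
    rw [he, pd_eden c0 hu]
    simp only [boxOp_eq, Fin.sum_univ_three]
    linear_combination (-(deriv φ (X p) * K * eden c0 u p)) * hs
  -- compactness bound
  obtain ⟨Cg, hCg0, hCg⟩ := gradSize_le_eden hc0
  have hK0 : 0 ≤ K := by linarith
  obtain ⟨Kb, hKb⟩ := ((isCompact_Icc (a := (0 : ℝ)) (b := τ2)).prod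
    (isCompact_closedBall y (K * τ2 + 2))).exists_bound_of_continuousOn
    (f := fun q : ℝ × Sp => gradSize u (t1 + s * q.1, q.2))
    ((gradSize_continuous hu).comp (by fun_prop)).continuousOn
  obtain ⟨Cr, hCr0, hCr⟩ := rhs_bound F Cub hC Kb
  set C := 3 * Cr * Cg with hCdef
  have hDle : ∀ τ ∈ Icc 0 τ2, ∀ x : Sp, D (t1 + s * τ, x) ≤ C * G (t1 + s * τ, x) := by
    intro τ hτ' x
    set p : Pt := (t1 + s * τ, x) with hp
    have hXp : X p = K * (τ2 - τ) + 2 - br y p := by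
      simp only [hX, cone, hp]
      linear_combination (-K * τ) * hs
    have hφ0 : 0 ≤ φ (X p) := expNegInvGlue.nonneg _
    have he0 : 0 ≤ e p := eden_nonneg c0 u p
    rw [hDeq]
    have a1 : s * (deriv φ (X p) * ∑ i : Fin 3, cspeed c0 i ^ 2 *
        (pd 0 (u i) p * ∑ j : Fin 3, pd j.succ (br y) p * pd j.succ (u i) p))
        ≤ K * (deriv φ (X p) * e p) := by
      have hs1 : |s| = 1 := by rw [← Real.sqrt_sq_eq_abs, hs, Real.sqrt_one]
      refine (le_abs_self _).trans ?_
      rw [abs_mul, hs1, one_mul, abs_mul, abs_of_nonneg (hφ' _), mul_left_comm]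
      refine mul_le_mul_of_nonneg_left ?_ (hφ' _)
      refine (Finset.abs_sum_le_sum_abs _ _).trans ?_
      simp only [he, eden]
      rw [Finset.mul_sum]
      exact Finset.sum_le_sum fun i _ => flux_bound (cspeed_pos hc0 i) (hKi i) _ _ _
        (sum_pd_br_sq y p)
    have a2 : s * (φ (X p) * ∑ i : Fin 3, pd 0 (u i) p * boxOp (cspeed c0 i) (u i) p)
        ≤ C * (φ (X p) * e p) := by
      by_cases hx : X p ≤ 0
      · rw [show φ (X p) = 0 from expNegInvGlue.zero_of_nonpos hx]; simp
      · have hx' : ‖x - y‖ ≤ K * τ2 + 2 := by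
          have := norm_le_br y p
          have h3 : 0 ≤ K * τ := mul_nonneg hK0 hτ'.1
          rw [hXp] at hx
          simp only [hp] at this hx
          linarith
        have hg : gradSize u p ≤ Kb :=
          (le_abs_self _).trans (hKb (τ, x) ⟨hτ', by simpa [dist_eq_norm] using hx'⟩)
        have hb : ∀ i, |pd 0 (u i) p * boxOp (cspeed c0 i) (u i) p| ≤ Cr * (Cg * e p) := by
          intro i
          rw [hsol i _ (hI τ hτ') x, abs_mul]
          have b1 := pd_le_gradSize u p (i, 0)
          have b2 := hCr u p hg i
          have b3 := gradSize_nonneg u p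
          calc |pd 0 (u i) p| * |rhs F Cub u i p| ≤ gradSize u p * (Cr * gradSize u p) := by
                gcongr
            _ = Cr * gradSize u p ^ 2 := by ring
            _ ≤ _ := mul_le_mul_of_nonneg_left (hCg u p) hCr0
        have hs1 : |s| = 1 := by rw [← Real.sqrt_sq_eq_abs, hs, Real.sqrt_one]
        refine (le_abs_self _).trans ?_
        rw [abs_mul, hs1, one_mul, abs_mul, abs_of_nonneg hφ0, mul_left_comm]
        refine mul_le_mul_of_nonneg_left ?_ hφ0
        refine (Finset.abs_sum_le_sum_abs _ _).trans ((Finset.sum_le_sum fun i _ => hb i).trans ?_)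
        simp [hCdef]; linarith
    simp only [hG]
    linarith
  -- Gronwall
  have hf' : ∀ τ, HasDerivAt (fun τ => E (t1 + s * τ)) (∫ x : Sp, D (t1 + s * τ, x)) τ := by
    intro τ
    have h1 : HasDerivAt (fun τ : ℝ => t1 + s * τ) s τ := by
      simpa using ((hasDerivAt_id τ).const_mul s).const_add t1
    have := (hE' (t1 + s * τ)).comp τ h1
    rwa [mul_comm, hDint] at this
  have hle : ∀ τ ∈ Icc 0 τ2, ∫ x : Sp, D (t1 + s * τ, x) ≤ C * E (t1 + s * τ) := by
    intro τ hτ'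
    rw [hE]
    simp only
    rw [← integral_const_mul]
    refine integral_mono ?_ (((scG _).integrable sG.continuous).const_mul C) (hDle τ hτ')
    exact Integrable.sub ((((scG _).pd 0).integrable (sG.pdc 0)).const_mul s)
      (integrable_finsetSum _ fun i _ => integrable_finsetSum _ fun j _ =>
        ((((scφ _).mul_right _).pd j.succ).integrable ((sW i j).pdc _)).const_mul _)
  have hg' : ∀ τ, HasDerivAt (fun τ => E (t1 + s * τ) * Real.exp (-C * τ))
      ((∫ x : Sp, D (t1 + s * τ, x)) * Real.exp (-C * τ)
        + E (t1 + s * τ) * (Real.exp (-C * τ) * (-C))) τ := by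
    intro τ
    refine (hf' τ).mul ?_
    have h1 : HasDerivAt (fun τ : ℝ => -C * τ) (-C) τ := by
      simpa using (hasDerivAt_id τ).const_mul (-C)
    exact h1.exp
  have hanti : AntitoneOn (fun τ => E (t1 + s * τ) * Real.exp (-C * τ)) (Icc 0 τ2) := by
    refine antitoneOn_of_deriv_nonpos (convex_Icc _ _)
      (fun τ _ => (hg' τ).continuousAt.continuousWithinAt)
      (fun τ _ => (hg' τ).differentiableAt.differentiableWithinAt) fun τ hτ' => ?_
    rw [interior_Icc] at hτ'
    rw [(hg' τ).deriv]
    have := hle τ (Ioo_subset_Icc_self hτ')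
    nlinarith [Real.exp_pos (-C * τ)]
  have hE0 : E t1 = 0 := by
    have : ∀ x : Sp, G (t1, x) = 0 := by
      intro x
      by_cases hx : ‖x - y‖ < K * τ2 + 2
      · have : e (t1, x) = 0 := by simp [he, eden, h0 x hx]
        simp [hG, this]
      · have : φ (X (t1, x)) = 0 := by
          refine expNegInvGlue.zero_of_nonpos ?_
          have := norm_le_br y (t1, x)
          simp only [hX, cone] at *
          linarith
        simp [hG, this]
    simp [hE, this]
  have hGnn : ∀ p, 0 ≤ G p := fun p => mul_nonneg (expNegInvGlue.nonneg _) (eden_nonneg c0 u p)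
  have hEτ : E (t1 + s * τ2) = 0 := by
    have h1 := hanti (left_mem_Icc.2 hτ) (right_mem_Icc.2 hτ) hτ
    simp only [mul_zero, add_zero, hE0, zero_mul] at h1
    have h2 : 0 ≤ E (t1 + s * τ2) := integral_nonneg fun x => hGnn _
    have h3 := Real.exp_pos (-C * τ2)
    nlinarith
  have hG0 : G (t1 + s * τ2, y) = 0 := by
    have h1 := (integral_eq_zero_iff_of_nonneg (fun x => hGnn (t1 + s * τ2, x))
      ((scG _).integrable sG.continuous)).1 hEτ
    have h2 := (continuous_slice sG.continuous _).ae_eq_iff_eq (μ := (volume : Measure Sp))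
      continuous_const |>.1 h1
    exact congrFun h2 y
  have hφ1 : 0 < φ (X (t1 + s * τ2, y)) := by
    refine expNegInvGlue.pos_of_pos ?_
    have h1 : br y (t1 + s * τ2, y) = 1 := by rw [br_eq]; simp
    simp only [hX, cone, h1]
    have : K * (τ2 - s * (t1 + s * τ2 - t1)) = 0 := by linear_combination (-K * τ2) * hs
    linarith
  have he0 : e (t1 + s * τ2, y) = 0 := by
    rcases mul_eq_zero.1 hG0 with h | h
    · exact absurd h hφ1.ne'
    · exact h
  have h5 := hCg u (t1 + s * τ2, y)
  rw [← he, he0, mul_zero] at h5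
  have h6 := pd_le_gradSize u (t1 + s * τ2, y) (i, α)
  have h7 : gradSize u (t1 + s * τ2, y) = 0 := by
    have := gradSize_nonneg u (t1 + s * τ2, y)
    nlinarith
  rw [h7] at h6
  exact abs_nonpos_iff.1 h6

/-- Finite propagation speed makes the spatial supports locally uniform in time. -/
lemma LocalSolution.sc {c0 : ℝ} (hc0 : 0 < c0) {F : Coef}
    {Cub : Fin 3 → MvPolynomial (Fin 3 × Fin 4) ℝ} (hC : ∀ i, CubicLike (Cub i))
    {T : ℝ} {u : Fin 3 → Fn} (h : LocalSolution c0 F Cub T u) {t : ℝ} (ht : t ∈ Ioo 0 T)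
    (i : Fin 3) : SC t (u i) := by
  obtain ⟨hu, hcs, hsol⟩ := h
  -- Baire
  set B : ℕ → Set ℝ := fun n => {r | ∀ i, ∀ x : Sp, (n : ℝ) < ‖x‖ → u i (r, x) = 0} with hB
  have hBc : ∀ n, IsClosed (B n) := by
    intro n
    simp only [hB, ofPred_forall]
    refine isClosed_iInter fun i => isClosed_iInter fun x => isClosed_iInter fun _ => ?_
    exact isClosed_eq ((hu i).continuous.comp (by fun_prop)) continuous_const
  have hBu : ⋃ n, B n = univ := by
    refine eq_univ_of_forall fun r => mem_iUnion.2 ?_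
    have : ∀ i, ∃ R : ℝ, ∀ x : Sp, R < ‖x‖ → u i (r, x) = 0 := by
      intro i
      obtain ⟨R, hR⟩ := (hcs i r).isCompact.isBounded.subset_closedBall (0 : Sp)
      refine ⟨R, fun x hx => ?_⟩
      by_contra hne
      have := hR (subset_tsupport _ hne)
      rw [mem_closedBall_zero_iff] at this
      linarith
    choose R hR using this
    obtain ⟨n, hn⟩ := exists_nat_gt (∑ i, |R i|)
    refine ⟨n, fun i x hx => hR i x ?_⟩
    have := Finset.single_le_sum (f := fun i => |R i|) (fun _ _ => abs_nonneg _) (Finset.mem_univ i)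
    have := le_abs_self (R i)
    linarith
  obtain ⟨t1, ht1, ht1'⟩ := (dense_iUnion_interior_of_closed hBc hBu).inter_open_nonempty
    (Ioo 0 T) isOpen_Ioo ⟨t, ht⟩
  obtain ⟨n, hn⟩ := mem_iUnion.1 ht1'
  have hsc1 : ∀ i, SC t1 (u i) := fun i => ⟨n, by
    filter_upwards [mem_interior_iff_mem_nhds.1 hn] with r hr x hx
    exact hr i x hx⟩
  choose R hR using fun q : Fin 3 × Fin 4 => (hsc1 q.1).pd q.2
  set R0 := ∑ q, |R q| with hR0
  have hz1 : ∀ x : Sp, R0 < ‖x‖ → ∀ i α, pd α (u i) (t1, x) = 0 := by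
    intro x hx i α
    refine (hR (i, α)).self_of_nhds x (lt_of_le_of_lt ?_ hx)
    exact (le_abs_self _).trans (Finset.single_le_sum (f := fun q => |R q|)
      (fun _ _ => abs_nonneg _) (Finset.mem_univ (i, α)))
  set K := max 1 c0 with hK
  have hK1 : 1 ≤ K := le_max_left _ _
  have hz : ∀ y : Sp, R0 + K * T + 2 < ‖y‖ → ∀ r ∈ Ioo 0 T, ∀ i α, pd α (u i) (r, y) = 0 := by
    intro y hy r hr i α
    have core : ∀ s : ℝ, s ^ 2 = 1 → ∀ τ2, 0 ≤ τ2 → t1 + s * τ2 = r → τ2 ≤ T →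
        pd α (u i) (r, y) = 0 := by
      intro s hs τ2 hτ hrs hτT
      rw [← hrs]
      refine propagation hc0 hC hu hsol hs hτ hK1 (le_max_right _ _) y ?_ ?_ i α
      · intro τ hτ'
        rcases sq_eq_one_iff.1 hs with rfl | rfl
        · constructor <;> nlinarith [ht1.1, ht1.2, hr.1, hr.2, hτ'.1, hτ'.2]
        · constructor <;> nlinarith [ht1.1, ht1.2, hr.1, hr.2, hτ'.1, hτ'.2]
      · intro x hx
        refine hz1 x ?_
        have h1 := norm_sub_norm_le y x
        rw [norm_sub_rev] at h1
        have h2 : K * τ2 ≤ K * T := mul_le_mul_of_nonneg_left hτT (by linarith)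
        linarith
    rcases le_total t1 r with hle | hle
    · exact core 1 (by norm_num) (r - t1) (by linarith) (by ring) (by linarith [hr.2, ht1.1])
    · exact core (-1) (by norm_num) (t1 - r) (by linarith) (by ring) (by linarith [hr.1, ht1.2])
  refine ⟨max n (R0 + K * T + 2), ?_⟩
  filter_upwards [Ioo_mem_nhds ht.1 ht.2] with r hr y hy
  have hy1 := lt_of_le_of_lt (le_max_left _ _) hy
  have hy2 := lt_of_le_of_lt (le_max_right _ _) hy
  have h0 : u i (t1, y) = 0 := (interior_subset hn) i y hy1
  rw [← h0]
  refine isOpen_Ioo.is_const_of_deriv_eq_zero (𝕜 := ℝ) (f := fun r => u i (r, y)) (s := Ioo 0 T)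
    isPreconnected_Ioo
    (fun r _ => (hasDerivAt_time (hu i) r y).differentiableAt.differentiableWithinAt)
    (fun r hr => ?_) hr ht1
  rw [(hasDerivAt_time (hu i) r y).deriv, hz y hy2 r hr]
  rfl

/-- Continuous functions with locally uniform spatial supports. -/
structure CS (t : ℝ) (f : Fn) : Prop where
  cont : Continuous f
  sc : SC t f

lemma CS.int {t : ℝ} {f : Fn} (h : CS t f) : Integrable fun x : Sp => f (t, x) :=
  h.sc.integrable h.cont

lemma CS.add {t : ℝ} {f g : Fn} (hf : CS t f) (hg : CS t g) : CS t fun p => f p + g p :=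
  ⟨hf.cont.add hg.cont, hf.sc.add hg.sc⟩

lemma CS.mul_left {t : ℝ} {f g : Fn} (hf : CS t f) (hg : Continuous g) : CS t fun p => g p * f p :=
  ⟨hg.mul hf.cont, hf.sc.mul_left g⟩

lemma CS.mul_right {t : ℝ} {f g : Fn} (hf : CS t f) (hg : Continuous g) :
    CS t fun p => f p * g p :=
  ⟨hf.cont.mul hg, hf.sc.mul_right g⟩

lemma CS.const_mul {t : ℝ} {f : Fn} (hf : CS t f) (c : ℝ) : CS t fun p => c * f p :=
  hf.mul_left continuous_const

lemma CS.sq {t : ℝ} {f : Fn} (hf : CS t f) : CS t fun p => f p ^ 2 :=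
  ⟨hf.cont.pow 2, hf.sc.mono fun p hp => by simp [hp]⟩

lemma CS.sum {t : ℝ} {ι : Type*} (s : Finset ι) {f : ι → Fn} (hf : ∀ i ∈ s, CS t (f i)) :
    CS t fun p => ∑ i ∈ s, f i p :=
  ⟨continuous_finsetSum s fun i hi => (hf i hi).cont, SC.sum s fun i hi => (hf i hi).sc⟩

lemma CS.pd {t : ℝ} {v : Fn} (hv : Sm v) (hs : SC t v) (α : Fin 4) : CS t (pd α v) :=
  ⟨hv.pdc α, hs.pd α⟩

lemma CS.of_sm {t : ℝ} {v : Fn} (hv : Sm v) (hs : SC t v) : CS t v := ⟨hv.continuous, hs⟩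

/-- The integral over a time slice. -/
def In (t : ℝ) (f : Fn) : ℝ := ∫ x : Sp, f (t, x)

lemma In_mono {t : ℝ} {f g : Fn} (hf : CS t f) (hg : CS t g) (h : ∀ x, f (t, x) ≤ g (t, x)) :
    In t f ≤ In t g :=
  integral_mono hf.int hg.int h

lemma In_nonneg {t : ℝ} {f : Fn} (h : ∀ p, 0 ≤ f p) : 0 ≤ In t f := integral_nonneg fun _ => h _

lemma In_add {t : ℝ} {f g : Fn} (hf : CS t f) (hg : CS t g) :
    In t (fun p => f p + g p) = In t f + In t g :=
  integral_add hf.int hg.int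

lemma In_const_mul (t c : ℝ) (f : Fn) : In t (fun p => c * f p) = c * In t f :=
  integral_const_mul _ _

lemma In_sum {t : ℝ} {ι : Type*} (s : Finset ι) {f : ι → Fn} (hf : ∀ i ∈ s, CS t (f i)) :
    In t (fun p => ∑ i ∈ s, f i p) = ∑ i ∈ s, In t (f i) :=
  integral_finsetSum s fun i hi => (hf i hi).int

lemma In_pd {v : Fn} (h : Sm v) {t : ℝ} (hs : SC t v) (j : Fin 3) : In t (pd j.succ v) = 0 :=
  integral_px h hs j

lemma abs_coord_le (x : Sp) (k : Fin 3) : |x k| ≤ ‖x‖ := by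
  have := PiLp.norm_apply_le x k
  rwa [Real.norm_eq_abs] at this

lemma rot_bound {v : Fn} {p : Pt} {q : ℝ} (h : ∀ l, |Zop l v p| ≤ q) (k j : Fin 3) :
    |p.2 k * pd j.succ v p - p.2 j * pd k.succ v p| ≤ q := by
  have h0 : 0 ≤ q := (abs_nonneg _).trans (h 0)
  have h3 := h 3
  have h4 := h 4
  have h5 := h 5
  change |p.2 0 * pd (Fin.succ 1) v p - p.2 1 * pd (Fin.succ 0) v p| ≤ q at h3
  change |p.2 1 * pd (Fin.succ 2) v p - p.2 2 * pd (Fin.succ 1) v p| ≤ q at h4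
  change |p.2 0 * pd (Fin.succ 2) v p - p.2 2 * pd (Fin.succ 0) v p| ≤ q at h5
  fin_cases k <;> fin_cases j <;> first
    | simpa using h0
    | exact h3
    | exact h4
    | exact h5
    | (rw [abs_sub_comm]; exact h3)
    | (rw [abs_sub_comm]; exact h4)
    | (rw [abs_sub_comm]; exact h5)

lemma Zop_six (v : Fn) (p : Pt) :
    Zop 6 v p = p.1 * pd 0 v p + ∑ j : Fin 3, p.2 j * pd j.succ v p := rfl

lemma px_bound {v : Fn} {p : Pt} {q : ℝ} (h : ∀ l, |Zop l v p| ≤ q) (j : Fin 3) :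
    |pd j.succ v p| ≤ q := by
  fin_cases j
  · exact h 0
  · exact h 1
  · exact h 2

lemma abs_sum_fin3_le {f : Fin 3 → ℝ} {B : ℝ} (h : ∀ j, |f j| ≤ B) : |∑ j, f j| ≤ 3 * B := by
  refine (Finset.abs_sum_le_sum_abs _ _).trans ((Finset.sum_le_sum fun j _ => h j).trans ?_)
  simp

/-- The Laplacian. -/
def lap (v : Fn) : Fn := fun p => ∑ j : Fin 3, pd j.succ (pd j.succ v) p

/-- The pointwise Klainerman–Sideris inequality. -/
lemma ks_pointwise {c : ℝ} (hc : 0 < c) : ∃ C, 0 ≤ C ∧ ∀ (v : Fn), Sm v → ∀ p : Pt, 0 < p.1 →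
    ∀ q, (∀ l α, |Zop l (pd α v) p| ≤ q) → p.1 * |boxOp c v p| ≤ q →
    |c * p.1 - ‖p.2‖| * |lap v p| ≤ C * q ∧
    ∀ j : Fin 3, |c * p.1 - ‖p.2‖| * |pd 0 (pd j.succ v) p| ≤ C * q := by
  refine ⟨(14 + 4 * c ^ 2) * (1 + c⁻¹), by positivity, fun v hv p hp q hZ hB => ?_⟩
  obtain ⟨t, x⟩ := p
  simp only at hp hB ⊢
  have hq : 0 ≤ q := (abs_nonneg _).trans (hZ 0 0)
  set r := ‖x‖ with hr
  have hr0 : 0 ≤ r := norm_nonneg x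
  have hr2 : r ^ 2 = ∑ k : Fin 3, x k ^ 2 := norm_sq_sp x
  have hx : ∀ k, |x k| ≤ r := abs_coord_le x
  have hpos : 0 < c * t + r := by positivity
  have hcomp : t + r ≤ (1 + c⁻¹) * (c * t + r) := by
    have e : (1 + c⁻¹) * (c * t + r) = t + r + (c * t + c⁻¹ * r) := by field_simp; ring
    rw [e]
    have : 0 ≤ c * t + c⁻¹ * r := by positivity
    linarith
  have fin : ∀ z : ℝ, |(c ^ 2 * t ^ 2 - r ^ 2) * z| ≤ (14 + 4 * c ^ 2) * (t + r) * q →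
      |c * t - r| * |z| ≤ (14 + 4 * c ^ 2) * (1 + c⁻¹) * q := by
    intro z hz
    have e : (c ^ 2 * t ^ 2 - r ^ 2) * z = (c * t + r) * ((c * t - r) * z) := by ring
    rw [e, abs_mul, abs_of_pos hpos, abs_mul] at hz
    refine le_of_mul_le_mul_left (hz.trans ?_) hpos
    calc (14 + 4 * c ^ 2) * (t + r) * q ≤ (14 + 4 * c ^ 2) * ((1 + c⁻¹) * (c * t + r)) * q := by
          gcongr
      _ = _ := by ring
  set O : Fin 3 → Fin 3 → Fin 4 → ℝ := fun k j α =>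
    x k * pd j.succ (pd α v) (t, x) - x j * pd k.succ (pd α v) (t, x) with hO
  have hOb : ∀ k j α, |O k j α| ≤ q := fun k j α =>
    rot_bound (v := pd α v) (p := (t, x)) (fun l => hZ l α) k j
  set f : Fin 4 → ℝ := fun α => Zop 6 (pd α v) (t, x) with hf
  have hfb : ∀ α, |f α| ≤ q := fun α => hZ 6 α
  have xb : ∀ k (z : ℝ), |z| ≤ q → |x k * z| ≤ r * q := by
    intro k z hz
    rw [abs_mul]
    exact mul_le_mul (hx k) hz (abs_nonneg _) hr0
  have tb : ∀ (z : ℝ), |z| ≤ q → |t * z| ≤ t * q := by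
    intro z hz
    rw [abs_mul, abs_of_pos hp]
    gcongr
  have hB' : |t * boxOp c v (t, x)| ≤ q := by rwa [abs_mul, abs_of_pos hp]
  constructor
  · apply fin
    have id1 : (c ^ 2 * t ^ 2 - r ^ 2) * lap v (t, x) = t * f 0 - ∑ j : Fin 3, x j * f j.succ
        - t * (t * boxOp c v (t, x)) - ∑ j : Fin 3, ∑ k : Fin 3, x k * O k j j.succ := by
      simp only [hf, hO, lap, Zop_six, boxOp_eq, Fin.sum_univ_three, hr2]
      rw [pd_comm hv 0 (Fin.succ 0), pd_comm hv 0 (Fin.succ 1), pd_comm hv 0 (Fin.succ 2)]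
      ring
    rw [id1]
    have b1 := tb _ (hfb 0)
    have b2 : |∑ j : Fin 3, x j * f j.succ| ≤ 3 * (r * q) :=
      abs_sum_fin3_le fun j => xb j _ (hfb _)
    have b3 := tb _ hB'
    have b4 : |∑ j : Fin 3, ∑ k : Fin 3, x k * O k j j.succ| ≤ 3 * (3 * (r * q)) :=
      abs_sum_fin3_le fun j => abs_sum_fin3_le fun k => xb k _ (hOb _ _ _)
    have p1 : 0 ≤ c ^ 2 * (t * q) := by positivity
    have p2 : 0 ≤ c ^ 2 * (r * q) := by positivity
    have p3 : 0 ≤ t * q := by positivity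
    have p4 : 0 ≤ r * q := by positivity
    rw [abs_le] at *
    constructor <;> nlinarith
  · intro j
    apply fin
    have id2 : (c ^ 2 * t ^ 2 - r ^ 2) * pd 0 (pd j.succ v) (t, x) = c ^ 2 * (t * f j.succ)
        - x j * f 0 + x j * (t * boxOp c v (t, x))
        - c ^ 2 * ∑ k : Fin 3, t * O k j k.succ - ∑ k : Fin 3, x k * O k j 0 := by
      simp only [hf, hO, Zop_six, boxOp_eq, Fin.sum_univ_three, hr2]
      rw [pd_comm hv 0 j.succ, pd_comm hv j.succ (Fin.succ 0), pd_comm hv j.succ (Fin.succ 1),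
        pd_comm hv j.succ (Fin.succ 2)]
      ring
    rw [id2]
    have b1 := tb _ (hfb j.succ)
    have b2 := xb j _ (hfb 0)
    have b3 := xb j _ hB'
    have b4 : |∑ k : Fin 3, t * O k j k.succ| ≤ 3 * (t * q) :=
      abs_sum_fin3_le fun k => tb _ (hOb _ _ _)
    have b5 : |∑ k : Fin 3, x k * O k j 0| ≤ 3 * (r * q) :=
      abs_sum_fin3_le fun k => xb k _ (hOb _ _ _)
    have c2 : 0 ≤ c ^ 2 := by positivity
    have p2 : 0 ≤ c ^ 2 * (r * q) := by positivity
    have p3 : 0 ≤ t * q := by positivity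
    have p4 : 0 ≤ r * q := by positivity
    have b1' : |c ^ 2 * (t * f j.succ)| ≤ c ^ 2 * (t * q) := by
      rw [abs_mul, abs_of_nonneg c2]; gcongr
    have b4' : |c ^ 2 * ∑ k : Fin 3, t * O k j k.succ| ≤ c ^ 2 * (3 * (t * q)) := by
      rw [abs_mul, abs_of_nonneg c2]; gcongr
    rw [abs_le] at *
    constructor <;> nlinarith

/-- A smooth weight comparable to `⟨ct − r⟩²`. -/
def psi (c : ℝ) : Fn := fun p => 1 + (c * p.1 - br 0 p) ^ 2

lemma Sm.psi (c : ℝ) : Sm (psi c) :=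
  contDiff_const.add (((contDiff_const.mul contDiff_fst).sub (Sm.br 0)).pow 2)

lemma one_le_psi (c : ℝ) (p : Pt) : 1 ≤ psi c p := by
  unfold psi; nlinarith [sq_nonneg (c * p.1 - br 0 p)]

lemma psi_pos (c : ℝ) (p : Pt) : 0 < psi c p := lt_of_lt_of_le one_pos (one_le_psi c p)

lemma jb_sq (x : ℝ) : jb x ^ 2 = 1 + x ^ 2 := Real.sq_sqrt (by positivity)

lemma one_le_jb (x : ℝ) : 1 ≤ jb x := Real.one_le_sqrt.2 (by nlinarith [sq_nonneg x])

lemma jb_pos (x : ℝ) : 0 < jb x := lt_of_lt_of_le one_pos (one_le_jb x)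

lemma br_sub_norm (p : Pt) : 0 ≤ br 0 p - ‖p.2‖ ∧ br 0 p - ‖p.2‖ ≤ 1 := by
  have h1 := norm_le_br 0 p
  have h2 := br_le 0 p
  rw [sub_zero] at h1 h2
  constructor <;> linarith

lemma psi_le (c : ℝ) (p : Pt) : psi c p ≤ 3 * jb (c * p.1 - ‖p.2‖) ^ 2 := by
  obtain ⟨h1, h2⟩ := br_sub_norm p
  rw [jb_sq]
  unfold psi
  nlinarith [sq_nonneg ((c * p.1 - ‖p.2‖) + (br 0 p - ‖p.2‖)), sq_nonneg (c * p.1 - ‖p.2‖)]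

lemma le_psi (c : ℝ) (p : Pt) : jb (c * p.1 - ‖p.2‖) ^ 2 ≤ 3 * psi c p := by
  obtain ⟨h1, h2⟩ := br_sub_norm p
  rw [jb_sq]
  unfold psi
  nlinarith [sq_nonneg ((c * p.1 - br 0 p) - (br 0 p - ‖p.2‖)), sq_nonneg (c * p.1 - br 0 p)]

lemma pd_psi_succ (c : ℝ) (j : Fin 3) (p : Pt) :
    pd j.succ (psi c) p = -2 * (c * p.1 - br 0 p) * pd j.succ (br 0) p := by
  have s0 : Sm (fun q : Pt => c * xc 0 q) := contDiff_const.mul (Sm.xc 0)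
  have s1 : Sm (fun q : Pt => c * xc 0 q - br 0 q) := s0.sub (Sm.br 0)
  have s2 : Sm (fun q : Pt => (c * xc 0 q - br 0 q) ^ 2) := s1.pow 2
  have e : psi c = fun q => 1 + (c * xc 0 q - br 0 q) ^ 2 := rfl
  rw [e, pd_add contDiff_const s2, pd_const, pd_sq s1, pd_sub s0 (Sm.br 0),
    pd_const_mul (Sm.xc 0), pd_xc]
  simp [xc_zero]

/-- The weighted elliptic estimate. -/
lemma elliptic {c t : ℝ} {v : Fn} (hv : Sm v) (hs : SC t v) :
    In t (fun p => psi c p * ∑ i : Fin 3, ∑ j : Fin 3, pd i.succ (pd j.succ v) p ^ 2)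
      ≤ 4 * In t (fun p => psi c p * lap v p ^ 2) + 6 * In t (fun p => ∑ j : Fin 3, pd j.succ v p ^ 2) := by
  have sψ := Sm.psi c
  have s1 : ∀ j : Fin 3, Sm (pd j.succ v) := fun j => hv.pd _
  have s2 : ∀ i j : Fin 3, Sm (pd i.succ (pd j.succ v)) := fun i j => (s1 j).pd _
  have c2 : ∀ i j : Fin 3, CS t (pd i.succ (pd j.succ v)) := fun i j =>
    CS.of_sm (s2 i j) ((hs.pd _).pd _)
  have c1 : ∀ j : Fin 3, CS t (pd j.succ v) := fun j => CS.of_sm (s1 j) (hs.pd _)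
  set A : Fin 3 → Fin 3 → Fn := fun i j p => psi c p * (pd j.succ v p * pd i.succ (pd j.succ v) p)
  set B : Fin 3 → Fin 3 → Fn := fun i j p => psi c p * (pd j.succ v p * pd i.succ (pd i.succ v) p)
  have sA : ∀ i j, Sm (A i j) := fun i j => sψ.mul ((s1 j).mul (s2 i j))
  have sB : ∀ i j, Sm (B i j) := fun i j => sψ.mul ((s1 j).mul (s2 i i))
  have scA : ∀ i j, SC t (A i j) := fun i j => ((hs.pd _).mul_right _).mul_left _
  have scB : ∀ i j, SC t (B i j) := fun i j => ((hs.pd _).mul_right _).mul_left _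
  have cA : ∀ i j, CS t (pd i.succ (A i j)) := fun i j => CS.pd (sA i j) (scA i j) _
  have cB : ∀ i j, CS t (fun p => (-1) * pd j.succ (B i j) p) := fun i j =>
    (CS.pd (sB i j) (scB i j) _).const_mul _
  set D : Fn := fun p => ∑ i : Fin 3, ∑ j : Fin 3,
    (pd i.succ (A i j) p + (-1) * pd j.succ (B i j) p) with hD
  have cD : CS t D := CS.sum _ fun i _ => CS.sum _ fun j _ => (cA i j).add (cB i j)
  have hD0 : In t D = 0 := by
    rw [hD, In_sum _ fun i _ => CS.sum _ fun j _ => (cA i j).add (cB i j)]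
    refine Finset.sum_eq_zero fun i _ => ?_
    rw [In_sum _ fun j _ => (cA i j).add (cB i j)]
    refine Finset.sum_eq_zero fun j _ => ?_
    rw [In_add (cA i j) (cB i j), In_const_mul, In_pd (sA i j) (scA i j),
      In_pd (sB i j) (scB i j)]
    ring
  have cl : CS t (lap v) := CS.sum _ fun j _ => c2 j j
  have cX : CS t (fun p => psi c p * ∑ i : Fin 3, ∑ j : Fin 3, pd i.succ (pd j.succ v) p ^ 2) :=
    (CS.sum _ fun i _ => CS.sum _ fun j _ => (c2 i j).sq).mul_left sψ.continuous
  have cL : CS t (fun p => psi c p * lap v p ^ 2) := cl.sq.mul_left sψ.continuous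
  have cG : CS t (fun p => ∑ j : Fin 3, pd j.succ v p ^ 2) := CS.sum _ fun j _ => (c1 j).sq
  have key := In_mono cX ((cD.const_mul 2).add ((cL.const_mul 4).add (cG.const_mul 6))) (by
    intro x
    set p : Pt := (t, x)
    set s := c * p.1 - br 0 p with hsdef
    have hψ : psi c p = 1 + s ^ 2 := rfl
    have hDp : D p = psi c p * (∑ i : Fin 3, ∑ j : Fin 3, pd i.succ (pd j.succ v) p ^ 2)
        - psi c p * lap v p ^ 2
        + (∑ i : Fin 3, ∑ j : Fin 3, (-2 * s * pd i.succ (br 0) p) * (pd j.succ v p *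
          pd i.succ (pd j.succ v) p))
        - (∑ j : Fin 3, (-2 * s * pd j.succ (br 0) p) * pd j.succ v p) * lap v p := by
      simp only [hD]
      have e1 : ∀ i j, pd i.succ (A i j) p = (-2 * s * pd i.succ (br 0) p) * (pd j.succ v p *
          pd i.succ (pd j.succ v) p) + psi c p * (pd i.succ (pd j.succ v) p *
          pd i.succ (pd j.succ v) p + pd j.succ v p * pd i.succ (pd i.succ (pd j.succ v)) p) := by
        intro i j
        rw [pd_mul sψ ((s1 j).mul (s2 i j)), pd_mul (s1 j) (s2 i j), pd_psi_succ]
      have e2 : ∀ i j, pd j.succ (B i j) p = (-2 * s * pd j.succ (br 0) p) * (pd j.succ v p *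
          pd i.succ (pd i.succ v) p) + psi c p * (pd j.succ (pd j.succ v) p *
          pd i.succ (pd i.succ v) p + pd j.succ v p * pd i.succ (pd i.succ (pd j.succ v)) p) := by
        intro i j
        rw [pd_mul sψ ((s1 j).mul (s2 i i)), pd_mul (s1 j) (s2 i i), pd_psi_succ,
          pd_comm (s1 i) j.succ i.succ]
        have : pd j.succ (pd i.succ v) = pd i.succ (pd j.succ v) := by
          funext q; exact pd_comm hv _ _ _
        rw [this]
      simp only [e1, e2, lap, Fin.sum_univ_three]
      ring
    have hb := sum_pd_br_sq 0 p
    simp only [hDp, hψ]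
    generalize hlap : lap v p = L
    generalize hbd : (fun i : Fin 3 => pd i.succ (br 0) p) = b at hb
    have hb' : ∀ i : Fin 3, pd i.succ (br 0) p = b i := fun i => congrFun hbd i
    simp only [hb'] at hb ⊢
    generalize hg : (fun i : Fin 3 => pd i.succ v p) = g
    have hg' : ∀ i : Fin 3, pd i.succ v p = g i := fun i => congrFun hg i
    generalize hh : (fun i j : Fin 3 => pd i.succ (pd j.succ v) p) = h
    have hh' : ∀ i j : Fin 3, pd i.succ (pd j.succ v) p = h i j :=
      fun i j => congrFun (congrFun hh i) j
    simp only [hh']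
    simp only [hg']
    have a1 : ∀ i j : Fin 3, -(s ^ 2 * h i j ^ 2 / 2 + 2 * (b i ^ 2 * g j ^ 2)) ≤
        (-2 * s * b i) * (g j * h i j) := fun i j => by
      nlinarith [sq_nonneg (s * h i j - 2 * (b i * g j))]
    have a1' := Finset.sum_le_sum fun i (_ : i ∈ Finset.univ) =>
      Finset.sum_le_sum fun j (_ : j ∈ Finset.univ) => a1 i j
    have a2 : ∑ i : Fin 3, ∑ j : Fin 3, -(s ^ 2 * h i j ^ 2 / 2 + 2 * (b i ^ 2 * g j ^ 2))
        = -(s ^ 2 / 2 * (∑ i : Fin 3, ∑ j : Fin 3, h i j ^ 2)) - 2 * ((∑ i : Fin 3, b i ^ 2) *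
          ∑ j : Fin 3, g j ^ 2) := by
      simp only [Fin.sum_univ_three]; ring
    rw [a2] at a1'
    have cs : (∑ i : Fin 3, b i * g i) ^ 2 ≤ (∑ i : Fin 3, b i ^ 2) * ∑ i : Fin 3, g i ^ 2 :=
      Finset.sum_mul_sq_le_sq_mul_sq _ _ _
    have e3 : (∑ j : Fin 3, (-2 * s * b j) * g j) = -2 * s * ∑ j : Fin 3, b j * g j := by
      simp only [Fin.sum_univ_three]; ring
    rw [e3]
    have a3 : (-2 * s * ∑ j : Fin 3, b j * g j) * L ≤ s ^ 2 * L ^ 2 + (∑ j : Fin 3, b j * g j) ^ 2 := by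
      nlinarith [sq_nonneg (s * L + ∑ j : Fin 3, b j * g j)]
    have hG : 0 ≤ ∑ j : Fin 3, g j ^ 2 := Finset.sum_nonneg fun _ _ => sq_nonneg _
    have hH : 0 ≤ ∑ i : Fin 3, ∑ j : Fin 3, h i j ^ 2 :=
      Finset.sum_nonneg fun _ _ => Finset.sum_nonneg fun _ _ => sq_nonneg _
    have hbg : (∑ i : Fin 3, b i ^ 2) * ∑ j : Fin 3, g j ^ 2 ≤ ∑ j : Fin 3, g j ^ 2 := by
      nlinarith
    nlinarith [sq_nonneg L])
  rw [In_add (cD.const_mul 2) ((cL.const_mul 4).add (cG.const_mul 6)),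
    In_add (cL.const_mul 4) (cG.const_mul 6), In_const_mul, In_const_mul, In_const_mul, hD0] at key
  linarith

/-- The squared space-time gradient. -/
def gsq (v : Fn) : Fn := fun p => ∑ α : Fin 4, pd α v p ^ 2

lemma gsq_nonneg (v : Fn) (p : Pt) : 0 ≤ gsq v p := Finset.sum_nonneg fun _ _ => sq_nonneg _

lemma CS.gsq {t : ℝ} {v : Fn} (hv : Sm v) (hs : SC t v) : CS t (gsq v) :=
  CS.sum _ fun α _ => (CS.pd hv hs α).sq

lemma pd_sq_le_gsq (v : Fn) (α : Fin 4) (p : Pt) : pd α v p ^ 2 ≤ gsq v p :=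
  Finset.single_le_sum (f := fun α => pd α v p ^ 2) (fun _ _ => sq_nonneg _) (Finset.mem_univ α)

/-- The weighted second derivative density. -/
def hess (v : Fn) : Fn := fun p => ∑ α : Fin 4, ∑ j : Fin 3, pd α (pd j.succ v) p ^ 2

lemma CS.hess {t : ℝ} {v : Fn} (hv : Sm v) (hs : SC t v) : CS t (hess v) :=
  CS.sum _ fun α _ => CS.sum _ fun _ _ => (CS.pd (hv.pd _) (hs.pd _) α).sq

/-- The Klainerman–Sideris inequality in integrated form. -/
lemma ks_integral {c : ℝ} (hc : 0 < c) : ∃ C, 0 ≤ C ∧ ∀ (v : Fn) (t : ℝ), Sm v → SC t v → 0 < t →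
    In t (fun p => psi c p * hess v p) ≤ C * (In t (gsq v)
      + In t (fun p => ∑ l : Fin 7, ∑ α : Fin 4, Zop l (pd α v) p ^ 2)
      + t ^ 2 * In t (fun p => boxOp c v p ^ 2)) := by
  obtain ⟨K, hK0, hK⟩ := ks_pointwise hc
  refine ⟨15 * (27 + 3 * K ^ 2) + 6, by positivity, fun v t hv hs ht => ?_⟩
  set Q : Fn := fun p => (∑ l : Fin 7, ∑ α : Fin 4, Zop l (pd α v) p ^ 2) +
    t ^ 2 * boxOp c v p ^ 2 with hQ
  have cZ : CS t (fun p => ∑ l : Fin 7, ∑ α : Fin 4, Zop l (pd α v) p ^ 2) :=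
    CS.sum _ fun l _ => CS.sum _ fun α _ =>
      (CS.of_sm ((hv.pd α).Zop l) ((hs.pd α).Zop l)).sq
  have scB : SC t (boxOp c v) := by
    have : SC t (fun p => pd 0 (pd 0 v) p + (-c ^ 2) * ∑ j : Fin 3, pd j.succ (pd j.succ v) p) :=
      ((hs.pd _).pd _).add ((SC.sum _ fun j _ => (hs.pd _).pd _).mul_left _)
    convert this using 1
    funext p; rw [boxOp_eq]; ring
  have cB : CS t (fun p => boxOp c v p ^ 2) := (CS.of_sm (hv.boxOp c) scB).sq
  have cQ : CS t Q := cZ.add (cB.const_mul _)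
  have cψ := (Sm.psi c).continuous
  have cpp : ∀ α β, CS t (pd α (pd β v)) := fun α β => CS.pd (hv.pd _) (hs.pd _) α
  have cl : CS t (lap v) := CS.sum _ fun j _ => cpp _ _
  have pw : ∀ x : Sp, psi c (t, x) * lap v (t, x) ^ 2 ≤ (27 + 3 * K ^ 2) * Q (t, x) ∧
      ∀ j : Fin 3, psi c (t, x) * pd 0 (pd j.succ v) (t, x) ^ 2 ≤ (27 + 3 * K ^ 2) * Q (t, x) := by
    intro x
    have hZ0 : 0 ≤ ∑ l : Fin 7, ∑ α : Fin 4, Zop l (pd α v) (t, x) ^ 2 :=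
      Finset.sum_nonneg fun _ _ => Finset.sum_nonneg fun _ _ => sq_nonneg _
    have hB0 : 0 ≤ t ^ 2 * boxOp c v (t, x) ^ 2 := by positivity
    have hQ0 : 0 ≤ Q (t, x) := add_nonneg hZ0 hB0
    have hq := Real.sq_sqrt hQ0
    have hq0 := Real.sqrt_nonneg (Q (t, x))
    set q := Real.sqrt (Q (t, x))
    have hz : ∀ l α, |Zop l (pd α v) (t, x)| ≤ q := by
      intro l α
      refine Real.abs_le_sqrt ?_
      have h1 : Zop l (pd α v) (t, x) ^ 2 ≤ ∑ α : Fin 4, Zop l (pd α v) (t, x) ^ 2 :=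
        Finset.single_le_sum (f := fun α => Zop l (pd α v) (t, x) ^ 2) (fun _ _ => sq_nonneg _)
          (Finset.mem_univ α)
      have h2 : ∑ α : Fin 4, Zop l (pd α v) (t, x) ^ 2 ≤
          ∑ l : Fin 7, ∑ α : Fin 4, Zop l (pd α v) (t, x) ^ 2 :=
        Finset.single_le_sum (f := fun l => ∑ α : Fin 4, Zop l (pd α v) (t, x) ^ 2)
          (fun _ _ => Finset.sum_nonneg fun _ _ => sq_nonneg _) (Finset.mem_univ l)
      simp only [hQ]; linarith
    have hb : t * |boxOp c v (t, x)| ≤ q := by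
      rw [← abs_of_pos ht, ← abs_mul, abs_of_pos ht]
      refine Real.abs_le_sqrt ?_
      rw [mul_pow]; simp only [hQ]; linarith
    obtain ⟨k1, k2⟩ := hK v hv (t, x) ht q hz hb
    simp only at k1 k2
    have hψ := psi_le c (t, x)
    rw [jb_sq] at hψ
    simp only at hψ
    have comb : ∀ z : ℝ, |c * t - ‖x‖| * |z| ≤ K * q → |z| ≤ 3 * q →
        psi c (t, x) * z ^ 2 ≤ (27 + 3 * K ^ 2) * Q (t, x) := by
      intro z h1 h2
      have h1' : (c * t - ‖x‖) ^ 2 * z ^ 2 ≤ K ^ 2 * q ^ 2 := by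
        rw [← abs_mul] at h1
        have := pow_le_pow_left₀ (abs_nonneg _) h1 2
        rwa [sq_abs, mul_pow, mul_pow] at this
      have h2' : z ^ 2 ≤ 9 * q ^ 2 := by
        have := pow_le_pow_left₀ (abs_nonneg _) h2 2
        rw [sq_abs] at this; linarith
      rw [← hq]
      calc psi c (t, x) * z ^ 2 ≤ 3 * (1 + (c * t - ‖x‖) ^ 2) * z ^ 2 := by gcongr
        _ = 3 * z ^ 2 + 3 * ((c * t - ‖x‖) ^ 2 * z ^ 2) := by ring
        _ ≤ _ := by nlinarith
    have hp : ∀ (j : Fin 3) α, |pd j.succ (pd α v) (t, x)| ≤ q := fun j α =>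
      px_bound (fun l => hz l α) j
    refine ⟨comb _ k1 (abs_sum_fin3_le fun j => hp j _), fun j => comb _ (k2 j) ?_⟩
    rw [pd_comm hv]
    linarith [hp j 0]
  have cL : CS t (fun p => psi c p * lap v p ^ 2) := cl.sq.mul_left cψ
  have i1 : In t (fun p => psi c p * lap v p ^ 2) ≤ (27 + 3 * K ^ 2) * In t Q := by
    rw [← In_const_mul]
    exact In_mono cL (cQ.const_mul _) fun x => (pw x).1
  have cT : CS t (fun p => psi c p * ∑ j : Fin 3, pd 0 (pd j.succ v) p ^ 2) :=
    (CS.sum _ fun j _ => (cpp _ _).sq).mul_left cψ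
  have i2 : In t (fun p => psi c p * ∑ j : Fin 3, pd 0 (pd j.succ v) p ^ 2) ≤
      3 * (27 + 3 * K ^ 2) * In t Q := by
    rw [← In_const_mul]
    refine In_mono cT (cQ.const_mul _) fun x => ?_
    rw [Finset.mul_sum]
    refine (Finset.sum_le_sum fun j _ => (pw x).2 j).trans ?_
    simp only [Finset.sum_const, Finset.card_univ, Fintype.card_fin, nsmul_eq_mul, Nat.cast_ofNat]
    exact le_of_eq (by ring)
  have cX : CS t (fun p => psi c p * ∑ i : Fin 3, ∑ j : Fin 3, pd i.succ (pd j.succ v) p ^ 2) :=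
    (CS.sum _ fun i _ => CS.sum _ fun j _ => (cpp _ _).sq).mul_left cψ
  have i3 := elliptic (c := c) hv hs
  have i4 : In t (fun p => ∑ j : Fin 3, pd j.succ v p ^ 2) ≤ In t (gsq v) := by
    refine In_mono (CS.sum _ fun j _ => (CS.pd hv hs _).sq) (CS.gsq hv hs) fun x => ?_
    simp only [gsq, Fin.sum_univ_succ (n := 3)]
    linarith [sq_nonneg (pd 0 v (t, x))]
  have e : In t (fun p => psi c p * hess v p) =
      In t (fun p => psi c p * ∑ j : Fin 3, pd 0 (pd j.succ v) p ^ 2) +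
      In t (fun p => psi c p * ∑ i : Fin 3, ∑ j : Fin 3, pd i.succ (pd j.succ v) p ^ 2) := by
    rw [← In_add cT cX]
    congr 1; funext p
    simp only [hess, Fin.sum_univ_succ (n := 3), mul_add]
  have eQ : In t Q = In t (fun p => ∑ l : Fin 7, ∑ α : Fin 4, Zop l (pd α v) p ^ 2)
      + t ^ 2 * In t (fun p => boxOp c v p ^ 2) := by
    rw [hQ, In_add cZ (cB.const_mul _), In_const_mul]
  have g0 : 0 ≤ In t (gsq v) := In_nonneg (gsq_nonneg v)
  have q0 : 0 ≤ In t Q := In_nonneg fun p => add_nonneg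
    (Finset.sum_nonneg fun _ _ => Finset.sum_nonneg fun _ _ => sq_nonneg _) (by positivity)
  rw [e, add_assoc, ← eQ]
  have m1 : 0 ≤ K ^ 2 * In t Q := by positivity
  have m2 : 0 ≤ K ^ 2 * In t (gsq v) := by positivity
  nlinarith

lemma exists_unif {ι : Type*} (s : Finset ι) {P : ι → ℝ → Prop}
    (hm : ∀ i, ∀ C C', C ≤ C' → P i C → P i C') (h : ∀ i ∈ s, ∃ C, 0 ≤ C ∧ P i C) :
    ∃ C, 0 ≤ C ∧ ∀ i ∈ s, P i C := by
  classical
  induction s using Finset.induction_on with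
  | empty => exact ⟨0, le_rfl, by simp⟩
  | insert a s ha ih =>
    obtain ⟨C, hC0, hC⟩ := ih fun i hi => h i (Finset.mem_insert_of_mem hi)
    obtain ⟨C', hC0', hC'⟩ := h a (Finset.mem_insert_self a s)
    refine ⟨C + C', add_nonneg hC0 hC0', fun i hi => ?_⟩
    rcases Finset.mem_insert.1 hi with rfl | hi
    · exact hm _ _ _ (by linarith) hC'
    · exact hm _ _ _ (by linarith) (hC i hi)

lemma gsq_sum_le {ι : Type*} (s : Finset ι) (c : ι → ℝ) {w : ι → Fn} (hw : ∀ i, Sm (w i)) (p : Pt) :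
    gsq (fun q => ∑ i ∈ s, c i * w i q) p ≤ (∑ i ∈ s, c i ^ 2) * ∑ i ∈ s, gsq (w i) p := by
  unfold gsq
  rw [Finset.sum_comm, Finset.mul_sum]
  refine Finset.sum_le_sum fun α _ => ?_
  rw [pd_sum s fun i _ => contDiff_const.mul (hw i)]
  simp only [pd_const_mul (hw _)]
  exact Finset.sum_mul_sq_le_sq_mul_sq _ _ _

lemma zop_pd_sq_le : ∃ K, 0 ≤ K ∧ ∀ v, Sm v → ∀ p,
    ∑ l : Fin 7, ∑ α : Fin 4, Zop l (pd α v) p ^ 2 ≤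
      K * (gsq v p + ∑ l : Fin 7, gsq (Zop l v) p) := by
  refine ⟨2 + 2 * ∑ l : Fin 7, ∑ α : Fin 4, ∑ β : Fin 4, (zA l β α : ℝ) ^ 2, by positivity,
    fun v hv p => ?_⟩
  have h1 : ∀ l α, Zop l (pd α v) p ^ 2 ≤ 2 * pd α (Zop l v) p ^ 2 +
      2 * ((∑ β : Fin 4, (zA l β α : ℝ) ^ 2) * gsq v p) := by
    intro l α
    rw [Zop_pd hv]
    have := Finset.sum_mul_sq_le_sq_mul_sq Finset.univ (fun β => (zA l β α : ℝ))
      (fun β => pd β v p)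
    have h2 : gsq v p = ∑ β, pd β v p ^ 2 := rfl
    rw [h2]
    nlinarith [sq_nonneg (pd α (Zop l v) p + ∑ β, (zA l β α : ℝ) * pd β v p)]
  refine (Finset.sum_le_sum fun l _ => Finset.sum_le_sum fun α _ => h1 l α).trans ?_
  have e : ∑ l : Fin 7, ∑ α : Fin 4, (2 * pd α (Zop l v) p ^ 2 +
      2 * ((∑ β : Fin 4, (zA l β α : ℝ) ^ 2) * gsq v p)) =
      2 * (∑ l : Fin 7, gsq (Zop l v) p) +
      2 * (∑ l : Fin 7, ∑ α : Fin 4, ∑ β : Fin 4, (zA l β α : ℝ) ^ 2) * gsq v p := by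
    have e0 : ∀ l, gsq (Zop l v) p = ∑ α : Fin 4, pd α (Zop l v) p ^ 2 := fun l => rfl
    simp only [e0]
    generalize gsq v p = G
    simp only [Finset.sum_add_distrib, Finset.mul_sum, Finset.sum_mul, mul_assoc]
  rw [e]
  have g0 := gsq_nonneg v p
  have g1 : 0 ≤ ∑ l : Fin 7, gsq (Zop l v) p := Finset.sum_nonneg fun l _ => gsq_nonneg _ p
  have g2 : 0 ≤ ∑ l : Fin 7, ∑ α : Fin 4, ∑ β : Fin 4, (zA l β α : ℝ) ^ 2 := by positivity
  nlinarith [mul_nonneg g2 g1]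

/-- Squared generalized energy. -/
def NQ (n : ℕ) (v : Fn) (t : ℝ) : ℝ := ∑ a ∈ idxSet 7 n, In t (gsq (Zmulti a v))

/-- Squared weighted second-derivative norm. -/
def MQ (c : ℝ) (m : ℕ) (v : Fn) (t : ℝ) : ℝ :=
  ∑ a ∈ idxSet 7 m, In t (fun p => psi c p * hess (Zmulti a v) p)

lemma NQ_nonneg (n : ℕ) (v : Fn) (t : ℝ) : 0 ≤ NQ n v t :=
  Finset.sum_nonneg fun _ _ => In_nonneg (gsq_nonneg _)

lemma hess_nonneg (v : Fn) (p : Pt) : 0 ≤ hess v p :=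
  Finset.sum_nonneg fun _ _ => Finset.sum_nonneg fun _ _ => sq_nonneg _

lemma MQ_nonneg (c : ℝ) (n : ℕ) (v : Fn) (t : ℝ) : 0 ≤ MQ c n v t :=
  Finset.sum_nonneg fun _ _ => In_nonneg fun p => mul_nonneg (psi_pos c p).le (hess_nonneg _ p)

lemma gsq_le_NQ {n : ℕ} {a : Fin 7 → ℕ} (ha : ∑ i, a i ≤ n) (v : Fn) (t : ℝ) :
    In t (gsq (Zmulti a v)) ≤ NQ n v t :=
  Finset.single_le_sum (f := fun a => In t (gsq (Zmulti a v)))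
    (fun _ _ => In_nonneg (gsq_nonneg _)) (mem_idxSet.2 ha)

lemma hess_le_MQ {n : ℕ} {a : Fin 7 → ℕ} (ha : ∑ i, a i ≤ n) (c : ℝ) (v : Fn) (t : ℝ) :
    In t (fun p => psi c p * hess (Zmulti a v) p) ≤ MQ c n v t :=
  Finset.single_le_sum (f := fun a => In t (fun p => psi c p * hess (Zmulti a v) p))
    (fun _ _ => In_nonneg fun p => mul_nonneg (psi_pos c p).le (hess_nonneg _ p)) (mem_idxSet.2 ha)

lemma gsq_Zop_le (m : ℕ) (l : Fin 7) (a : Fin 7 → ℕ) (ha : ∑ i, a i ≤ m) :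
    ∃ K, 0 ≤ K ∧ ∀ v t, Sm v → SC t v →
      In t (gsq (Zop l (Zmulti a v))) ≤ K * NQ (m + 1) v t := by
  obtain ⟨s, hs⟩ := Zop_Zmulti m l a ha
  refine ⟨∑ b ∈ idxSet 7 (m + 1), s b ^ 2, by positivity, fun v t hv hc => ?_⟩
  have e : Zop l (Zmulti a v) = fun q => ∑ b ∈ idxSet 7 (m + 1), s b * Zmulti b v q := by
    funext p; exact hs v hv p
  have cg : ∀ b, CS t (gsq (Zmulti b v)) := fun b => CS.gsq (hv.Zmulti b) (hc.Zmulti b)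
  rw [NQ, ← In_sum _ fun b _ => cg b, ← In_const_mul]
  refine In_mono (CS.gsq ((hv.Zmulti a).Zop l) ((hc.Zmulti a).Zop l))
    ((CS.sum _ fun b _ => cg b).const_mul _) fun x => ?_
  rw [e]
  exact gsq_sum_le _ _ (fun b => hv.Zmulti b) _

lemma ks_sum {c : ℝ} (hc : 0 < c) (m : ℕ) : ∃ C, 0 ≤ C ∧ ∀ (v : Fn) (t : ℝ), Sm v → SC t v → 0 < t →
    MQ c m v t ≤ C * (NQ (m + 1) v t +
      t ^ 2 * ∑ a ∈ idxSet 7 m, In t (fun p => boxOp c (Zmulti a v) p ^ 2)) := by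
  obtain ⟨C1, hC1, h1⟩ := ks_integral hc
  obtain ⟨K, hK, h2⟩ := zop_pd_sq_le
  have key : ∀ a ∈ idxSet 7 m, ∃ C, 0 ≤ C ∧ ∀ (v : Fn) (t : ℝ), Sm v → SC t v → 0 < t →
      In t (fun p => psi c p * hess (Zmulti a v) p) ≤ C * NQ (m + 1) v t +
        C1 * (t ^ 2 * In t (fun p => boxOp c (Zmulti a v) p ^ 2)) := by
    intro a ha
    rw [mem_idxSet] at ha
    obtain ⟨K', hK', h3⟩ := exists_unif (Finset.univ : Finset (Fin 7))
      (P := fun l C => ∀ v t, Sm v → SC t v → In t (gsq (Zop l (Zmulti a v))) ≤ C * NQ (m + 1) v t)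
      (fun i C C' hCC h v t hv hs => (h v t hv hs).trans
        (mul_le_mul_of_nonneg_right hCC (NQ_nonneg _ _ _))) fun l _ => gsq_Zop_le m l a ha
    refine ⟨C1 * (1 + K * (1 + 7 * K')), by positivity, fun v t hv hs ht => ?_⟩
    have sv := hv.Zmulti a
    have cv := hs.Zmulti a
    refine (h1 _ t sv cv ht).trans ?_
    have g1 := gsq_le_NQ (ha.trans (Nat.le_succ m)) v t
    have g2 : In t (fun p => ∑ l : Fin 7, ∑ α : Fin 4, Zop l (pd α (Zmulti a v)) p ^ 2) ≤
        K * (In t (gsq (Zmulti a v)) + ∑ l : Fin 7, In t (gsq (Zop l (Zmulti a v)))) := by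
      have cg := CS.gsq sv cv
      have cgl : ∀ l, CS t (gsq (Zop l (Zmulti a v))) := fun l => CS.gsq (sv.Zop l) (cv.Zop l)
      rw [← In_sum _ fun l _ => cgl l, ← In_add cg (CS.sum _ fun l _ => cgl l), ← In_const_mul]
      exact In_mono (CS.sum _ fun l _ => CS.sum _ fun α _ =>
        (CS.of_sm ((sv.pd α).Zop l) ((cv.pd α).Zop l)).sq)
        ((cg.add (CS.sum _ fun l _ => cgl l)).const_mul _) fun x => h2 _ sv _
    have g3 : ∑ l : Fin 7, In t (gsq (Zop l (Zmulti a v))) ≤ 7 * (K' * NQ (m + 1) v t) := by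
      refine (Finset.sum_le_sum fun l hl => h3 l hl v t hv hs).trans ?_
      simp
    have g4 : K * (In t (gsq (Zmulti a v)) + ∑ l : Fin 7, In t (gsq (Zop l (Zmulti a v)))) ≤
        K * (NQ (m + 1) v t + 7 * (K' * NQ (m + 1) v t)) := by gcongr
    have g5 := g2.trans g4
    calc C1 * (In t (gsq (Zmulti a v)) +
          In t (fun p => ∑ l : Fin 7, ∑ α : Fin 4, Zop l (pd α (Zmulti a v)) p ^ 2) +
          t ^ 2 * In t fun p => boxOp c (Zmulti a v) p ^ 2)
        ≤ C1 * (NQ (m + 1) v t + K * (NQ (m + 1) v t + 7 * (K' * NQ (m + 1) v t)) +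
          t ^ 2 * In t fun p => boxOp c (Zmulti a v) p ^ 2) := by gcongr
      _ = _ := by ring
  obtain ⟨C2, hC2, h4⟩ := exists_unif _ (fun i C C' hCC h v t hv hs ht => (h v t hv hs ht).trans (by
    have := mul_le_mul_of_nonneg_right hCC (NQ_nonneg (m + 1) v t); linarith)) key
  refine ⟨(idxSet 7 m).card * C2 + C1, by positivity, fun v t hv hs ht => ?_⟩
  refine (Finset.sum_le_sum fun a ha => h4 a ha v t hv hs ht).trans ?_
  rw [Finset.sum_add_distrib, Finset.sum_const, nsmul_eq_mul, ← Finset.mul_sum, ← Finset.mul_sum]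
  have n0 := NQ_nonneg (m + 1) v t
  have b0 : 0 ≤ ∑ a ∈ idxSet 7 m, In t (fun p => boxOp c (Zmulti a v) p ^ 2) :=
    Finset.sum_nonneg fun _ _ => In_nonneg fun _ => sq_nonneg _
  set N := NQ (m + 1) v t
  set B := t ^ 2 * ∑ a ∈ idxSet 7 m, In t (fun p => boxOp c (Zmulti a v) p ^ 2) with hB
  have b1 : 0 ≤ B := by positivity
  have p1 : 0 ≤ C1 * N := by positivity
  have p2 : 0 ≤ (idxSet 7 m).card * C2 * B := by positivity
  nlinarith

/-- The weight `1/(1+r²)`. -/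
def th : Fn := fun p => (br 0 p ^ 2)⁻¹

lemma Sm.th : Sm th := ((Sm.br 0).pow 2).inv fun p => (pow_pos (br_pos 0 p) 2).ne'

lemma th_pos (p : Pt) : 0 < th p := inv_pos.2 (pow_pos (br_pos 0 p) 2)

lemma th_mul (p : Pt) : th p * (1 + ‖p.2‖ ^ 2) = 1 := by
  have := br_sq 0 p
  rw [sub_zero] at this
  rw [← this, th]
  exact inv_mul_cancel₀ (pow_pos (br_pos 0 p) 2).ne'

lemma pd_th_succ (j : Fin 3) (p : Pt) : pd j.succ th p = -2 * th p ^ 2 * p.2 j := by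
  have e : (fun q => th q * br 0 q ^ 2) = fun _ => (1 : ℝ) := by
    funext q; exact inv_mul_cancel₀ (pow_pos (br_pos 0 q) 2).ne'
  have h1 : pd j.succ (fun q => th q * br 0 q ^ 2) p = 0 := by rw [e, pd_const]
  rw [pd_mul Sm.th ((Sm.br 0).pow 2), pd_sq (Sm.br 0), pd_br_succ] at h1
  have hb := (br_pos 0 p).ne'
  have h2 : th p * br 0 p ^ 2 = 1 := congrFun e p
  have h3 : 2 * br 0 p * ((p.2 j - (0 : Sp) j) / br 0 p) = 2 * p.2 j := by
    field_simp; simp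
  rw [h3] at h1
  have h4 : pd j.succ th p * (br 0 p ^ 2) * th p + 2 * th p ^ 2 * p.2 j = 0 := by
    linear_combination th p * h1
  linear_combination h4 - pd j.succ th p * h2

lemma hardy_real {s R θ b w D G ψ : ℝ} (hψ : ψ = 1 + s ^ 2) (hθ : 0 < θ) (hR : 0 ≤ R)
    (hRθ : R * θ ≤ 1) (hb : θ * b ^ 2 = 1) (hD : D ^ 2 ≤ R * G) (hG : 0 ≤ G) :
    ψ * θ * w ^ 2 ≤ 4 * (-2 * s * (R * θ ^ 2 * b) * w ^ 2 + ψ * (θ + 2 * θ ^ 2) * w ^ 2 +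
      2 * ψ * θ * w * D) + (8 * (ψ * G) + 16 * w ^ 2) := by
  have hψ0 : 0 ≤ ψ := by rw [hψ]; positivity
  have i1 : -(8 * ψ * θ * w * D) ≤ 2 * (ψ * θ * w ^ 2) + 8 * (ψ * G) := by
    have h1 : 0 ≤ ψ * θ * (w + 2 * D) ^ 2 := by positivity
    have h2 : θ * D ^ 2 ≤ G := by
      calc θ * D ^ 2 ≤ θ * (R * G) := by gcongr
        _ = (R * θ) * G := by ring
        _ ≤ 1 * G := by gcongr
        _ = G := one_mul G
    have h3 := mul_le_mul_of_nonneg_left h2 hψ0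
    nlinarith only [h1, h3]
  have i2 : 8 * s * (R * θ ^ 2 * b) * w ^ 2 ≤ s ^ 2 * θ * w ^ 2 + 16 * w ^ 2 := by
    have hk0 : 0 ≤ R * θ := by positivity
    have h1 : 0 ≤ (s - 4 * (R * θ) * b) ^ 2 * θ * w ^ 2 := by positivity
    have h2 : (R * θ) ^ 2 ≤ 1 := pow_le_one₀ hk0 hRθ
    have h3 : 16 * (R * θ * b) ^ 2 * θ * w ^ 2 ≤ 16 * w ^ 2 := by
      have e : 16 * (R * θ * b) ^ 2 * θ * w ^ 2 = 16 * ((R * θ) ^ 2 * w ^ 2) := by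
        linear_combination 16 * (R * θ) ^ 2 * w ^ 2 * hb
      rw [e]
      have := mul_le_mul_of_nonneg_right h2 (sq_nonneg w)
      linarith
    linarith only [h1, h3]
  have i3 : s ^ 2 * θ * w ^ 2 ≤ ψ * θ * w ^ 2 := by
    have : 0 ≤ θ * w ^ 2 := by positivity
    rw [hψ]; linarith
  have i4 : 0 ≤ ψ * θ ^ 2 * w ^ 2 := by positivity
  linarith only [i1, i2, i3, i4]

/-- A weighted Hardy inequality. -/
lemma hardy (c : ℝ) {t : ℝ} {w : Fn} (hw : Sm w) (hs : SC t w) :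
    In t (fun p => psi c p * th p * w p ^ 2) ≤
      8 * In t (fun p => psi c p * ∑ j : Fin 3, pd j.succ w p ^ 2) +
        16 * In t (fun p => w p ^ 2) := by
  have sψ := Sm.psi c
  have cw := CS.of_sm hw hs
  set A : Fin 3 → Fn := fun j p => psi c p * (xc j.succ p * (th p * w p ^ 2)) with hA
  have s3 : Sm (fun p => th p * w p ^ 2) := Sm.th.mul (hw.pow 2)
  have s2 : ∀ j : Fin 3, Sm (fun p => xc j.succ p * (th p * w p ^ 2)) := fun j => (Sm.xc _).mul s3
  have sA : ∀ j, Sm (A j) := fun j => sψ.mul (s2 j)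
  have scA : ∀ j, SC t (A j) := fun j => hs.mono fun p hp => by simp [hA, hp]
  have c0 : ∀ j, CS t (pd j.succ (A j)) := fun j => CS.pd (sA j) (scA j) _
  have cL : CS t (fun p => psi c p * th p * w p ^ 2) :=
    cw.sq.mul_left (sψ.continuous.mul Sm.th.continuous)
  have cG : CS t (fun p => psi c p * ∑ j : Fin 3, pd j.succ w p ^ 2) :=
    (CS.sum _ fun j _ => (CS.pd hw hs _).sq).mul_left sψ.continuous
  have cD : CS t (fun p => ∑ j : Fin 3, pd j.succ (A j) p) := CS.sum _ fun j _ => c0 j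
  have hD0 : In t (fun p => ∑ j : Fin 3, pd j.succ (A j) p) = 0 := by
    rw [In_sum _ fun j _ => c0 j]
    exact Finset.sum_eq_zero fun j _ => In_pd (sA j) (scA j) j
  have key := In_mono cL ((cD.const_mul 4).add ((cG.const_mul 8).add (cw.sq.const_mul 16))) (by
    intro x
    set p : Pt := (t, x)
    have hx : p.2 = x := rfl
    set s := c * p.1 - br 0 p with hsdef
    have hψ : psi c p = 1 + s ^ 2 := rfl
    have hth := th_mul p
    have hr2 := norm_sq_sp x
    have hth0 := th_pos p
    have e1 : ∀ j, pd j.succ (A j) p = (-2 * s * (x j / br 0 p)) * (x j * (th p * w p ^ 2)) +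
        psi c p * (th p * w p ^ 2 + x j * ((-2 * th p ^ 2 * x j) * w p ^ 2 +
          th p * (2 * w p * pd j.succ w p))) := by
      intro j
      rw [hA, pd_mul sψ (s2 j), pd_mul (Sm.xc _) s3, pd_mul Sm.th (hw.pow 2), pd_sq hw, pd_psi_succ,
        pd_th_succ, pd_xc, pd_br_succ]
      simp [xc_succ, hx, ← hsdef]
    have e2 : ∑ j : Fin 3, pd j.succ (A j) p = -2 * s * (‖x‖ ^ 2 / br 0 p) * (th p * w p ^ 2) +
        psi c p * (3 * th p - 2 * th p ^ 2 * ‖x‖ ^ 2) * w p ^ 2 +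
        2 * psi c p * th p * w p * ∑ j : Fin 3, x j * pd j.succ w p := by
      simp only [e1, hr2, Fin.sum_univ_three]
      ring
    rw [hx] at hth
    have e3 : 3 * th p - 2 * th p ^ 2 * ‖x‖ ^ 2 = th p + 2 * th p ^ 2 := by
      linear_combination (-2 * th p) * hth
    have hb := br_pos 0 p
    have hbs := br_sq 0 p
    rw [sub_zero, hx] at hbs
    have hbt : th p * br 0 p ^ 2 = 1 := by rw [hbs]; exact hth
    have e4 : ‖x‖ ^ 2 / br 0 p * th p = ‖x‖ ^ 2 * th p ^ 2 * br 0 p := by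
      rw [div_mul_eq_mul_div, div_eq_iff hb.ne']
      linear_combination (-(‖x‖ ^ 2 * th p)) * hbt
    have e5 : ∑ j : Fin 3, pd j.succ (A j) p = -2 * s * (‖x‖ ^ 2 * th p ^ 2 * br 0 p) * w p ^ 2 +
        psi c p * (th p + 2 * th p ^ 2) * w p ^ 2 +
        2 * psi c p * th p * w p * ∑ j : Fin 3, x j * pd j.succ w p := by
      rw [e2, e3, ← e4]; ring
    have cs : (∑ j : Fin 3, x j * pd j.succ w p) ^ 2 ≤
        (∑ j : Fin 3, x j ^ 2) * ∑ j : Fin 3, pd j.succ w p ^ 2 :=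
      Finset.sum_mul_sq_le_sq_mul_sq _ _ _
    rw [← hr2] at cs
    change psi c p * th p * w p ^ 2 ≤ 4 * (∑ j : Fin 3, pd j.succ (A j) p) +
      (8 * (psi c p * ∑ j : Fin 3, pd j.succ w p ^ 2) + 16 * w p ^ 2)
    rw [e5]
    set D := ∑ j : Fin 3, x j * pd j.succ w p
    set G := ∑ j : Fin 3, pd j.succ w p ^ 2 with hG
    have hG0 : 0 ≤ G := Finset.sum_nonneg fun _ _ => sq_nonneg _
    have hrt : ‖x‖ ^ 2 * th p ≤ 1 := by nlinarith
    exact hardy_real hψ hth0 (sq_nonneg _) hrt hbt cs hG0)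
  rw [In_add (cD.const_mul 4) ((cG.const_mul 8).add (cw.sq.const_mul 16)),
    In_add (cG.const_mul 8) (cw.sq.const_mul 16), In_const_mul, In_const_mul, In_const_mul,
    hD0] at key
  linarith

open scoped ENNReal NNReal

/-- The radial measure `r² dr` on `(0,∞)`. -/
abbrev radMeas : Measure (Ioi (0 : ℝ)) := Measure.volumeIoiPow 2

lemma lintegral_polar {h : Sp → ℝ≥0∞} (hm : Measurable h) :
    ∫⁻ x, h x = ∫⁻ r : Ioi (0 : ℝ), ∫⁻ ω : S2, h ((r : ℝ) • (ω : Sp)) ∂sphMeas ∂radMeas := by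
  have hd : Module.finrank ℝ Sp - 1 = 2 := by simp
  have mp := (volume : Measure Sp).measurePreserving_homeomorphUnitSphereProd
  rw [hd] at mp
  have h1 : ∫⁻ x, h x = ∫⁻ x : ({0}ᶜ : Set Sp), h x ∂((volume : Measure Sp).comap (↑)) := by
    rw [lintegral_subtype_comap (measurableSet_singleton _).compl, restrict_compl_singleton]
  have h2 := mp.lintegral_comp_emb (Homeomorph.measurableEmbedding _)
    (fun q : S2 × Ioi (0 : ℝ) => h ((q.2 : ℝ) • (q.1 : Sp)))
  have h3 : ∀ x : ({0}ᶜ : Set Sp), h (((homeomorphUnitSphereProd Sp x).2 : ℝ) •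
      ((homeomorphUnitSphereProd Sp x).1 : Sp)) = h x := by
    intro x
    have hx : ‖(x : Sp)‖ ≠ 0 := norm_ne_zero_iff.2 x.2
    simp [smul_smul, hx]
  simp only [h3] at h2
  have h4 : Measurable fun q : S2 × Ioi (0 : ℝ) => h ((q.2 : ℝ) • (q.1 : Sp)) :=
    hm.comp (by fun_prop)
  have h5 := lintegral_prod_symm (μ := (volume : Measure Sp).toSphere) (ν := radMeas) _
    h4.aemeasurable
  exact h1.trans (h2.trans h5)

/-- Integrals of a radial cut-off times a function on the sphere. -/
lemma lintegral_polar_prod {H : Sp → ℝ≥0∞} (hH : Measurable H) {I : Set ℝ} (hI : MeasurableSet I) :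
    ∫⁻ x : Sp, {x : Sp | ‖x‖ ∈ I}.indicator (fun x => H (‖x‖⁻¹ • x)) x =
      radMeas {r | (r : ℝ) ∈ I} * ∫⁻ ω : S2, H (ω : Sp) ∂sphMeas := by
  have hS : MeasurableSet {x : Sp | ‖x‖ ∈ I} := measurable_norm hI
  have hG : Measurable fun x : Sp => H (‖x‖⁻¹ • x) := hH.comp (by fun_prop)
  rw [lintegral_polar (hG.indicator hS)]
  have : ∀ (r : Ioi (0 : ℝ)) (ω : S2),
      {x : Sp | ‖x‖ ∈ I}.indicator (fun x => H (‖x‖⁻¹ • x)) ((r : ℝ) • (ω : Sp)) =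
        {r : Ioi (0 : ℝ) | (r : ℝ) ∈ I}.indicator 1 r * H ω := by
    intro r ω
    have hr : (0 : ℝ) < r := r.2
    have hn : ‖(r : ℝ) • (ω : Sp)‖ = r := by
      rw [norm_smul, Real.norm_eq_abs, abs_of_pos hr, norm_eq_of_mem_sphere, mul_one]
    by_cases h : (r : ℝ) ∈ I
    · rw [Set.indicator_of_mem (by simpa [hn] using h), Set.indicator_of_mem (by simpa using h), hn,
        smul_smul, inv_mul_cancel₀ hr.ne', one_smul, Pi.one_apply, one_mul]
    · rw [Set.indicator_of_notMem (by simpa [hn] using h),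
        Set.indicator_of_notMem (by simpa using h), zero_mul]
  simp only [this]
  have hHs : Measurable fun ω : S2 => H ω := hH.comp measurable_subtype_coe
  simp_rw [lintegral_const_mul _ hHs]
  have hI' : MeasurableSet {r : Ioi (0 : ℝ) | (r : ℝ) ∈ I} := measurable_subtype_coe hI
  rw [lintegral_mul_const _ ((measurable_one).indicator hI'), lintegral_indicator_one hI']

lemma radMeas_Iio (b : ℝ) (hb : 0 < b) :
    radMeas {r | (r : ℝ) ∈ Iio b} = ENNReal.ofReal (b ^ 3 / 3) := by
  have := Measure.volumeIoiPow_apply_Iio 2 ⟨b, hb⟩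
  norm_num at this
  rw [← this]
  rfl

lemma radMeas_Icc_pos {a b : ℝ} (ha : 0 < a) (hab : a < b) :
    radMeas {r | (r : ℝ) ∈ Ico a b} ≠ 0 := by
  intro h0
  have h1 := radMeas_Iio b (ha.trans hab)
  have h2 := radMeas_Iio a ha
  have : radMeas {r | (r : ℝ) ∈ Iio b} ≤
      radMeas {r | (r : ℝ) ∈ Iio a} + radMeas {r | (r : ℝ) ∈ Ico a b} := by
    refine (measure_mono ?_).trans (measure_union_le _ _)
    intro r hr
    by_cases h : (r : ℝ) < a
    · exact Or.inl h
    · exact Or.inr ⟨not_lt.1 h, hr⟩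
  rw [h1, h2, h0, add_zero, ENNReal.ofReal_le_ofReal_iff (by positivity)] at this
  have h3 : a ^ 3 < b ^ 3 := by gcongr
  linarith

lemma hasFDerivAt_norm_ne {y : Sp} (hy : y ≠ 0) :
    HasFDerivAt (fun z : Sp => ‖z‖) (‖y‖⁻¹ • innerSL ℝ y) y := by
  have hn : ‖y‖ ≠ 0 := norm_ne_zero_iff.2 hy
  have h := (hasStrictFDerivAt_norm_sq y).hasFDerivAt.sqrt (by positivity)
  simp only [Real.sqrt_sq (norm_nonneg _)] at h
  refine h.congr_fderiv ?_
  ext v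
  simp
  field_simp

/-- Differential of the radial projection onto the sphere of radius `ρ`. -/
lemma hasFDerivAt_proj {y : Sp} (hy : y ≠ 0) (ρ : ℝ) :
    HasFDerivAt (fun z : Sp => (ρ * ‖z‖⁻¹) • z)
      ((ρ * ‖y‖⁻¹) • ContinuousLinearMap.id ℝ Sp +
        ((ρ • (-(‖y‖ ^ 2)⁻¹) • (‖y‖⁻¹ • innerSL ℝ y)).smulRight y)) y := by
  have hn : ‖y‖ ≠ 0 := norm_ne_zero_iff.2 hy
  have h1 := ((hasDerivAt_inv hn).comp_hasFDerivAt y (hasFDerivAt_norm_ne hy)).const_mul ρ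
  exact h1.smul (hasFDerivAt_id y)

lemma sp_eq_sum (v : Sp) : v = ∑ k : Fin 3, v k • EuclideanSpace.single k (1 : ℝ) := by
  ext i
  simp [Fin.sum_univ_three]
  fin_cases i <;> simp

lemma fderiv_space (g : Fn) (p : Pt) (w : Sp) :
    fderiv ℝ g p (0, w) = ∑ k : Fin 3, w k * pd k.succ g p := by
  have : ((0 : ℝ), w) = ∑ k : Fin 3, w k • ((0 : ℝ), EuclideanSpace.single k (1 : ℝ)) := by
    refine Prod.ext ?_ ?_
    · simp [Prod.fst_sum]
    · simpa [Prod.snd_sum] using sp_eq_sum w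
  rw [this, map_sum]
  exact Finset.sum_congr rfl fun k _ => by rw [map_smul]; rfl

lemma inner_sp (y v : Sp) : inner ℝ y v = ∑ j : Fin 3, y j * v j := by
  simp [PiLp.inner_apply, mul_comm]

/-- Sum of the squares of `g` and its rotational derivatives. -/
def rotQ (g : Fn) : Fn := fun p => g p ^ 2 + (om 0 1 g p ^ 2 + om 1 2 g p ^ 2 + om 0 2 g p ^ 2)

lemma rotQ_nonneg (g : Fn) (p : Pt) : 0 ≤ rotQ g p := by unfold rotQ; positivity

lemma abs_le_sqrt_rotQ (g : Fn) (p : Pt) : |g p| ≤ √(rotQ g p) := by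
  refine Real.abs_le_sqrt (le_add_of_nonneg_right ?_)
  positivity

/-- Derivatives of a function composed with the radial projection are rotational. -/
lemma fderiv_proj_le {g : Fn} (hg : Sm g) (t : ℝ) {ρ : ℝ} (hρ : 0 < ρ) {y : Sp} (hy : y ≠ 0) :
    ∃ D : Sp →L[ℝ] ℝ, HasFDerivAt (fun z : Sp => g (t, (ρ * ‖z‖⁻¹) • z)) D y ∧
      ‖D‖ ≤ ‖y‖⁻¹ * (9 * √(rotQ g (t, (ρ * ‖y‖⁻¹) • y))) := by
  have hn : 0 < ‖y‖ := norm_pos_iff.2 hy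
  refine ⟨_, (hasFDerivAt_slice hg t _).comp y (hasFDerivAt_proj hy ρ), ?_⟩
  refine ContinuousLinearMap.opNorm_le_bound _ (by positivity) fun v => ?_
  set z : Sp := (ρ * ‖y‖⁻¹) • y with hz
  have hzc : ∀ k, z k = ρ * ‖y‖⁻¹ * y k := fun k => by simp [hz]
  have hQ := rotQ_nonneg g (t, z)
  set q := √(rotQ g (t, z)) with hq
  have hq2 : q ^ 2 = rotQ g (t, z) := Real.sq_sqrt hQ
  have hrot : ∀ k j : Fin 3, |z k * pd j.succ g (t, z) - z j * pd k.succ g (t, z)| ≤ q := by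
    have key : ∀ a : ℝ, a ^ 2 ≤ q ^ 2 → |a| ≤ q := fun a ha => abs_le_of_sq_le_sq ha (sqrt_nonneg _)
    have e : ∀ i j, om i j g (t, z) = z i * pd j.succ g (t, z) - z j * pd i.succ g (t, z) :=
      fun _ _ => rfl
    unfold rotQ at hq2
    simp only [e] at hq2
    intro k j
    apply key
    fin_cases k <;> fin_cases j <;> simp only [Fin.reduceFinMk, Fin.zero_eta, Fin.mk_one] <;>
      nlinarith [sq_nonneg (g (t, z)),
        sq_nonneg (z 0 * pd (Fin.succ 1) g (t, z) - z 1 * pd (Fin.succ 0) g (t, z)),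
        sq_nonneg (z 1 * pd (Fin.succ 2) g (t, z) - z 2 * pd (Fin.succ 1) g (t, z)),
        sq_nonneg (z 0 * pd (Fin.succ 2) g (t, z) - z 2 * pd (Fin.succ 0) g (t, z))]
  have hyn : ∑ j : Fin 3, y j ^ 2 = ‖y‖ ^ 2 := (norm_sq_sp y).symm
  have hval : fderiv ℝ g (t, z) (0, (ρ * ‖y‖⁻¹) • v + (ρ • (-(‖y‖ ^ 2)⁻¹) •
      (‖y‖⁻¹ • innerSL ℝ y)) v • y) = (‖y‖ ^ 2)⁻¹ * ∑ k : Fin 3, ∑ j : Fin 3,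
        (y j * v k) * (z j * pd k.succ g (t, z) - z k * pd j.succ g (t, z)) := by
    rw [fderiv_space]
    simp only [PiLp.add_apply, PiLp.smul_apply, smul_eq_mul, _root_.smul_apply,
      innerSL_apply_apply, inner_sp, hzc]
    have e1 : (ρ * ‖y‖⁻¹) = (‖y‖ ^ 2)⁻¹ * (ρ * ‖y‖⁻¹) * ‖y‖ ^ 2 := by field_simp
    have e2 : ∀ k, ρ * ‖y‖⁻¹ * v k + ρ * (-(‖y‖ ^ 2)⁻¹ * (‖y‖⁻¹ * ∑ j, y j * v j)) * y k =
        (‖y‖ ^ 2)⁻¹ * (ρ * ‖y‖⁻¹) * (‖y‖ ^ 2 * v k - (∑ j, y j * v j) * y k) := by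
      intro k
      linear_combination (v k) * e1
    rw [Finset.sum_congr rfl fun k _ => by rw [e2 k]]
    generalize (‖y‖ ^ 2)⁻¹ = a at *
    rw [← hyn]
    simp only [Fin.sum_univ_three]
    ring
  change ‖fderiv ℝ g (t, z) (0, (ρ * ‖y‖⁻¹) • v + (ρ • (-(‖y‖ ^ 2)⁻¹) •
      (‖y‖⁻¹ • innerSL ℝ y)) v • y)‖ ≤ _
  rw [hval, Real.norm_eq_abs, abs_mul, abs_of_pos (by positivity : 0 < (‖y‖ ^ 2)⁻¹)]
  have hs : |∑ k : Fin 3, ∑ j : Fin 3,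
      (y j * v k) * (z j * pd k.succ g (t, z) - z k * pd j.succ g (t, z))| ≤
      9 * (‖y‖ * ‖v‖ * q) := by
    have : ∀ k j, |(y j * v k) * (z j * pd k.succ g (t, z) - z k * pd j.succ g (t, z))| ≤
        ‖y‖ * ‖v‖ * q := by
      intro k j
      rw [abs_mul, abs_mul]
      have h1 := abs_coord_le y j
      have h2 := abs_coord_le v k
      have h3 := hrot j k
      gcongr
    refine (abs_sum_fin3_le fun k => abs_sum_fin3_le fun j => this k j).trans (by linarith)
  calc (‖y‖ ^ 2)⁻¹ * _ ≤ (‖y‖ ^ 2)⁻¹ * (9 * (‖y‖ * ‖v‖ * q)) := by gcongr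
    _ = ‖y‖⁻¹ * (9 * q) * ‖v‖ := by field_simp

open scoped ENNReal NNReal

/-- A radial cut-off supported in a shell. -/
lemma exists_shell : ∃ (X : Sp → ℝ) (K : ℝ), ContDiff ℝ 1 X ∧ 0 ≤ K ∧ (∀ y, 0 ≤ X y) ∧
    (∀ y, X y ≤ 1) ∧ (∀ y, ‖fderiv ℝ X y‖ ≤ K) ∧ (∀ y, ‖y‖ ^ 2 ≤ 2 → X y = 0) ∧
    (∀ y, 6 ≤ ‖y‖ ^ 2 → X y = 0) ∧ ∀ y, 3 ≤ ‖y‖ ^ 2 → ‖y‖ ^ 2 ≤ 5 → X y = 1 := by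
  let f : ContDiffBump (4 : ℝ) := ⟨1, 2, by norm_num, by norm_num⟩
  have hz : ∀ r : ℝ, 2 ≤ |r - 4| → f r = 0 := by
    intro r hr
    exact f.zero_of_le_dist (by simpa [Real.dist_eq] using hr)
  have h0 : ∀ y : Sp, 6 ≤ ‖y‖ ^ 2 → f (‖y‖ ^ 2) = 0 := fun y hy =>
    hz _ (by rw [le_abs]; left; linarith)
  have hX : ContDiff ℝ 1 fun y : Sp => f (‖y‖ ^ 2) := f.contDiff.comp (contDiff_norm_sq ℝ)
  have hc : HasCompactSupport fun y : Sp => f (‖y‖ ^ 2) := by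
    refine HasCompactSupport.of_support_subset_isCompact (isCompact_closedBall 0 3) ?_
    intro y hy
    rw [mem_closedBall_zero_iff]
    by_contra h
    push Not at h
    exact hy (h0 y (by nlinarith))
  obtain ⟨K, hK⟩ := (hX.continuous_fderiv (by norm_num)).bounded_above_of_compact_support
    (hc.fderiv (𝕜 := ℝ))
  refine ⟨_, K, hX, (norm_nonneg _).trans (hK 0), fun y => f.nonneg, fun y => f.le_one, hK,
    fun y hy => hz _ (by rw [le_abs]; right; linarith), h0, fun y h3 h5 => ?_⟩
  refine f.one_of_mem_closedBall ?_
  rw [Real.closedBall_eq_Icc]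
  constructor <;> simp only [f] <;> linarith

lemma shell_fderiv {X : Sp → ℝ} {K : ℝ} (hX : ContDiff ℝ 1 X) (h0 : ∀ y, 0 ≤ X y)
    (h1 : ∀ y, X y ≤ 1) (hK : ∀ y, ‖fderiv ℝ X y‖ ≤ K) (hlow : ∀ y, ‖y‖ ^ 2 ≤ 2 → X y = 0)
    (hup : ∀ y, 6 ≤ ‖y‖ ^ 2 → X y = 0) {g : Fn} (hg : Sm g) (t : ℝ) {ρ : ℝ} (hρ : 0 < ρ) :
    ContDiff ℝ 1 (fun y => X y * g (t, (ρ * ‖y‖⁻¹) • y)) ∧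
    ∀ y, ‖fderiv ℝ (fun y => X y * g (t, (ρ * ‖y‖⁻¹) • y)) y‖ ≤
      {x : Sp | ‖x‖ ∈ Ico 1 3}.indicator
        (fun x => (K + 9) * √(rotQ g (t, ρ • (‖x‖⁻¹ • x)))) y := by
  have hloc : ∀ y : Sp, ‖y‖ ^ 2 < 2 ∨ 6 < ‖y‖ ^ 2 →
      (fun y => X y * g (t, (ρ * ‖y‖⁻¹) • y)) =ᶠ[nhds y] fun _ => 0 := by
    intro y hy
    have hcont : Continuous fun y : Sp => ‖y‖ ^ 2 := by fun_prop
    rcases hy with hy | hy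
    · filter_upwards [hcont.continuousAt.eventually_lt_const hy] with z hz
      rw [hlow z hz.le, zero_mul]
    · filter_upwards [hcont.continuousAt.eventually_const_lt hy] with z hz
      rw [hup z hz.le, zero_mul]
  constructor
  · rw [contDiff_iff_contDiffAt]
    intro y
    by_cases hy : y = 0
    · exact contDiffAt_const.congr_of_eventuallyEq (hloc y (Or.inl (by simp [hy])))
    · refine hX.contDiffAt.mul ?_
      have h2 : ContDiffAt ℝ 1 (fun y : Sp => (t, (ρ * ‖y‖⁻¹) • y)) y :=
        contDiffAt_const.prodMk ((contDiffAt_const.mul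
          ((contDiffAt_norm ℝ hy).inv (norm_ne_zero_iff.2 hy))).smul contDiffAt_id)
      exact (hg.of_le (by norm_cast)).contDiffAt.comp y h2
  · intro y
    by_cases hy : ‖y‖ ∈ Ico (1 : ℝ) 3
    · rw [Set.indicator_of_mem (by exact hy)]
      have hy0 : y ≠ 0 := by
        rintro rfl
        norm_num at hy
      obtain ⟨D, hD, hDb⟩ := fderiv_proj_le hg t hρ hy0
      have hXd := (hX.differentiable (by norm_num) y).hasFDerivAt
      have hm : HasFDerivAt (fun y => X y * g (t, (ρ * ‖y‖⁻¹) • y))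
          (X y • D + g (t, (ρ * ‖y‖⁻¹) • y) • fderiv ℝ X y) y := hXd.mul hD
      rw [hm.fderiv]
      rw [smul_smul]
      have hg0 := abs_le_sqrt_rotQ g (t, (ρ * ‖y‖⁻¹) • y)
      set q := √(rotQ g (t, (ρ * ‖y‖⁻¹) • y))
      have hq : 0 ≤ q := Real.sqrt_nonneg _
      have hinv : ‖y‖⁻¹ ≤ 1 := inv_le_one_of_one_le₀ hy.1
      calc _ ≤ ‖X y • D‖ + ‖g (t, (ρ * ‖y‖⁻¹) • y) • fderiv ℝ X y‖ := norm_add_le _ _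
        _ = X y * ‖D‖ + |g (t, (ρ * ‖y‖⁻¹) • y)| * ‖fderiv ℝ X y‖ := by
          rw [norm_smul, norm_smul, Real.norm_eq_abs, Real.norm_eq_abs, abs_of_nonneg (h0 y)]
        _ ≤ 1 * (1 * (9 * q)) + q * K := by
          have := h1 y
          have := hK y
          have := h0 y
          have := hDb.trans (mul_le_mul_of_nonneg_right hinv (by positivity))
          gcongr
        _ = (K + 9) * q := by ring
    · rw [Set.indicator_of_notMem (by exact hy)]
      rw [(hloc y ?_).fderiv_eq]
      · simp
      · rw [mem_Ico, not_and_or] at hy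
        rcases hy with h | h
        · left; nlinarith [norm_nonneg y]
        · right; nlinarith [norm_nonneg y]

lemma Sm.om_continuous {g : Fn} (hg : Sm g) (i j : Fin 3) : Continuous (om i j g) := by
  have hc : ∀ k : Fin 3, Continuous fun p : Pt => p.2 k := fun k => by fun_prop
  exact ((hc i).mul (hg.pdc j.succ)).sub ((hc j).mul (hg.pdc i.succ))

lemma Sm.rotQ_continuous {g : Fn} (hg : Sm g) : Continuous (rotQ g) :=
  (hg.continuous.pow 2).add ((((hg.om_continuous 0 1).pow 2).add
    ((hg.om_continuous 1 2).pow 2)).add ((hg.om_continuous 0 2).pow 2))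

/-- The Sobolev inequality on spheres. -/
lemma sphere_sobolev : ∃ C : ℝ≥0∞, C ≠ ⊤ ∧ ∀ (g : Fn), Sm g → ∀ (t ρ : ℝ), 0 < ρ →
    ∫⁻ ω : S2, ENNReal.ofReal (g (t, ρ • (ω : Sp)) ^ 4) ∂sphMeas ≤
      C * (∫⁻ ω : S2, ENNReal.ofReal (rotQ g (t, ρ • (ω : Sp))) ∂sphMeas) ^ 2 := by
  obtain ⟨X, K, hX, hK0, h0, h1, hK, hlow, hup, hone⟩ := exists_shell
  set L := eLpNormLESNormFDerivOfLeConst ℝ (volume : Measure Sp) (Metric.closedBall (0 : Sp) 3) 2 4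
    with hL
  set m := radMeas {r | (r : ℝ) ∈ Ico (9 / 5 : ℝ) 2} with hm
  set M := radMeas {r | (r : ℝ) ∈ Ico (1 : ℝ) 3} with hM
  have hm0 : m ≠ 0 := radMeas_Icc_pos (by norm_num) (by norm_num)
  have hfin : ∀ a b : ℝ, 0 < b → radMeas {r | (r : ℝ) ∈ Ico a b} ≠ ⊤ := by
    intro a b hb
    refine ne_top_of_le_ne_top ?_ (measure_mono (t := {r : Ioi (0 : ℝ) | (r : ℝ) ∈ Iio b})
      fun r (hr : (r : ℝ) ∈ Ico a b) => hr.2)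
    rw [radMeas_Iio b hb]
    exact ENNReal.ofReal_ne_top
  have hmt : m ≠ ⊤ := hfin _ _ (by norm_num)
  have hMt : M ≠ ⊤ := hfin _ _ (by norm_num)
  refine ⟨m⁻¹ * ((L : ℝ≥0∞) ^ 4 * (M * ENNReal.ofReal ((K + 9) ^ 2)) ^ 2), ?_, ?_⟩
  · refine ENNReal.mul_ne_top (ENNReal.inv_ne_top.2 hm0) (ENNReal.mul_ne_top ?_ ?_)
    · exact ENNReal.pow_ne_top ENNReal.coe_ne_top
    · exact ENNReal.pow_ne_top (ENNReal.mul_ne_top hMt ENNReal.ofReal_ne_top)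
  intro g hg t ρ hρ
  obtain ⟨hG, hF⟩ := shell_fderiv hX h0 h1 hK hlow hup hg t hρ
  set G : Sp → ℝ := fun y => X y * g (t, (ρ * ‖y‖⁻¹) • y) with hGd
  have hsup : G.support ⊆ Metric.closedBall 0 3 := by
    intro y hy
    rw [mem_closedBall_zero_iff]
    by_contra h
    push Not at h
    exact hy (by simp [hGd, hup y (by nlinarith)])
  have hS := eLpNorm_le_eLpNorm_fderiv_of_le (volume : Measure Sp) hG hsup (p := 2) (q := 4)
    (by norm_num) (by simp; norm_num) (by simp; norm_num) Metric.isBounded_closedBall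
  rw [← hL] at hS
  have h4 := eLpNorm_nnreal_pow_eq_lintegral (f := G) (μ := (volume : Measure Sp)) (p := 4)
    (by norm_num)
  have h2 := eLpNorm_nnreal_pow_eq_lintegral (f := fderiv ℝ G) (μ := (volume : Measure Sp))
    (p := 2) (by norm_num)
  have c4 : ((4 : ℝ≥0) : ℝ) = ((4 : ℕ) : ℝ) := by norm_num
  have c2 : ((2 : ℝ≥0) : ℝ) = ((2 : ℕ) : ℝ) := by norm_num
  rw [c4] at h4
  rw [c2] at h2
  simp only [ENNReal.rpow_natCast] at h4 h2
  have hcont : Continuous fun z : Sp => g (t, ρ • z) :=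
    hg.continuous.comp (by fun_prop)
  have hcontQ : Continuous fun z : Sp => rotQ g (t, ρ • z) :=
    hg.rotQ_continuous.comp (by fun_prop)
  have hlo := lintegral_polar_prod (H := fun z => ENNReal.ofReal (g (t, ρ • z) ^ 4))
    (I := Ico (9 / 5) 2) (by exact (hcont.pow 4).measurable.ennreal_ofReal) measurableSet_Ico
  have hhi := lintegral_polar_prod
    (H := fun z => ENNReal.ofReal ((K + 9) ^ 2) * ENNReal.ofReal (rotQ g (t, ρ • z)))
    (I := Ico 1 3) (by exact hcontQ.measurable.ennreal_ofReal.const_mul _) measurableSet_Ico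
  have hmQ : Measurable fun ω : S2 => ENNReal.ofReal (rotQ g (t, ρ • (ω : Sp))) :=
    hcontQ.measurable.ennreal_ofReal.comp measurable_subtype_coe
  rw [lintegral_const_mul _ hmQ] at hhi
  rw [← hm] at hlo
  rw [← hM] at hhi
  have hlo' : m * ∫⁻ ω : S2, ENNReal.ofReal (g (t, ρ • (ω : Sp)) ^ 4) ∂sphMeas ≤
      ∫⁻ x, ‖G x‖ₑ ^ 4 := by
    rw [← hlo]
    refine lintegral_mono fun x => ?_
    by_cases hx : ‖x‖ ∈ Ico (9 / 5 : ℝ) 2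
    · rw [Set.indicator_of_mem (by exact hx)]
      have : G x = g (t, ρ • (‖x‖⁻¹ • x)) := by
        simp only [hGd]
        rw [hone x (by nlinarith [hx.1, hx.2]) (by nlinarith [hx.1, hx.2]), one_mul, smul_smul]
      rw [this, Real.enorm_eq_ofReal_abs, ← ENNReal.ofReal_pow (abs_nonneg _)]
      refine ENNReal.ofReal_le_ofReal ?_
      rw [← abs_pow]
      exact le_abs_self _
    · rw [Set.indicator_of_notMem (by exact hx)]
      exact zero_le
  have hhi' : ∫⁻ x, ‖fderiv ℝ G x‖ₑ ^ 2 ≤ M * (ENNReal.ofReal ((K + 9) ^ 2) *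
      ∫⁻ ω : S2, ENNReal.ofReal (rotQ g (t, ρ • (ω : Sp))) ∂sphMeas) := by
    rw [← hhi]
    refine lintegral_mono fun x => ?_
    have hx := hF x
    rw [← ofReal_norm, ← ENNReal.ofReal_pow (norm_nonneg _)]
    by_cases hx1 : ‖x‖ ∈ Ico (1 : ℝ) 3
    · rw [Set.indicator_of_mem (by exact hx1)] at hx ⊢
      rw [← ENNReal.ofReal_mul (by positivity)]
      refine ENNReal.ofReal_le_ofReal ?_
      refine (pow_le_pow_left₀ (norm_nonneg _) hx 2).trans ?_
      rw [mul_pow, Real.sq_sqrt (rotQ_nonneg _ _)]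
    · rw [Set.indicator_of_notMem (by exact hx1)] at hx ⊢
      have : ‖fderiv ℝ G x‖ = 0 := le_antisymm hx (norm_nonneg _)
      simp [this]
  set I4 := ∫⁻ ω : S2, ENNReal.ofReal (g (t, ρ • (ω : Sp)) ^ 4) ∂sphMeas
  set I2 := ∫⁻ ω : S2, ENNReal.ofReal (rotQ g (t, ρ • (ω : Sp))) ∂sphMeas
  have hfinal : m * I4 ≤ (L : ℝ≥0∞) ^ 4 * (M * ENNReal.ofReal ((K + 9) ^ 2)) ^ 2 * I2 ^ 2 := by
    calc m * I4 ≤ eLpNorm G ((4 : ℝ≥0) : ℝ≥0∞) volume ^ 4 := by rw [h4]; exact hlo'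
      _ ≤ ((L : ℝ≥0∞) * eLpNorm (fderiv ℝ G) ((2 : ℝ≥0) : ℝ≥0∞) volume) ^ 4 := by gcongr
      _ = (L : ℝ≥0∞) ^ 4 * (eLpNorm (fderiv ℝ G) ((2 : ℝ≥0) : ℝ≥0∞) volume ^ 2) ^ 2 := by ring
      _ ≤ (L : ℝ≥0∞) ^ 4 * (M * (ENNReal.ofReal ((K + 9) ^ 2) * I2)) ^ 2 := by
        rw [h2]; gcongr
      _ = _ := by ring
  calc I4 = m⁻¹ * (m * I4) := by rw [← mul_assoc, ENNReal.inv_mul_cancel hm0 hmt, one_mul]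
    _ ≤ m⁻¹ * ((L : ℝ≥0∞) ^ 4 * (M * ENNReal.ofReal ((K + 9) ^ 2)) ^ 2 * I2 ^ 2) := by gcongr
    _ = _ := by ring

open scoped ENNReal NNReal

instance : IsFiniteMeasure sphMeas := inferInstanceAs (IsFiniteMeasure (volume : Measure Sp).toSphere)

lemma integrable_sphere {f : S2 → ℝ} (hf : Continuous f) : Integrable f sphMeas :=
  hf.integrable_of_hasCompactSupport (HasCompactSupport.of_compactSpace f)

lemma sqrt_ofReal_pow_four (B : ℝ) :
    ENNReal.ofReal (B ^ 4) ^ (1 / 2 : ℝ) = ENNReal.ofReal (B ^ 2) := by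
  rw [ENNReal.ofReal_rpow_of_nonneg (by positivity) (by norm_num), ← Real.sqrt_eq_rpow,
    show B ^ 4 = (B ^ 2) ^ 2 by ring, Real.sqrt_sq (by positivity)]

lemma sqrt_mul_sq (C J : ℝ≥0∞) : (C * J ^ 2) ^ (1 / 2 : ℝ) = C ^ (1 / 2 : ℝ) * J := by
  rw [ENNReal.mul_rpow_of_nonneg _ _ (by norm_num), ← ENNReal.rpow_natCast, ← ENNReal.rpow_mul]
  norm_num

lemma lintegral_holder_two {F G : S2 → ℝ} (hF : Continuous F) (hG : Continuous G) :
    ∫⁻ ω, ENNReal.ofReal (F ω ^ 2 * G ω ^ 2) ∂sphMeas ≤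
      (∫⁻ ω, ENNReal.ofReal (F ω ^ 2) ^ (2 : ℝ) ∂sphMeas) ^ (1 / 2 : ℝ) *
      (∫⁻ ω, ENNReal.ofReal (G ω ^ 2) ^ (2 : ℝ) ∂sphMeas) ^ (1 / 2 : ℝ) := by
  have hF' : Measurable fun ω => ENNReal.ofReal (F ω ^ 2) := (hF.pow 2).measurable.ennreal_ofReal
  have hG' : Measurable fun ω => ENNReal.ofReal (G ω ^ 2) := (hG.pow 2).measurable.ennreal_ofReal
  have hH := ENNReal.lintegral_mul_le_Lp_mul_Lq sphMeas Real.HolderConjugate.two_two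
    hF'.aemeasurable hG'.aemeasurable
  refine le_trans (le_of_eq (lintegral_congr fun ω => ?_)) hH
  exact ENNReal.ofReal_mul (sq_nonneg _)

/-- The Hölder inequality on the sphere with exponents `4, 4`. -/
lemma sphere_holder {F G : S2 → ℝ} (hF : Continuous F) (hG : Continuous G) {B : ℝ}
    {C J : ℝ≥0∞} (h1 : (∫ ω, |F ω| ^ 4 ∂sphMeas) ^ ((1 : ℝ) / 4) ≤ B)
    (h2 : ∫⁻ ω, ENNReal.ofReal (G ω ^ 4) ∂sphMeas ≤ C * J ^ 2) :
    ∫⁻ ω, ENNReal.ofReal (F ω ^ 2 * G ω ^ 2) ∂sphMeas ≤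
      ENNReal.ofReal (B ^ 2) * C ^ (1 / 2 : ℝ) * J := by
  have two : (2 : ℝ) = ((2 : ℕ) : ℝ) := by norm_num
  have hsq : ∀ a : ℝ, ENNReal.ofReal (a ^ 2) ^ (2 : ℝ) = ENNReal.ofReal (a ^ 4) := by
    intro a
    rw [ENNReal.ofReal_rpow_of_nonneg (sq_nonneg _) (by norm_num), two, Real.rpow_natCast,
      ← pow_mul]
  have hf4 : ∫⁻ ω, ENNReal.ofReal (F ω ^ 2) ^ (2 : ℝ) ∂sphMeas ≤ ENNReal.ofReal (B ^ 4) := by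
    have hnn : 0 ≤ ∫ ω, |F ω| ^ 4 ∂sphMeas := integral_nonneg fun _ => by positivity
    have h3 : ∫ ω, |F ω| ^ 4 ∂sphMeas ≤ B ^ 4 := by
      have h2 := pow_le_pow_left₀ (Real.rpow_nonneg hnn _) h1 4
      rwa [← Real.rpow_natCast (_ ^ _), ← Real.rpow_mul hnn,
        show (1 : ℝ) / 4 * ((4 : ℕ) : ℝ) = 1 by norm_num, Real.rpow_one] at h2
    refine le_trans (le_of_eq ?_) (ENNReal.ofReal_le_ofReal h3)
    have hi : Integrable (fun ω => |F ω| ^ 4) sphMeas := integrable_sphere (hF.abs.pow 4)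
    rw [ofReal_integral_eq_lintegral_ofReal hi (Filter.Eventually.of_forall fun _ => by positivity)]
    refine lintegral_congr fun ω => ?_
    rw [hsq, ← abs_pow, abs_of_nonneg (by positivity)]
  have hg4 : ∫⁻ ω, ENNReal.ofReal (G ω ^ 2) ^ (2 : ℝ) ∂sphMeas ≤ C * J ^ 2 :=
    (lintegral_congr fun ω => hsq (G ω)).trans_le h2
  rw [mul_assoc, ← sqrt_ofReal_pow_four B, ← sqrt_mul_sq C J]
  have h0 : (0 : ℝ) ≤ 1 / 2 := by norm_num
  exact (lintegral_holder_two hF hG).trans (mul_le_mul' (ENNReal.rpow_le_rpow hf4 h0)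
    (ENNReal.rpow_le_rpow hg4 h0))

lemma CS.rotQ {t : ℝ} {g : Fn} (hg : Sm g) (hs : SC t g) : CS t (rotQ g) := by
  refine ⟨hg.rotQ_continuous, ?_⟩
  have h3 : SC t (om 0 1 g) := hs.Zop 3
  have h4 : SC t (om 1 2 g) := hs.Zop 4
  have h5 : SC t (om 0 2 g) := hs.Zop 5
  exact (hs.mono fun p hp => by simp [hp]).add (((h3.mono fun p hp => by simp [hp]).add
    (h4.mono fun p hp => by simp [hp])).add (h5.mono fun p hp => by simp [hp]))

/-- The product estimate from Sobolev embedding on spheres. -/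
lemma sphere_product : ∃ C : ℝ, 0 ≤ C ∧ ∀ (f g : Fn) (t B : ℝ), Continuous f → Sm g → SC t g →
    (∀ ρ, 0 < ρ → L4sph (fun x => f (t, x)) ρ ≤ B) →
    In t (fun p => f p ^ 2 * g p ^ 2) ≤ C * B ^ 2 * In t (rotQ g) := by
  obtain ⟨C, hC, hS⟩ := sphere_sobolev
  refine ⟨(C ^ (1 / 2 : ℝ)).toReal, ENNReal.toReal_nonneg, fun f g t B hf hg hs hL => ?_⟩
  have hgC : Continuous g := hg.continuous
  have hft : Continuous fun x : Sp => f (t, x) := hf.comp (by fun_prop)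
  have hgt : Continuous fun x : Sp => g (t, x) := hgC.comp (by fun_prop)
  have hQs := CS.rotQ hg hs
  have hQt : Continuous fun x : Sp => rotQ g (t, x) := hQs.cont.comp (by fun_prop)
  have hslice : ∀ ρ : ℝ, 0 < ρ →
      ∫⁻ ω : S2, ENNReal.ofReal (f (t, ρ • (ω : Sp)) ^ 2 * g (t, ρ • (ω : Sp)) ^ 2) ∂sphMeas ≤
      ENNReal.ofReal (B ^ 2) * C ^ (1 / 2 : ℝ) *
        ∫⁻ ω : S2, ENNReal.ofReal (rotQ g (t, ρ • (ω : Sp))) ∂sphMeas := fun ρ hρ =>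
    sphere_holder (F := fun ω : S2 => f (t, ρ • (ω : Sp))) (G := fun ω : S2 => g (t, ρ • (ω : Sp)))
      (hft.comp (by fun_prop)) (hgt.comp (by fun_prop)) (hL ρ hρ) (hS g hg t ρ hρ)
  have hl : ∫⁻ x : Sp, ENNReal.ofReal (f (t, x) ^ 2 * g (t, x) ^ 2) ≤
      ENNReal.ofReal (B ^ 2) * C ^ (1 / 2 : ℝ) * ∫⁻ x : Sp, ENNReal.ofReal (rotQ g (t, x)) := by
    have hCt : C ^ (1 / 2 : ℝ) ≠ ⊤ := ENNReal.rpow_ne_top_of_nonneg (by norm_num) hC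
    have hm : Measurable fun x : Sp => ENNReal.ofReal (f (t, x) ^ 2 * g (t, x) ^ 2) :=
      ((hft.pow 2).mul (hgt.pow 2)).measurable.ennreal_ofReal
    rw [lintegral_polar hm,
      lintegral_polar hQt.measurable.ennreal_ofReal,
      ← lintegral_const_mul' _ _ (ENNReal.mul_ne_top ENNReal.ofReal_ne_top hCt)]
    exact lintegral_mono fun r => hslice r r.2
  have hfg : CS t fun p => f p ^ 2 * g p ^ 2 :=
    (CS.sq (CS.of_sm hg hs)).mul_left (hf.pow 2)
  have i1 := ofReal_integral_eq_lintegral_ofReal hfg.int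
    (Filter.Eventually.of_forall fun x => mul_nonneg (sq_nonneg _) (sq_nonneg _))
  have i2 := ofReal_integral_eq_lintegral_ofReal hQs.int
    (Filter.Eventually.of_forall fun x => rotQ_nonneg _ _)
  have hn := In_nonneg (t := t) (rotQ_nonneg g)
  rw [← i1, ← i2] at hl
  have hCt : C ^ (1 / 2 : ℝ) ≠ ⊤ := ENNReal.rpow_ne_top_of_nonneg (by norm_num) hC
  rw [← ENNReal.ofReal_toReal hCt, ← ENNReal.ofReal_mul (by positivity),
    ← ENNReal.ofReal_mul (by positivity)] at hl
  have := (ENNReal.ofReal_le_ofReal_iff (mul_nonneg (by positivity) hn)).1 hl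
  calc _ ≤ _ := this
    _ = _ := by unfold In; ring

lemma sum_eight {A a b c d e f g h : ℝ} (hA : A = a + b + c + d + e + f + g + h) (ha : 0 ≤ a)
    (hb : 0 ≤ b) (hc : 0 ≤ c) (hd : 0 ≤ d) (he : 0 ≤ e) (hf : 0 ≤ f) (hg : 0 ≤ g) (hh : 0 ≤ h) :
    0 ≤ A ∧ b ≤ A ∧ d ≤ A ∧ e ≤ A ∧ g ≤ A := by
  refine ⟨?_, ?_, ?_, ?_, ?_⟩ <;> linarith

lemma pdNorm_sq (v : Fn) (p : Pt) : pdNorm v p ^ 2 = gsq v p :=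
  Real.sq_sqrt (gsq_nonneg v p)

lemma pdNorm_nonneg (v : Fn) (p : Pt) : 0 ≤ pdNorm v p := Real.sqrt_nonneg _

lemma Sm.pdNorm_continuous {v : Fn} (hv : Sm v) : Continuous (pdNorm v) := by
  unfold pdNorm
  exact Real.continuous_sqrt.comp
    (continuous_finsetSum _ fun α _ => (hv.pdc α).pow 2)

lemma SC.pdNorm {t : ℝ} {v : Fn} (h : SC t v) : SC t (pdNorm v) := by
  have h1 : SC t (gsq v) := SC.sum _ fun α _ => (h.pd α).mono fun p hp => by simp [hp]
  exact h1.mono fun p hp => by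
    have := pdNorm_sq v p
    rw [hp] at this
    exact pow_eq_zero_iff (two_ne_zero) |>.1 this

lemma exists_slice_bound {t : ℝ} {f : Fn} (hf : CS t f) {w : Sp → ℝ} (hw : Continuous w) :
    ∃ K, 0 ≤ K ∧ ∀ x, |w x * f (t, x)| ≤ K := by
  obtain ⟨R, hR⟩ := hf.sc
  have hR := hR.self_of_nhds
  have hc : Continuous fun x : Sp => w x * f (t, x) := hw.mul (hf.cont.comp (by fun_prop))
  obtain ⟨K, hK⟩ := (isCompact_closedBall (0 : Sp) R).exists_bound_of_continuousOn hc.continuousOn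
  refine ⟨max K 0, le_max_right _ _, fun x => ?_⟩
  by_cases hx : ‖x‖ ≤ R
  · exact (hK x (by simpa using hx)).trans (le_max_left _ _)
  · rw [hR x (not_le.1 hx)]
    simp

lemma le_Linf {t : ℝ} {f : Fn} (hf : CS t f) {w : Sp → ℝ} (hw : Continuous w) (x : Sp) :
    w x * f (t, x) ≤ Linf fun x => w x * f (t, x) := by
  obtain ⟨K, _, hK⟩ := exists_slice_bound hf hw
  exact (le_abs_self _).trans
    (le_ciSup (f := fun x => |w x * f (t, x)|) ⟨K, by rintro _ ⟨y, rfl⟩; exact hK y⟩ x)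

lemma le_LinfrL4 {t : ℝ} {f : Fn} (hf : CS t f) {w : Sp → ℝ} (hw : Continuous w) {ρ : ℝ}
    (hρ : 0 < ρ) : L4sph (fun x => w x * f (t, x)) ρ ≤ LinfrL4 fun x => w x * f (t, x) := by
  obtain ⟨K, hK0, hK⟩ := exists_slice_bound hf hw
  refine le_ciSup (f := fun r : Set.Ioi (0:ℝ) => L4sph (fun x => w x * f (t, x)) (r : ℝ))
    ⟨(∫ _ : S2, K ^ 4 ∂sphMeas) ^ ((1:ℝ)/4), ?_⟩ ⟨ρ, hρ⟩
  rintro _ ⟨r, rfl⟩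
  have hc : Continuous fun x : Sp => w x * f (t, x) := hw.mul (hf.cont.comp (by fun_prop))
  have hi : Continuous fun ω : S2 => |w ((r : ℝ) • (ω : Sp)) * f (t, (r : ℝ) • (ω : Sp))| ^ 4 :=
    ((hc.comp (by fun_prop : Continuous fun ω : S2 => (r : ℝ) • (ω : Sp))).abs).pow 4
  refine Real.rpow_le_rpow (integral_nonneg fun _ => by positivity)
    (integral_mono (integrable_sphere hi) (integrable_const _) fun ω => ?_) (by norm_num)
  exact pow_le_pow_left₀ (abs_nonneg _) (hK _) 4

lemma Linf_nonneg (f : Sp → ℝ) : 0 ≤ Linf f := Real.iSup_nonneg fun _ => abs_nonneg _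

lemma LinfrL4_nonneg (f : Sp → ℝ) : 0 ≤ LinfrL4 f :=
  Real.iSup_nonneg fun _ => Real.rpow_nonneg (integral_nonneg fun _ => by positivity) _

lemma wL6_nonneg (w : Sp → ℝ) (v : Fn) (t : ℝ) : 0 ≤ wL6 w v t :=
  Real.rpow_nonneg (integral_nonneg fun _ => by positivity) _

lemma jb_continuous : Continuous jb := by unfold jb; fun_prop

/-- The consequences of a bound on `⟨⟨u(t)⟩⟩` that enter the nonlinear estimates. -/
structure Adm (c0 δ : ℝ) (u : Fin 3 → Fn) (t A : ℝ) : Prop where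
  sm : ∀ i, Sm (u i)
  sc : ∀ i, SC t (u i)
  ht : 0 < t
  hA : 0 ≤ A
  hA1 : A ≤ 1
  inf1 : ∀ i a, ∑ l, a l ≤ 1 → ∀ x : Sp, ‖x‖ ^ 2 * jb (cspeed c0 i * t - ‖x‖) *
    gsq (Zmulti a (u i)) (t, x) ≤ A ^ 2 * (jb t ^ (sig δ i + δ)) ^ 2
  inf2 : ∀ i a, ∑ l, a l ≤ 1 → ∀ x : Sp, jb (cspeed c0 i * t - ‖x‖) ^ 2 *
    gsq (Zmulti a (u i)) (t, x) ≤ A ^ 2 * (jb t ^ (sig δ i + δ)) ^ 2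
  sph1 : ∀ i a, ∑ l, a l ≤ 1 → ∀ ρ, 0 < ρ →
    L4sph (fun x => ‖x‖ * pdNorm (Zmulti a (u i)) (t, x)) ρ ≤ A * jb t ^ sig δ i
  sph2 : ∀ i a, ∑ l, a l ≤ 2 → ∀ ρ, 0 < ρ →
    L4sph (fun x => Real.sqrt ‖x‖ * jb (cspeed c0 i * t - ‖x‖) * pdNorm (Zmulti a (u i)) (t, x)) ρ
      ≤ A * jb t ^ (sig δ i + δ)
  sph3 : ∀ i a l, ∑ l, a l ≤ 2 → ∀ ρ, 0 < ρ →
    L4sph (fun x => Real.sqrt ‖x‖ * Zop l (Zmulti a (u i)) (t, x)) ρ ≤ A * jb t ^ (sig δ i + δ)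

lemma le_of_rpow_neg_mul_le {T s y A : ℝ} (hT : 0 < T) (h : T ^ (-s) * y ≤ A) : y ≤ A * T ^ s := by
  rw [Real.rpow_neg hT.le] at h
  exact (inv_mul_le_iff₀ (Real.rpow_pos_of_pos hT s)).1 h |>.trans_eq (mul_comm _ _)

lemma sum_le_of_mem {ι : Type*} {s : Finset ι} {f : ι → ℝ} {A : ℝ} (h : ∑ i ∈ s, f i ≤ A)
    (hf : ∀ i, 0 ≤ f i) {i : ι} (hi : i ∈ s) : f i ≤ A :=
  (Finset.single_le_sum (fun i _ => hf i) hi).trans h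

lemma bigBracket_nonneg_and_adm {c0 δ : ℝ} {u : Fin 3 → Fn} {t : ℝ} (hu : ∀ i, Sm (u i))
    (hs : ∀ i, SC t (u i)) (ht : 0 < t) : 0 ≤ bigBracket c0 δ u t ∧
      (bigBracket c0 δ u t ≤ 1 → Adm c0 δ u t (bigBracket c0 δ u t)) := by
  have hT : 0 < jb t := jb_pos t
  have hP : ∀ s : ℝ, 0 ≤ jb t ^ s := fun s => Real.rpow_nonneg hT.le s
  have nI : ∀ w v, 0 ≤ wInf w v t := fun w v => Linf_nonneg _
  have nL : ∀ w v, 0 ≤ wL4 w v t := fun w v => LinfrL4_nonneg _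
  have n4 : ∀ i a, 0 ≤ wL4 (fun x => Real.sqrt ‖x‖ * jb (cspeed c0 i * t - ‖x‖)) (Zmulti a (u i)) t
      + ∑ j : Fin 7, LinfrL4 fun x => Real.sqrt ‖x‖ * Zop j (Zmulti a (u i)) (t,x) := fun i a =>
    add_nonneg (nL _ _) (Finset.sum_nonneg fun _ _ => LinfrL4_nonneg _)
  obtain ⟨h0, hb, hd, he, hg⟩ := sum_eight (A := bigBracket c0 δ u t) rfl
    (Finset.sum_nonneg fun i _ => mul_nonneg (hP _) (nI _ _))
    (Finset.sum_nonneg fun i _ => Finset.sum_nonneg fun a _ => mul_nonneg (hP _) (nI _ _))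
    (Finset.sum_nonneg fun i _ => Finset.sum_nonneg fun a _ => mul_nonneg (hP _) (n4 i a))
    (Finset.sum_nonneg fun i _ => Finset.sum_nonneg fun a _ => mul_nonneg (hP _) (n4 i a))
    (Finset.sum_nonneg fun i _ => Finset.sum_nonneg fun a _ => mul_nonneg (hP _) (nL _ _))
    (Finset.sum_nonneg fun i _ => mul_nonneg (hP _) (nI _ _))
    (mul_nonneg (hP _) (Finset.sum_nonneg fun i _ => Finset.sum_nonneg fun a _ =>
      mul_nonneg (hP _) (nI _ _)))
    (Finset.sum_nonneg fun i _ => Finset.sum_nonneg fun a _ => mul_nonneg (hP _) (wL6_nonneg _ _ _))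
  refine ⟨h0, fun h1 => ?_⟩
  have cN : ∀ i a, CS t (pdNorm (Zmulti a (u i))) := fun i a =>
    ⟨((hu i).Zmulti a).pdNorm_continuous, ((hs i).Zmulti a).pdNorm⟩
  have cZ : ∀ i a l, CS t (Zop l (Zmulti a (u i))) := fun i a l =>
    CS.of_sm (((hu i).Zmulti a).Zop l) (((hs i).Zmulti a).Zop l)
  have cj : ∀ c : ℝ, Continuous fun x : Sp => jb (c * t - ‖x‖) := fun c =>
    jb_continuous.comp (by fun_prop)
  have csq : Continuous fun x : Sp => Real.sqrt ‖x‖ := by fun_prop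
  have m1 : ∀ {a : Fin 7 → ℕ} {m}, ∑ l, a l ≤ m → a ∈ idxSet 7 m := fun h => mem_idxSet.2 h
  have q4 : ∀ (i : Fin 3) (a : Fin 7 → ℕ), ∑ l, a l ≤ 2 →
      wL4 (fun x => Real.sqrt ‖x‖ * jb (cspeed c0 i * t - ‖x‖)) (Zmulti a (u i)) t
        + (∑ j : Fin 7, LinfrL4 fun x => Real.sqrt ‖x‖ * Zop j (Zmulti a (u i)) (t,x)) ≤
      bigBracket c0 δ u t * jb t ^ (sig δ i + δ) := fun i a ha => by
    have := sum_le_of_mem (sum_le_of_mem hd (fun i => Finset.sum_nonneg fun a _ =>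
      mul_nonneg (hP _) (n4 i a)) (Finset.mem_univ i)) (fun a => mul_nonneg (hP _) (n4 i a)) (m1 ha)
    rw [show -(sig δ i) - δ = -(sig δ i + δ) by ring] at this
    exact le_of_rpow_neg_mul_le hT this
  refine ⟨hu, hs, ht, h0, h1, fun i a ha x => ?_, fun i a ha x => ?_, fun i a ha ρ hρ => ?_,
    fun i a ha ρ hρ => ?_, fun i a l ha ρ hρ => ?_⟩
  · have := sum_le_of_mem (sum_le_of_mem hb (fun i => Finset.sum_nonneg fun a _ =>
      mul_nonneg (hP _) (nI _ _)) (Finset.mem_univ i)) (fun a => mul_nonneg (hP _) (nI _ _)) (m1 ha)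
    rw [show -(sig δ i) - δ = -(sig δ i + δ) by ring] at this
    have h2 := (le_Linf (cN i a) ((continuous_norm).mul (cj (cspeed c0 i)).sqrt) x).trans
      (le_of_rpow_neg_mul_le hT this)
    have h3 := pow_le_pow_left₀ (mul_nonneg (mul_nonneg (norm_nonneg _) (Real.sqrt_nonneg _))
      (pdNorm_nonneg _ _)) h2 2
    rwa [mul_pow, mul_pow, mul_pow, Real.sq_sqrt (jb_pos _).le, pdNorm_sq] at h3
  · rw [Finset.mul_sum] at hg
    have := sum_le_of_mem (sum_le_of_mem hg (fun i => mul_nonneg (hP _) (Finset.sum_nonneg fun a _ =>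
      mul_nonneg (hP _) (nI _ _))) (Finset.mem_univ i) |>.trans' (le_of_eq (Finset.mul_sum _ _ _).symm))
      (fun a => mul_nonneg (hP _) (mul_nonneg (hP _) (nI _ _))) (m1 ha)
    rw [← mul_assoc, ← Real.rpow_add hT, show -δ + -(sig δ i) = -(sig δ i + δ) by ring] at this
    have h2 := (le_Linf (cN i a) (cj (cspeed c0 i)) x).trans (le_of_rpow_neg_mul_le hT this)
    have h3 := pow_le_pow_left₀ (mul_nonneg (jb_pos _).le (pdNorm_nonneg _ _)) h2 2
    rwa [mul_pow, mul_pow, pdNorm_sq] at h3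
  · have := sum_le_of_mem (sum_le_of_mem he (fun i => Finset.sum_nonneg fun a _ =>
      mul_nonneg (hP _) (nL _ _)) (Finset.mem_univ i)) (fun a => mul_nonneg (hP _) (nL _ _)) (m1 ha)
    exact (le_LinfrL4 (cN i a) continuous_norm hρ).trans (le_of_rpow_neg_mul_le hT this)
  · refine ((le_LinfrL4 (cN i a) (csq.mul (cj (cspeed c0 i))) hρ).trans ?_).trans (q4 i a ha)
    exact le_add_of_nonneg_right (Finset.sum_nonneg fun _ _ => LinfrL4_nonneg _)
  · refine ((le_LinfrL4 (cZ i a l) csq hρ).trans ?_).trans (q4 i a ha)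
    exact (Finset.single_le_sum (f := fun j : Fin 7 => LinfrL4 fun x => Real.sqrt ‖x‖ *
      Zop j (Zmulti a (u i)) (t,x)) (fun _ _ => LinfrL4_nonneg _) (Finset.mem_univ l)).trans
      (le_add_of_nonneg_left (nL _ _))

lemma rotQ_pd_le {v : Fn} (p : Pt) :
    ∑ α : Fin 4, rotQ (pd α v) p ≤ gsq v p + ∑ l : Fin 7, ∑ α : Fin 4, Zop l (pd α v) p ^ 2 := by
  have h : ∀ α : Fin 4, rotQ (pd α v) p ≤ pd α v p ^ 2 + ∑ l : Fin 7, Zop l (pd α v) p ^ 2 := by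
    intro α
    have e3 : om 0 1 (pd α v) p = Zop 3 (pd α v) p := rfl
    have e4 : om 1 2 (pd α v) p = Zop 4 (pd α v) p := rfl
    have e5 : om 0 2 (pd α v) p = Zop 5 (pd α v) p := rfl
    simp only [rotQ, e3, e4, e5]
    have hs := Finset.sum_le_sum_of_subset_of_nonneg (f := fun l : Fin 7 => Zop l (pd α v) p ^ 2)
      (Finset.subset_univ {3, 4, 5}) fun _ _ _ => sq_nonneg _
    rw [Finset.sum_insert (by decide), Finset.sum_insert (by decide), Finset.sum_singleton] at hs
    linarith
  refine (Finset.sum_le_sum fun α _ => h α).trans_eq ?_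
  rw [Finset.sum_add_distrib, Finset.sum_comm (s := Finset.univ (α := Fin 7))]
  rfl

lemma rotQ_le_NQ (m : ℕ) : ∃ K, 0 ≤ K ∧ ∀ a, ∑ i, a i ≤ m → ∀ (v : Fn) (t : ℝ), Sm v → SC t v →
    ∑ α : Fin 4, In t (rotQ (pd α (Zmulti a v))) ≤ K * NQ (m + 1) v t := by
  obtain ⟨K, hK, h2⟩ := zop_pd_sq_le
  have key : ∀ a ∈ idxSet 7 m, ∃ C, 0 ≤ C ∧ ∀ (v : Fn) (t : ℝ), Sm v → SC t v →
      ∑ α : Fin 4, In t (rotQ (pd α (Zmulti a v))) ≤ C * NQ (m + 1) v t := by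
    intro a ha
    have ha := mem_idxSet.1 ha
    obtain ⟨L, hL, h3⟩ := exists_unif (Finset.univ (α := Fin 7))
      (P := fun l C => ∀ v t, Sm v → SC t v →
        In t (gsq (Zop l (Zmulti a v))) ≤ C * NQ (m + 1) v t)
      (fun l C C' hC h v t hv hs => (h v t hv hs).trans
        (mul_le_mul_of_nonneg_right hC (NQ_nonneg _ _ _)))
      (fun l _ => gsq_Zop_le m l a ha)
    refine ⟨(1 + K) + K * (7 * L), by positivity, fun v t hv hs => ?_⟩
    have sw : Sm (Zmulti a v) := hv.Zmulti a
    have cw : SC t (Zmulti a v) := hs.Zmulti a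
    have c1 : CS t (gsq (Zmulti a v)) := CS.gsq sw cw
    have c2 : ∀ l : Fin 7, CS t (gsq (Zop l (Zmulti a v))) := fun l => CS.gsq (sw.Zop l) (cw.Zop l)
    have c3 : CS t fun p => ∑ l : Fin 7, gsq (Zop l (Zmulti a v)) p := CS.sum _ fun l _ => c2 l
    have cr : ∀ α, CS t (rotQ (pd α (Zmulti a v))) := fun α => CS.rotQ (sw.pd α) (cw.pd α)
    rw [← In_sum _ fun α _ => cr α]
    have h4 : In t (fun p => ∑ α : Fin 4, rotQ (pd α (Zmulti a v)) p) ≤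
        In t (fun p => (1 + K) * gsq (Zmulti a v) p + K * ∑ l : Fin 7, gsq (Zop l (Zmulti a v)) p) := by
      refine In_mono (CS.sum _ fun α _ => cr α) ((c1.const_mul _).add (c3.const_mul _)) fun x => ?_
      have := h2 _ sw (t, x)
      have := rotQ_pd_le (v := Zmulti a v) (t, x)
      linarith
    rw [In_add (c1.const_mul _) (c3.const_mul _), In_const_mul, In_const_mul,
      In_sum _ fun l _ => c2 l] at h4
    have h5 : In t (gsq (Zmulti a v)) ≤ NQ (m + 1) v t := gsq_le_NQ (ha.trans (Nat.le_succ m)) v t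
    have h6 : ∑ l : Fin 7, In t (gsq (Zop l (Zmulti a v))) ≤ 7 * (L * NQ (m + 1) v t) := by
      refine (Finset.sum_le_sum fun l _ => h3 l (Finset.mem_univ l) v t hv hs).trans_eq ?_
      simp
    calc _ ≤ _ := h4
      _ ≤ (1 + K) * NQ (m + 1) v t + K * (7 * (L * NQ (m + 1) v t)) := by gcongr
      _ = _ := by ring
  obtain ⟨C, hC, h⟩ := exists_unif (idxSet 7 m) (P := fun a C => ∀ (v : Fn) (t : ℝ), Sm v → SC t v →
      ∑ α : Fin 4, In t (rotQ (pd α (Zmulti a v))) ≤ C * NQ (m + 1) v t)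
    (fun l C C' hC h v t hv hs => (h v t hv hs).trans
        (mul_le_mul_of_nonneg_right hC (NQ_nonneg _ _ _))) key
  exact ⟨C, hC, fun a ha => h a (mem_idxSet.2 ha)⟩

lemma sphere_gsq (m : ℕ) : ∃ C, 0 ≤ C ∧ ∀ a, ∑ i, a i ≤ m → ∀ (f v : Fn) (t B : ℝ), Continuous f →
    Sm v → SC t v → (∀ ρ, 0 < ρ → L4sph (fun x => f (t, x)) ρ ≤ B) →
    In t (fun p => f p ^ 2 * gsq (Zmulti a v) p) ≤ C * B ^ 2 * NQ (m + 1) v t := by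
  obtain ⟨C, hC, h1⟩ := sphere_product
  obtain ⟨K, hK, h2⟩ := rotQ_le_NQ m
  refine ⟨C * K, by positivity, fun a ha f v t B hf hv hs hB => ?_⟩
  have sw : Sm (Zmulti a v) := hv.Zmulti a
  have cw : SC t (Zmulti a v) := hs.Zmulti a
  have e : (fun p => f p ^ 2 * gsq (Zmulti a v) p) =
      fun p => ∑ α : Fin 4, f p ^ 2 * pd α (Zmulti a v) p ^ 2 := by
    funext p; simp only [gsq, Finset.mul_sum]
  have c1 : ∀ α : Fin 4, CS t fun p => f p ^ 2 * pd α (Zmulti a v) p ^ 2 := fun α =>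
    ((CS.pd sw cw α).sq).mul_left (hf.pow 2)
  rw [e, In_sum _ fun α _ => c1 α]
  calc _ ≤ ∑ α : Fin 4, C * B ^ 2 * In t (rotQ (pd α (Zmulti a v))) :=
        Finset.sum_le_sum fun α _ => h1 f _ t B hf (sw.pd α) (cw.pd α) hB
    _ = C * B ^ 2 * ∑ α : Fin 4, In t (rotQ (pd α (Zmulti a v))) := by rw [Finset.mul_sum]
    _ ≤ C * B ^ 2 * (K * NQ (m + 1) v t) :=
        mul_le_mul_of_nonneg_left (h2 a ha v t hv hs) (by positivity)
    _ = _ := by ring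

lemma hardy_gsq (c : ℝ) {m : ℕ} {a : Fin 7 → ℕ} (ha : ∑ i, a i ≤ m) {v : Fn} {t : ℝ} (hv : Sm v)
    (hs : SC t v) : In t (fun p => psi c p * th p * gsq (Zmulti a v) p) ≤
      16 * (MQ c m v t + NQ (m + 1) v t) := by
  have sw : Sm (Zmulti a v) := hv.Zmulti a
  have cw : SC t (Zmulti a v) := hs.Zmulti a
  have cp : Continuous (psi c) := (Sm.psi c).continuous
  have ct : Continuous th := Sm.th.continuous
  have e : (fun p => psi c p * th p * gsq (Zmulti a v) p) =
      fun p => ∑ α : Fin 4, psi c p * th p * pd α (Zmulti a v) p ^ 2 := by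
    funext p; simp only [gsq, Finset.mul_sum]
  have c0 : ∀ α : Fin 4, CS t fun p => psi c p * th p * pd α (Zmulti a v) p ^ 2 := fun α =>
    ((CS.pd sw cw α).sq).mul_left (cp.mul ct)
  rw [e, In_sum _ fun α _ => c0 α]
  have c1 : ∀ α : Fin 4, CS t fun p => psi c p * ∑ j : Fin 3, pd j.succ (pd α (Zmulti a v)) p ^ 2 :=
    fun α => (CS.sum _ fun j _ => (CS.pd (sw.pd α) (cw.pd α) _).sq).mul_left cp
  have e1 : ∑ α : Fin 4, In t (fun p => psi c p * ∑ j : Fin 3, pd j.succ (pd α (Zmulti a v)) p ^ 2) =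
      In t (fun p => psi c p * hess (Zmulti a v) p) := by
    rw [← In_sum _ fun α _ => c1 α]
    congr 1
    funext p
    simp only [hess, Finset.mul_sum]
    refine Finset.sum_congr rfl fun α _ => Finset.sum_congr rfl fun j _ => ?_
    rw [pd_comm sw]
  have e2 : ∑ α : Fin 4, In t (fun p => pd α (Zmulti a v) p ^ 2) = In t (gsq (Zmulti a v)) := by
    rw [← In_sum _ fun α _ => (CS.pd sw cw α).sq]
    rfl
  have h1 := Finset.sum_le_sum fun (α : Fin 4) (_ : α ∈ Finset.univ) =>
    hardy c (sw.pd α) (cw.pd α)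
  rw [Finset.sum_add_distrib, ← Finset.mul_sum, ← Finset.mul_sum, e1, e2] at h1
  have h2 := hess_le_MQ ha c v t
  have h3 := gsq_le_NQ (ha.trans (Nat.le_succ m)) v t
  have h4 := MQ_nonneg c m v t
  simp only [Nat.succ_eq_add_one] at h3
  linarith

/-- The bilinear form with coefficients `H`. -/
def bil (H : Fin 4 → Fin 4 → ℝ) (a b : Fin 4 → ℝ) : ℝ :=
  ∑ α : Fin 4, ∑ β : Fin 4, H α β * a α * b β

/-- The squared Frobenius norm of the coefficients. -/
def frob (H : Fin 4 → Fin 4 → ℝ) : ℝ := ∑ α : Fin 4, ∑ β : Fin 4, H α β ^ 2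

lemma frob_nonneg (H : Fin 4 → Fin 4 → ℝ) : 0 ≤ frob H :=
  Finset.sum_nonneg fun _ _ => Finset.sum_nonneg fun _ _ => sq_nonneg _

lemma bil_sq_le (H : Fin 4 → Fin 4 → ℝ) (a b : Fin 4 → ℝ) :
    bil H a b ^ 2 ≤ frob H * ((∑ α, a α ^ 2) * ∑ α, b α ^ 2) := by
  have e : bil H a b = ∑ α, a α * ∑ β, H α β * b β := by
    simp only [bil, Finset.mul_sum]
    exact Finset.sum_congr rfl fun α _ => Finset.sum_congr rfl fun β _ => by ring
  rw [e]
  calc _ ≤ (∑ α, a α ^ 2) * ∑ α, (∑ β, H α β * b β) ^ 2 := Finset.sum_mul_sq_le_sq_mul_sq _ _ _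
    _ ≤ (∑ α, a α ^ 2) * ∑ α, (∑ β, H α β ^ 2) * ∑ β, b β ^ 2 := by
        refine mul_le_mul_of_nonneg_left (Finset.sum_le_sum fun α _ => ?_)
          (Finset.sum_nonneg fun _ _ => sq_nonneg _)
        exact Finset.sum_mul_sq_le_sq_mul_sq _ _ _
    _ = _ := by rw [← Finset.sum_mul, frob]; ring

/-- The covector conormal to the outgoing light cone in the direction `ω`. -/
def nullX (ω : Fin 3 → ℝ) : Fin 4 → ℝ := ![1, -ω 0, -ω 1, -ω 2]

lemma bil_nullX {H : Fin 4 → Fin 4 → ℝ} (hH : IsNull H) {ω : Fin 3 → ℝ}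
    (hω : ω 0 ^ 2 + ω 1 ^ 2 + ω 2 ^ 2 = 1) : bil H (nullX ω) (nullX ω) = 0 := by
  obtain ⟨lam, h⟩ := hH
  have h2 : bil H (nullX ω) (nullX ω) + bil H (nullX ω) (nullX ω) =
      ∑ α : Fin 4, ∑ β : Fin 4, (H α β + H β α) * nullX ω α * nullX ω β := by
    have e : bil H (nullX ω) (nullX ω) =
        ∑ α : Fin 4, ∑ β : Fin 4, H β α * nullX ω α * nullX ω β := by
      rw [bil, Finset.sum_comm]
      exact Finset.sum_congr rfl fun α _ => Finset.sum_congr rfl fun β _ => by ring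
    nth_rw 2 [e]
    rw [bil]
    simp only [← Finset.sum_add_distrib]
    exact Finset.sum_congr rfl fun α _ => Finset.sum_congr rfl fun β _ => by ring
  simp only [h] at h2
  have h3 : ∑ α : Fin 4, ∑ β : Fin 4, lam * (eta α β : ℝ) * nullX ω α * nullX ω β =
      lam * (1 - (ω 0 ^ 2 + ω 1 ^ 2 + ω 2 ^ 2)) := by
    simp [Fin.sum_univ_four, eta, nullX]
    ring
  rw [h3, hω] at h2
  linarith

lemma bil_null_sq_le {H : Fin 4 → Fin 4 → ℝ} (hH : IsNull H) {ω : Fin 3 → ℝ}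
    (hω : ω 0 ^ 2 + ω 1 ^ 2 + ω 2 ^ 2 = 1) (a b : Fin 4 → ℝ) :
    bil H a b ^ 2 ≤ 18 * frob H *
      ((∑ α, a α ^ 2) * (∑ j : Fin 3, (b j.succ + ω j * b 0) ^ 2) +
        (∑ α, b α ^ 2) * ∑ j : Fin 3, (a j.succ + ω j * a 0) ^ 2) := by
  set X := nullX ω with hX
  set Ta : Fin 4 → ℝ := fun α => a α - a 0 * X α with hTa
  set Tb : Fin 4 → ℝ := fun α => b α - b 0 * X α with hTb
  have e : bil H a b = a 0 * bil H X Tb + b 0 * bil H Ta X + bil H Ta Tb + a 0 * b 0 * bil H X X := by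
    simp only [bil, Finset.mul_sum, ← Finset.sum_add_distrib]
    exact Finset.sum_congr rfl fun α _ => Finset.sum_congr rfl fun β _ => by
      simp only [hTa, hTb]; ring
  rw [bil_nullX hH hω, mul_zero, add_zero] at e
  have n2 : ∑ α, X α ^ 2 = 2 := by
    simp [Fin.sum_univ_four, hX, nullX]; linarith
  have nT : ∀ c : Fin 4 → ℝ, ∑ α, (c α - c 0 * X α) ^ 2 =
      ∑ j : Fin 3, (c j.succ + ω j * c 0) ^ 2 := by
    intro c
    simp [Fin.sum_univ_four, Fin.sum_univ_three, hX, nullX]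
    ring
  have nT2 : ∀ c : Fin 4 → ℝ, ∑ j : Fin 3, (c j.succ + ω j * c 0) ^ 2 ≤ 2 * ∑ α, c α ^ 2 := by
    intro c
    have h : ∀ j : Fin 3, (c j.succ + ω j * c 0) ^ 2 ≤ 2 * c j.succ ^ 2 + 2 * (ω j ^ 2 * c 0 ^ 2) := by
      intro j; nlinarith [sq_nonneg (c j.succ - ω j * c 0)]
    refine (Finset.sum_le_sum fun j _ => h j).trans_eq ?_
    rw [Finset.sum_add_distrib, ← Finset.mul_sum, ← Finset.mul_sum, ← Finset.sum_mul,
      Fin.sum_univ_succ (n := 3), Fin.sum_univ_three (fun j => ω j ^ 2), hω]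
    ring
  have b1 := bil_sq_le H X Tb
  have b2 := bil_sq_le H Ta X
  have b3 := bil_sq_le H Ta Tb
  simp only [hTa, hTb, nT, n2] at b1 b2 b3
  set p := ∑ j : Fin 3, (a j.succ + ω j * a 0) ^ 2 with hp
  set q := ∑ j : Fin 3, (b j.succ + ω j * b 0) ^ 2 with hq
  have p0 : 0 ≤ p := Finset.sum_nonneg fun _ _ => sq_nonneg _
  have q0 : 0 ≤ q := Finset.sum_nonneg fun _ _ => sq_nonneg _
  have a0 : a 0 ^ 2 ≤ ∑ α, a α ^ 2 :=
    Finset.single_le_sum (f := fun α => a α ^ 2) (fun _ _ => sq_nonneg _) (Finset.mem_univ 0)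
  have b0 : b 0 ^ 2 ≤ ∑ α, b α ^ 2 :=
    Finset.single_le_sum (f := fun α => b α ^ 2) (fun _ _ => sq_nonneg _) (Finset.mem_univ 0)
  have h0 := frob_nonneg H
  have qb := nT2 b
  have s3 : ∀ x y z : ℝ, (x + y + z) ^ 2 ≤ 3 * (x ^ 2 + y ^ 2 + z ^ 2) := fun x y z => by
    nlinarith [sq_nonneg (x - y), sq_nonneg (x - z), sq_nonneg (y - z)]
  rw [e]
  have A0 : 0 ≤ ∑ α, a α ^ 2 := (sq_nonneg _).trans a0
  have B0 : 0 ≤ ∑ α, b α ^ 2 := (sq_nonneg _).trans b0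
  have c1 : (a 0 * bil H X Tb) ^ 2 ≤ (∑ α, a α ^ 2) * (frob H * (2 * q)) := by
    rw [mul_pow]; exact mul_le_mul a0 b1 (sq_nonneg _) A0
  have c2 : (b 0 * bil H Ta X) ^ 2 ≤ (∑ α, b α ^ 2) * (frob H * (p * 2)) := by
    rw [mul_pow]; exact mul_le_mul b0 b2 (sq_nonneg _) B0
  have c3 : bil H Ta Tb ^ 2 ≤ frob H * (p * (2 * ∑ α, b α ^ 2)) :=
    b3.trans (mul_le_mul_of_nonneg_left (mul_le_mul_of_nonneg_left qb p0) h0)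
  have d1 : 0 ≤ (∑ α, a α ^ 2) * (frob H * q) := mul_nonneg A0 (mul_nonneg h0 q0)
  have d2 : 0 ≤ (∑ α, b α ^ 2) * (frob H * p) := mul_nonneg B0 (mul_nonneg h0 p0)
  calc _ ≤ _ := s3 _ _ _
    _ ≤ 3 * ((∑ α, a α ^ 2) * (frob H * (2 * q)) + (∑ α, b α ^ 2) * (frob H * (p * 2)) +
        frob H * (p * (2 * ∑ α, b α ^ 2))) := by linarith
    _ ≤ _ := by linarith

/-- The good derivatives in terms of the scaling, the rotations and the gradient. -/
lemma good_deriv_sq_le {κ r t : ℝ} (hκ : 0 < κ) (hr : 0 < r) (ht : 0 < t) (hrt : κ * t ≤ r)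
    {ω : Fin 3 → ℝ} (hω : ω 0 ^ 2 + ω 1 ^ 2 + ω 2 ^ 2 = 1) (b : Fin 4 → ℝ) :
    t ^ 2 * ∑ j : Fin 3, (b j.succ + ω j * b 0) ^ 2 ≤
      9 * (1 + (κ ^ 2)⁻¹) * ((t * b 0 + r * ω 0 * b 1 + r * ω 1 * b 2 + r * ω 2 * b 3) ^ 2 +
        (r * ω 0 * b 2 - r * ω 1 * b 1) ^ 2 + (r * ω 1 * b 3 - r * ω 2 * b 2) ^ 2 +
        (r * ω 0 * b 3 - r * ω 2 * b 1) ^ 2) + 9 * ((t - r) ^ 2 * ∑ α, b α ^ 2) := by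
  have s3 : ∀ x y z : ℝ, (x + y + z) ^ 2 ≤ 3 * (x ^ 2 + y ^ 2 + z ^ 2) := fun x y z => by
    nlinarith [sq_nonneg (x - y), sq_nonneg (x - z), sq_nonneg (y - z)]
  set S := t * b 0 + r * ω 0 * b 1 + r * ω 1 * b 2 + r * ω 2 * b 3 with hS
  set R := ω 0 * b 1 + ω 1 * b 2 + ω 2 * b 3 with hR
  have hQ : (t / r) ^ 2 ≤ (κ ^ 2)⁻¹ := by
    rw [← inv_pow]
    refine pow_le_pow_left₀ (by positivity) ?_ 2
    rw [div_le_iff₀ hr, inv_mul_eq_div, le_div_iff₀ hκ]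
    linarith
  have id : ∀ j : Fin 3, t * (b j.succ + ω j * b 0) = ω j * S + ω j * ((t - r) * R) +
      (t / r) * (r * (ω 0 * (ω 0 * b j.succ - ω j * b 1) + ω 1 * (ω 1 * b j.succ - ω j * b 2) +
        ω 2 * (ω 2 * b j.succ - ω j * b 3))) := by
    intro j
    have hr' : t / r * r = t := div_mul_cancel₀ t hr.ne'
    rw [← mul_assoc (t / r), hr', hS, hR]
    linear_combination (-(t * b j.succ)) * hω
  have hR2 : R ^ 2 ≤ ∑ α, b α ^ 2 := by
    have h := Finset.sum_mul_sq_le_sq_mul_sq Finset.univ ω (fun j : Fin 3 => b j.succ)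
    simp only [Fin.sum_univ_three] at h
    rw [hω, one_mul] at h
    rw [Fin.sum_univ_succ, Fin.sum_univ_three]
    have : R = ω 0 * b (Fin.succ 0) + ω 1 * b (Fin.succ 1) + ω 2 * b (Fin.succ 2) := rfl
    rw [this]
    nlinarith [sq_nonneg (b 0)]
  have hω1 : ∀ j, ω j ^ 2 ≤ 1 := by
    intro j
    fin_cases j <;> simp only [Fin.zero_eta, Fin.mk_one, Fin.reduceFinMk] <;>
      linarith [sq_nonneg (ω 0), sq_nonneg (ω 1), sq_nonneg (ω 2)]
  set P := (r * ω 0 * b 2 - r * ω 1 * b 1) ^ 2 + (r * ω 1 * b 3 - r * ω 2 * b 2) ^ 2 +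
    (r * ω 0 * b 3 - r * ω 2 * b 1) ^ 2 with hP
  have hP0 : 0 ≤ P := by positivity
  have rot : ∀ j : Fin 3, (r * (ω 0 * (ω 0 * b j.succ - ω j * b 1) + ω 1 * (ω 1 * b j.succ - ω j * b 2) +
        ω 2 * (ω 2 * b j.succ - ω j * b 3))) ^ 2 ≤ P := by
    have cs : ∀ x y z : ℝ, (ω 0 * x + ω 1 * y + ω 2 * z) ^ 2 ≤ x ^ 2 + y ^ 2 + z ^ 2 := by
      intro x y z
      have h := Finset.sum_mul_sq_le_sq_mul_sq Finset.univ ω ![x, y, z]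
      simp only [Fin.sum_univ_three] at h
      rw [hω, one_mul] at h
      simpa using h
    intro j
    have h := cs (r * (ω 0 * b j.succ - ω j * b 1)) (r * (ω 1 * b j.succ - ω j * b 2))
      (r * (ω 2 * b j.succ - ω j * b 3))
    have e : r * (ω 0 * (ω 0 * b j.succ - ω j * b 1) + ω 1 * (ω 1 * b j.succ - ω j * b 2) +
        ω 2 * (ω 2 * b j.succ - ω j * b 3)) = ω 0 * (r * (ω 0 * b j.succ - ω j * b 1)) +
        ω 1 * (r * (ω 1 * b j.succ - ω j * b 2)) + ω 2 * (r * (ω 2 * b j.succ - ω j * b 3)) := by ring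
    rw [e]
    refine h.trans ?_
    have q1 := sq_nonneg (r * ω 0 * b 2 - r * ω 1 * b 1)
    have q2 := sq_nonneg (r * ω 1 * b 3 - r * ω 2 * b 2)
    have q3 := sq_nonneg (r * ω 0 * b 3 - r * ω 2 * b 1)
    have f1 : (Fin.succ (0 : Fin 3)) = 1 := rfl
    have f2 : (Fin.succ (1 : Fin 3)) = 2 := rfl
    have f3 : (Fin.succ (2 : Fin 3)) = 3 := rfl
    fin_cases j <;> simp only [Fin.zero_eta, Fin.mk_one, Fin.reduceFinMk, f1, f2, f3, hP] <;>
      linarith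
  have each : ∀ j : Fin 3, t ^ 2 * (b j.succ + ω j * b 0) ^ 2 ≤
      3 * (S ^ 2 + (t - r) ^ 2 * (∑ α, b α ^ 2) + (κ ^ 2)⁻¹ * P) := by
    intro j
    rw [← mul_pow, id j]
    refine (s3 _ _ _).trans ?_
    have k1 : (ω j * S) ^ 2 ≤ S ^ 2 := by
      rw [mul_pow]; exact mul_le_of_le_one_left (sq_nonneg _) (hω1 j)
    have k2 : (ω j * ((t - r) * R)) ^ 2 ≤ (t - r) ^ 2 * ∑ α, b α ^ 2 := by
      rw [mul_pow, mul_pow]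
      exact (mul_le_of_le_one_left (by positivity) (hω1 j)).trans
        (mul_le_mul_of_nonneg_left hR2 (sq_nonneg _))
    have k3 := mul_le_mul hQ (rot j) (sq_nonneg _) (by positivity)
    rw [← mul_pow] at k3
    linarith
  have hi : 0 ≤ (κ ^ 2)⁻¹ := by positivity
  have hsum := Finset.sum_le_sum fun (j : Fin 3) (_ : j ∈ Finset.univ) => each j
  rw [← Finset.mul_sum] at hsum
  simp only [Finset.sum_const, Finset.card_univ, Fintype.card_fin, nsmul_eq_mul] at hsum
  have m1 : 0 ≤ (κ ^ 2)⁻¹ * S ^ 2 := by positivity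
  have e : S ^ 2 + (r * ω 0 * b 2 - r * ω 1 * b 1) ^ 2 + (r * ω 1 * b 3 - r * ω 2 * b 2) ^ 2 +
    (r * ω 0 * b 3 - r * ω 2 * b 1) ^ 2 = S ^ 2 + P := by rw [hP]; ring
  rw [e]
  push_cast at hsum
  linarith

lemma le_jb_interior {κ c t r : ℝ} (hκ : 0 < κ) (hc : 2 * κ ≤ c) (ht : 0 < t) (hr : r ≤ κ * t) :
    min 1 κ * jb t ≤ jb (c * t - r) := by
  have hμ : 0 < min 1 κ := lt_min one_pos hκ
  refine (pow_le_pow_iff_left₀ (mul_nonneg hμ.le (jb_pos t).le) (jb_pos _).le two_ne_zero).1 ?_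
  rw [mul_pow, jb_sq, jb_sq]
  have h1 : min 1 κ * t ≤ c * t - r := by
    have := mul_le_mul_of_nonneg_right (min_le_right 1 κ) ht.le
    nlinarith
  have h2 := pow_le_pow_left₀ (mul_nonneg hμ.le ht.le) h1 2
  have h3 : min 1 κ ^ 2 ≤ 1 := pow_le_one₀ hμ.le (min_le_left _ _)
  nlinarith

lemma sq_le_sq_jb (t : ℝ) : t ^ 2 ≤ jb t ^ 2 := by rw [jb_sq]; linarith

lemma weight_interior {κ c c' t r : ℝ} (hκ : 0 < κ) (hc : 2 * κ ≤ c) (hc' : 2 * κ ≤ c') (ht : 0 < t)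
    (hr : r ≤ κ * t) :
    t ^ 2 ≤ (min 1 κ ^ 3)⁻¹ * ((jb t)⁻¹ * (jb (c * t - r) * jb (c' * t - r) ^ 2)) := by
  have hμ : 0 < min 1 κ := lt_min one_pos hκ
  have hT := jb_pos t
  have h1 := le_jb_interior hκ hc ht hr
  have h2 := pow_le_pow_left₀ (mul_nonneg hμ.le hT.le) (le_jb_interior hκ hc' ht hr) 2
  have h3 := mul_le_mul h1 h2 (sq_nonneg _) (jb_pos _).le
  refine (sq_le_sq_jb t).trans ?_
  rw [inv_mul_eq_div, le_div_iff₀ (by positivity), inv_mul_eq_div, le_div_iff₀ hT]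
  linarith

lemma weight_decay {κ c t r : ℝ} (hκ : 0 < κ) (hc : 2 * κ ≤ c) (ht : 0 < t) :
    jb t ^ 2 ≤ ((min 1 κ ^ 2)⁻¹ + 2 + 2 * (κ ^ 2)⁻¹) *
      (r ^ 2 * jb (c * t - r) + jb (c * t - r) ^ 2) := by
  have hμ : 0 < min 1 κ := lt_min one_pos hκ
  have hD := one_le_jb (c * t - r)
  have hD2 : 1 ≤ jb (c * t - r) ^ 2 := one_le_pow₀ hD
  have i1 : 0 ≤ (min 1 κ ^ 2)⁻¹ := by positivity
  have i2 : 0 ≤ (κ ^ 2)⁻¹ := by positivity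
  have hrD : r ^ 2 ≤ r ^ 2 * jb (c * t - r) := le_mul_of_one_le_right (sq_nonneg _) hD
  have hr0 : 0 ≤ r ^ 2 * jb (c * t - r) := (sq_nonneg r).trans hrD
  have hS : 0 ≤ r ^ 2 * jb (c * t - r) + jb (c * t - r) ^ 2 := by linarith
  rcases le_total r (κ * t) with hr | hr
  · have h1 := pow_le_pow_left₀ (mul_nonneg hμ.le (jb_pos t).le) (le_jb_interior hκ hc ht hr) 2
    rw [mul_pow] at h1
    have h2 : jb t ^ 2 ≤ (min 1 κ ^ 2)⁻¹ * jb (c * t - r) ^ 2 := by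
      rw [inv_mul_eq_div, le_div_iff₀ (by positivity)]; linarith
    have h3 : (min 1 κ ^ 2)⁻¹ * jb (c * t - r) ^ 2 ≤
        (min 1 κ ^ 2)⁻¹ * (r ^ 2 * jb (c * t - r) + jb (c * t - r) ^ 2) :=
      mul_le_mul_of_nonneg_left (by linarith) i1
    have h4 : 0 ≤ (2 + 2 * (κ ^ 2)⁻¹) * (r ^ 2 * jb (c * t - r) + jb (c * t - r) ^ 2) := by positivity
    linarith
  · rw [jb_sq]
    have h1 : t ^ 2 ≤ (κ ^ 2)⁻¹ * r ^ 2 := by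
      rw [inv_mul_eq_div, le_div_iff₀ (by positivity)]
      nlinarith [pow_le_pow_left₀ (by positivity) hr 2]
    have h2 : (κ ^ 2)⁻¹ * r ^ 2 ≤ (κ ^ 2)⁻¹ * (r ^ 2 * jb (c * t - r) + jb (c * t - r) ^ 2) :=
      mul_le_mul_of_nonneg_left (by linarith) i2
    have h3 : 0 ≤ (min 1 κ ^ 2)⁻¹ * (r ^ 2 * jb (c * t - r) + jb (c * t - r) ^ 2) :=
      mul_nonneg i1 hS
    have h4 : 0 ≤ (κ ^ 2)⁻¹ * (r ^ 2 * jb (c * t - r) + jb (c * t - r) ^ 2) := mul_nonneg i2 hS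
    linarith

/-- The squared norm of all the vector fields applied to a function. -/
def zsq (v : Fn) : Fn := fun p => ∑ l : Fin 7, Zop l v p ^ 2

lemma zsq_nonneg (v : Fn) (p : Pt) : 0 ≤ zsq v p := Finset.sum_nonneg fun _ _ => sq_nonneg _

/-- The weight `⟨c t - r⟩` as a function on space-time. -/
def cw (c : ℝ) : Fn := fun p => jb (c * p.1 - ‖p.2‖)

lemma cw_continuous (c : ℝ) : Continuous (cw c) := jb_continuous.comp (by fun_prop)

lemma cw_pos (c : ℝ) (p : Pt) : 0 < cw c p := jb_pos _

lemma nullQ_sq_le (H : Fin 4 → Fin 4 → ℝ) (v w : Fn) (p : Pt) :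
    nullQ H v w p ^ 2 ≤ frob H * (gsq v p * gsq w p) :=
  bil_sq_le H (fun α => pd α v p) fun α => pd α w p

lemma good_deriv_le {v : Fn} {t : ℝ} {x : Sp} (ht : 0 < t) (hx : t / 2 ≤ ‖x‖) :
    t ^ 2 * ∑ j : Fin 3, (pd j.succ v (t, x) + x j / ‖x‖ * pd 0 v (t, x)) ^ 2 ≤
      45 * (zsq v (t, x) + cw 1 (t, x) ^ 2 * gsq v (t, x)) := by
  have hr : 0 < ‖x‖ := lt_of_lt_of_le (by linarith) hx
  have hω : (x 0 / ‖x‖) ^ 2 + (x 1 / ‖x‖) ^ 2 + (x 2 / ‖x‖) ^ 2 = 1 := by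
    have h := norm_sq_sp x
    rw [Fin.sum_univ_three] at h
    rw [div_pow, div_pow, div_pow, ← add_div, ← add_div, ← h, div_self (by positivity)]
  have h := good_deriv_sq_le (κ := 1 / 2) (by norm_num) hr ht (by linarith)
    (ω := fun j => x j / ‖x‖) hω (fun α => pd α v (t, x))
  have hx' : ∀ j, ‖x‖ * (x j / ‖x‖) = x j := fun j => mul_div_cancel₀ _ hr.ne'
  simp only [hx'] at h
  have e6 : Zop 6 v (t, x) = t * pd 0 v (t, x) + x 0 * pd 1 v (t, x) + x 1 * pd 2 v (t, x) +
      x 2 * pd 3 v (t, x) := by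
    rw [Zop_six, Fin.sum_univ_three]
    simp only [show (Fin.succ (0 : Fin 3)) = 1 from rfl, show (Fin.succ (1 : Fin 3)) = 2 from rfl,
      show (Fin.succ (2 : Fin 3)) = 3 from rfl]
    ring
  have e3 : Zop 3 v (t, x) = x 0 * pd 2 v (t, x) - x 1 * pd 1 v (t, x) := rfl
  have e4 : Zop 4 v (t, x) = x 1 * pd 3 v (t, x) - x 2 * pd 2 v (t, x) := rfl
  have e5 : Zop 5 v (t, x) = x 0 * pd 3 v (t, x) - x 2 * pd 1 v (t, x) := rfl
  rw [← e3, ← e4, ← e5, ← e6] at h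
  have hz : Zop 6 v (t, x) ^ 2 + Zop 3 v (t, x) ^ 2 + Zop 4 v (t, x) ^ 2 + Zop 5 v (t, x) ^ 2 ≤
      zsq v (t, x) := by
    have hs := Finset.sum_le_sum_of_subset_of_nonneg (f := fun l : Fin 7 => Zop l v (t, x) ^ 2)
      (Finset.subset_univ {6, 3, 4, 5}) fun _ _ _ => sq_nonneg _
    rw [Finset.sum_insert (by decide), Finset.sum_insert (by decide), Finset.sum_insert (by decide),
      Finset.sum_singleton] at hs
    unfold zsq
    linarith
  have hD : (t - ‖x‖) ^ 2 * gsq v (t, x) ≤ cw 1 (t, x) ^ 2 * gsq v (t, x) := by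
    refine mul_le_mul_of_nonneg_right ?_ (gsq_nonneg _ _)
    simpa [cw] using sq_le_sq_jb (1 * t - ‖x‖)
  have h' : (t - ‖x‖) ^ 2 * ∑ α, pd α v (t, x) ^ 2 ≤ cw 1 (t, x) ^ 2 * gsq v (t, x) := hD
  have h0 : 0 ≤ cw 1 (t, x) ^ 2 * gsq v (t, x) := mul_nonneg (sq_nonneg _) (gsq_nonneg _ _)
  norm_num at h
  linarith

lemma null_pointwise {H : Fin 4 → Fin 4 → ℝ} (hH : IsNull H) : ∃ K, 0 ≤ K ∧
    ∀ (v w : Fn) (t : ℝ) (x : Sp), 1 ≤ t → t ^ 2 * nullQ H v w (t, x) ^ 2 ≤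
      K * ((jb t)⁻¹ * (cw 1 (t, x) * psi 1 (t, x) * (gsq v (t, x) * gsq w (t, x))) +
        (jb t)⁻¹ * (‖x‖ * (zsq v (t, x) + cw 1 (t, x) ^ 2 * gsq v (t, x)) * gsq w (t, x) +
          ‖x‖ * (zsq w (t, x) + cw 1 (t, x) ^ 2 * gsq w (t, x)) * gsq v (t, x))) := by
  have hF := frob_nonneg H
  refine ⟨24 * frob H + 3240 * frob H, by positivity, fun v w t x ht => ?_⟩
  have hT := jb_pos t
  have ht0 : 0 < t := by linarith
  have gv := gsq_nonneg v (t, x)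
  have gw := gsq_nonneg w (t, x)
  have zv := zsq_nonneg v (t, x)
  have zw := zsq_nonneg w (t, x)
  have hc := cw_pos 1 (t, x)
  have hp := psi_pos 1 (t, x)
  set I := (jb t)⁻¹ * (cw 1 (t, x) * psi 1 (t, x) * (gsq v (t, x) * gsq w (t, x))) with hI
  set E := ‖x‖ * (zsq v (t, x) + cw 1 (t, x) ^ 2 * gsq v (t, x)) * gsq w (t, x) +
          ‖x‖ * (zsq w (t, x) + cw 1 (t, x) ^ 2 * gsq w (t, x)) * gsq v (t, x) with hE
  have I0 : 0 ≤ I := by positivity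
  have E0 : 0 ≤ (jb t)⁻¹ * E := by positivity
  rcases le_total ‖x‖ (1 / 2 * t) with hr | hr
  · have h1 := weight_interior (κ := 1 / 2) (c := 1) (c' := 1) (by norm_num) (by norm_num)
      (by norm_num) ht0 hr
    have h2 : jb (1 * t - ‖x‖) ^ 2 ≤ 3 * psi 1 (t, x) := le_psi 1 (t, x)
    have e : ((min 1 (1 / 2) : ℝ) ^ 3)⁻¹ = 8 := by norm_num
    rw [e] at h1
    have hN := nullQ_sq_le H v w (t, x)
    have h3 : t ^ 2 ≤ 24 * ((jb t)⁻¹ * (cw 1 (t, x) * psi 1 (t, x))) := by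
      refine h1.trans ?_
      have : (jb t)⁻¹ * (jb (1 * t - ‖x‖) * jb (1 * t - ‖x‖) ^ 2) ≤
          (jb t)⁻¹ * (jb (1 * t - ‖x‖) * (3 * psi 1 (t, x))) := by
        gcongr
      have e2 : jb (1 * t - ‖x‖) = cw 1 (t, x) := rfl
      rw [e2] at this ⊢
      linarith
    have h4 := mul_le_mul h3 hN (sq_nonneg _) (by positivity)
    have e3 : 24 * ((jb t)⁻¹ * (cw 1 (t, x) * psi 1 (t, x))) * (frob H * (gsq v (t, x) * gsq w (t, x)))
        = 24 * frob H * I := by rw [hI]; ring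
    rw [e3] at h4
    have h5 : 0 ≤ 24 * frob H * ((jb t)⁻¹ * E) + 3240 * frob H * (I + (jb t)⁻¹ * E) := by positivity
    linarith
  · have hr' : t / 2 ≤ ‖x‖ := by linarith
    have hx0 : 0 < ‖x‖ := by linarith
    have hω : (x 0 / ‖x‖) ^ 2 + (x 1 / ‖x‖) ^ 2 + (x 2 / ‖x‖) ^ 2 = 1 := by
      have h := norm_sq_sp x
      rw [Fin.sum_univ_three] at h
      rw [div_pow, div_pow, div_pow, ← add_div, ← add_div, ← h, div_self (by positivity)]
    have h1 : nullQ H v w (t, x) ^ 2 ≤ _ := bil_null_sq_le hH (ω := fun j => x j / ‖x‖) hω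
      (fun α => pd α v (t, x)) (fun α => pd α w (t, x))
    have hTv := good_deriv_le (v := v) ht0 hr'
    have hTw := good_deriv_le (v := w) ht0 hr'
    set P := ∑ j : Fin 3, (pd j.succ v (t, x) + x j / ‖x‖ * pd 0 v (t, x)) ^ 2 with hP
    set Q := ∑ j : Fin 3, (pd j.succ w (t, x) + x j / ‖x‖ * pd 0 w (t, x)) ^ 2 with hQ
    have h2 : nullQ H v w (t, x) ^ 2 ≤ 18 * frob H * (gsq v (t, x) * Q + gsq w (t, x) * P) := h1
    have h3 := mul_le_mul_of_nonneg_left hTv gw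
    have h4 := mul_le_mul_of_nonneg_left hTw gv
    have hTr : 1 ≤ 4 * ((jb t)⁻¹ * ‖x‖) := by
      have : jb t ≤ 2 * t := by
        refine (pow_le_pow_iff_left₀ hT.le (by positivity) two_ne_zero).1 ?_
        rw [jb_sq]; nlinarith
      rw [← mul_assoc, mul_comm (4 : ℝ), mul_assoc, inv_mul_eq_div, le_div_iff₀ hT]
      linarith
    set Y := gsq v (t, x) * (zsq w (t, x) + cw 1 (t, x) ^ 2 * gsq w (t, x)) +
      gsq w (t, x) * (zsq v (t, x) + cw 1 (t, x) ^ 2 * gsq v (t, x)) with hY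
    have Y0 : 0 ≤ Y := by positivity
    have h5 : t ^ 2 * nullQ H v w (t, x) ^ 2 ≤ 810 * frob H * Y := by
      calc _ ≤ t ^ 2 * (18 * frob H * (gsq v (t, x) * Q + gsq w (t, x) * P)) :=
            mul_le_mul_of_nonneg_left h2 (sq_nonneg _)
        _ = 18 * frob H * (gsq v (t, x) * (t ^ 2 * Q) + gsq w (t, x) * (t ^ 2 * P)) := by ring
        _ ≤ 18 * frob H * (gsq v (t, x) * (45 * (zsq w (t, x) + cw 1 (t, x) ^ 2 * gsq w (t, x))) +
            gsq w (t, x) * (45 * (zsq v (t, x) + cw 1 (t, x) ^ 2 * gsq v (t, x)))) :=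
            mul_le_mul_of_nonneg_left (by linarith) (by positivity)
        _ = _ := by rw [hY]; ring
    have h6 : Y ≤ 4 * ((jb t)⁻¹ * E) := by
      have := mul_le_mul_of_nonneg_right hTr Y0
      rw [one_mul] at this
      refine this.trans_eq ?_
      rw [hY, hE]; ring
    have h7 := mul_le_mul_of_nonneg_left h6 (by positivity : 0 ≤ 810 * frob H)
    have h8 : 0 ≤ 24 * frob H * (I + (jb t)⁻¹ * E) + 3240 * frob H * I := by positivity
    linarith

/-- The combined weighted square of the norms of all three components. -/
def XY (c0 δ : ℝ) (m : ℕ) (u : Fin 3 → Fn) (t : ℝ) : ℝ :=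
  ∑ k : Fin 3, (jb t ^ (-(sig δ k))) ^ 2 * (MQ (cspeed c0 k) m (u k) t + NQ (m + 1) (u k) t)

lemma XY_nonneg (c0 δ : ℝ) (m : ℕ) (u : Fin 3 → Fn) (t : ℝ) : 0 ≤ XY c0 δ m u t :=
  Finset.sum_nonneg fun _ _ =>
    mul_nonneg (sq_nonneg _) (add_nonneg (MQ_nonneg _ _ _ _) (NQ_nonneg _ _ _))

lemma le_XY (c0 δ : ℝ) (m : ℕ) (u : Fin 3 → Fn) (t : ℝ) (k : Fin 3) :
    MQ (cspeed c0 k) m (u k) t + NQ (m + 1) (u k) t ≤ (jb t ^ sig δ k) ^ 2 * XY c0 δ m u t := by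
  have hT := jb_pos t
  have h : (jb t ^ (-(sig δ k))) ^ 2 * (MQ (cspeed c0 k) m (u k) t + NQ (m + 1) (u k) t) ≤
      XY c0 δ m u t := by
    refine Finset.single_le_sum (f := fun k : Fin 3 => (jb t ^ (-(sig δ k))) ^ 2 *
      (MQ (cspeed c0 k) m (u k) t + NQ (m + 1) (u k) t)) (fun _ _ => ?_) (Finset.mem_univ k)
    exact mul_nonneg (sq_nonneg _) (add_nonneg (MQ_nonneg _ _ _ _) (NQ_nonneg _ _ _))
  rw [Real.rpow_neg hT.le, inv_pow] at h
  exact (inv_mul_le_iff₀ (by positivity)).1 h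

lemma NQ_le_XY (c0 δ : ℝ) (m : ℕ) (u : Fin 3 → Fn) (t : ℝ) (k : Fin 3) :
    NQ (m + 1) (u k) t ≤ (jb t ^ sig δ k) ^ 2 * XY c0 δ m u t := by
  have := le_XY c0 δ m u t k
  have := MQ_nonneg (cspeed c0 k) m (u k) t
  linarith

lemma one_le_tau {δ : ℝ} (hδ : 0 < δ) (t : ℝ) (k : Fin 3) : 1 ≤ jb t ^ sig δ k := by
  refine Real.one_le_rpow (one_le_jb t) ?_
  fin_cases k <;> simp [sig, hδ.le]

lemma tau_le {δ : ℝ} (hδ : 0 < δ) (t : ℝ) (k : Fin 3) : jb t ^ sig δ k ≤ jb t ^ δ := by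
  refine Real.rpow_le_rpow_of_exponent_le (one_le_jb t) ?_
  fin_cases k <;> simp [sig, hδ.le]

lemma tau_add (δ t : ℝ) (k : Fin 3) : jb t ^ (sig δ k + δ) = jb t ^ sig δ k * jb t ^ δ :=
  Real.rpow_add (jb_pos t) _ _

lemma delta_pow_six {δ : ℝ} (hδ' : δ < 1 / 24) (t : ℝ) : (jb t ^ δ) ^ 6 ≤ jb t := by
  rw [← Real.rpow_natCast, ← Real.rpow_mul (jb_pos t).le]
  refine (Real.rpow_le_rpow_of_exponent_le (one_le_jb t) (y := δ * (6 : ℕ)) (z := 1) ?_).trans_eq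
    (Real.rpow_one _)
  push_cast
  linarith

lemma tau_six {δ : ℝ} (hδ : 0 < δ) (hδ' : δ < 1 / 24) (t : ℝ) (j k : Fin 3) :
    (jb t)⁻¹ * (jb t ^ sig δ j * jb t ^ δ * jb t ^ sig δ k) ^ 2 ≤ 1 := by
  have hT := jb_pos t
  have h1 := tau_le hδ t j
  have h2 := tau_le hδ t k
  have p1 := one_le_tau hδ t j
  have p2 := one_le_tau hδ t k
  rw [inv_mul_le_iff₀ hT, mul_one]
  refine le_trans ?_ (delta_pow_six hδ' t)
  calc (jb t ^ sig δ j * jb t ^ δ * jb t ^ sig δ k) ^ 2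
      ≤ (jb t ^ δ * jb t ^ δ * jb t ^ δ) ^ 2 := by gcongr
    _ = (jb t ^ δ) ^ 6 := by ring

lemma CS.gsq_mul {t : ℝ} {v w : Fn} (hv : Sm v) (hw : Sm w) (hs : SC t w) :
    CS t fun p => MultiSpeedWave.gsq v p * MultiSpeedWave.gsq w p := by
  have h : Continuous (MultiSpeedWave.gsq v) := continuous_finsetSum _ fun α _ => (hv.pdc α).pow 2
  exact (CS.gsq hw hs).mul_left h

lemma psi_continuous (c : ℝ) : Continuous (psi c) := (Sm.psi c).continuous

lemma Adm.interior {c0 δ : ℝ} (hδ : 0 < δ) (hδ' : δ < 1 / 24) {u : Fin 3 → Fn} {t A : ℝ}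
    (h : Adm c0 δ u t A) {m : ℕ} {b c : Fin 7 → ℕ} (hb : ∑ l, b l ≤ 1) (hc : ∑ l, c l ≤ m)
    (j k : Fin 3) :
    In t (fun p => (jb t)⁻¹ * (cw (cspeed c0 j) p * psi (cspeed c0 k) p *
      (gsq (Zmulti b (u j)) p * gsq (Zmulti c (u k)) p))) ≤ 32 * A ^ 2 * XY c0 δ m u t := by
  have hT := jb_pos t
  have sb := (h.sm j).Zmulti b
  have sc := (h.sm k).Zmulti c
  have cc := (h.sc k).Zmulti c
  set M := 2 * A ^ 2 * (jb t ^ sig δ j * jb t ^ δ) ^ 2 with hM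
  have hM0 : 0 ≤ M := by positivity
  have pt : ∀ x : Sp, (jb t)⁻¹ * (cw (cspeed c0 j) (t, x) * psi (cspeed c0 k) (t, x) *
      (gsq (Zmulti b (u j)) (t, x) * gsq (Zmulti c (u k)) (t, x))) ≤
      ((jb t)⁻¹ * M) * (psi (cspeed c0 k) (t, x) * th (t, x) * gsq (Zmulti c (u k)) (t, x)) := by
    intro x
    have i1 := h.inf1 j b hb x
    have i2 := h.inf2 j b hb x
    rw [tau_add] at i1 i2
    have g0 := gsq_nonneg (Zmulti b (u j)) (t, x)
    have g1 := gsq_nonneg (Zmulti c (u k)) (t, x)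
    have hp := psi_pos (cspeed c0 k) (t, x)
    have hh := th_pos (t, x)
    have ht := th_mul (t, x)
    have hw : jb (cspeed c0 j * t - ‖x‖) * gsq (Zmulti b (u j)) (t, x) ≤
        jb (cspeed c0 j * t - ‖x‖) ^ 2 * gsq (Zmulti b (u j)) (t, x) :=
      mul_le_mul_of_nonneg_right (by nlinarith [one_le_jb (cspeed c0 j * t - ‖x‖)]) g0
    have key : (1 + ‖x‖ ^ 2) * (cw (cspeed c0 j) (t, x) * gsq (Zmulti b (u j)) (t, x)) ≤ M := by
      simp only [cw]
      linarith
    have key2 := mul_le_mul_of_nonneg_left key (show 0 ≤ (jb t)⁻¹ * (psi (cspeed c0 k) (t, x) *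
      th (t, x) * gsq (Zmulti c (u k)) (t, x)) by positivity)
    calc _ = (jb t)⁻¹ * (psi (cspeed c0 k) (t, x) * gsq (Zmulti c (u k)) (t, x)) *
          (th (t, x) * (1 + ‖(t, x).2‖ ^ 2)) * (cw (cspeed c0 j) (t, x) * gsq (Zmulti b (u j)) (t, x)) := by
            rw [ht]; ring
      _ = (jb t)⁻¹ * (psi (cspeed c0 k) (t, x) * th (t, x) * gsq (Zmulti c (u k)) (t, x)) *
          ((1 + ‖x‖ ^ 2) * (cw (cspeed c0 j) (t, x) * gsq (Zmulti b (u j)) (t, x))) := by ring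
      _ ≤ _ := by linarith
  have c1 : CS t fun p => (jb t)⁻¹ * (cw (cspeed c0 j) p * psi (cspeed c0 k) p *
      (gsq (Zmulti b (u j)) p * gsq (Zmulti c (u k)) p)) :=
    ((CS.gsq_mul sb sc cc).mul_left ((cw_continuous _).mul (psi_continuous _))).const_mul _
  have c2 : CS t fun p => ((jb t)⁻¹ * M) * (psi (cspeed c0 k) p * th p * gsq (Zmulti c (u k)) p) :=
    ((CS.gsq sc cc).mul_left ((psi_continuous _).mul Sm.th.continuous)).const_mul _
  refine (In_mono c1 c2 pt).trans ?_
  rw [In_const_mul]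
  have h1 := hardy_gsq (cspeed c0 k) hc (h.sm k) (h.sc k)
  have h2 := le_XY c0 δ m u t k
  have h3 := tau_six hδ hδ' t j k
  have hX := XY_nonneg c0 δ m u t
  have h4 : ((jb t)⁻¹ * M) * In t (fun p => psi (cspeed c0 k) p * th p * gsq (Zmulti c (u k)) p) ≤
      ((jb t)⁻¹ * M) * (16 * ((jb t ^ sig δ k) ^ 2 * XY c0 δ m u t)) :=
    mul_le_mul_of_nonneg_left (h1.trans (by linarith)) (by positivity)
  refine h4.trans ?_
  have h5 := mul_le_mul_of_nonneg_right h3 (show 0 ≤ 32 * A ^ 2 * XY c0 δ m u t by positivity)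
  rw [hM]
  linarith

lemma cspeed_ge (c0 : ℝ) (i : Fin 3) : 2 * (min 1 c0 / 2) ≤ cspeed c0 i := by
  have h1 := min_le_left 1 c0
  have h2 := min_le_right 1 c0
  fin_cases i <;> simp [cspeed] <;> linarith

lemma product_pointwise {c0 : ℝ} (hc0 : 0 < c0) : ∃ K, 0 ≤ K ∧ ∀ (j k : Fin 3) (t : ℝ) (x : Sp), 0 < t →
    t ^ 2 ≤ K * (‖x‖ ^ 2 + (jb t)⁻¹ * (cw (cspeed c0 j) (t, x) * psi (cspeed c0 k) (t, x))) := by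
  have hκ : 0 < min 1 c0 / 2 := by positivity
  set κ := min 1 c0 / 2 with hk
  have hμ : 0 < min 1 κ := lt_min one_pos hκ
  refine ⟨(κ ^ 2)⁻¹ + 3 * (min 1 κ ^ 3)⁻¹, by positivity, fun j k t x ht => ?_⟩
  have hT := jb_pos t
  have hw := cw_pos (cspeed c0 j) (t, x)
  have hp := psi_pos (cspeed c0 k) (t, x)
  have e0 : 0 ≤ (jb t)⁻¹ * (cw (cspeed c0 j) (t, x) * psi (cspeed c0 k) (t, x)) := by positivity
  have i1 : 0 ≤ (κ ^ 2)⁻¹ := by positivity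
  have i2 : 0 ≤ (min 1 κ ^ 3)⁻¹ := by positivity
  have r0 := sq_nonneg ‖x‖
  rcases le_total ‖x‖ (κ * t) with hr | hr
  · have h1 := weight_interior hκ (cspeed_ge c0 j) (cspeed_ge c0 k) ht hr
    have h2 : jb (cspeed c0 k * t - ‖x‖) ^ 2 ≤ 3 * psi (cspeed c0 k) (t, x) := le_psi _ (t, x)
    have h3 : (jb t)⁻¹ * (jb (cspeed c0 j * t - ‖x‖) * jb (cspeed c0 k * t - ‖x‖) ^ 2) ≤
        (jb t)⁻¹ * (cw (cspeed c0 j) (t, x) * (3 * psi (cspeed c0 k) (t, x))) := by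
      refine mul_le_mul_of_nonneg_left ?_ (by positivity)
      exact mul_le_mul_of_nonneg_left h2 (jb_pos _).le
    have h4 := mul_le_mul_of_nonneg_left h3 i2
    have h5 := mul_nonneg i1 r0
    have h6 := mul_nonneg i1 e0
    have h7 := mul_nonneg i2 r0
    linarith
  · have h1 : t ^ 2 ≤ (κ ^ 2)⁻¹ * ‖x‖ ^ 2 := by
      rw [inv_mul_eq_div, le_div_iff₀ (by positivity)]
      nlinarith [pow_le_pow_left₀ (by positivity) hr 2]
    have h5 := mul_nonneg i1 r0
    have h6 := mul_nonneg i1 e0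
    have h7 := mul_nonneg i2 r0
    have h8 := mul_nonneg i2 e0
    linarith

lemma product_est_low {c0 δ : ℝ} (hc0 : 0 < c0) (hδ : 0 < δ) (hδ' : δ < 1 / 24) (m : ℕ) :
    ∃ C, 0 ≤ C ∧ ∀ (b c : Fin 7 → ℕ), ∑ l, b l ≤ 1 → ∑ l, c l ≤ m → ∀ (j k : Fin 3)
      (u : Fin 3 → Fn) (t A : ℝ), Adm c0 δ u t A →
      t ^ 2 * In t (fun p => gsq (Zmulti b (u j)) p * gsq (Zmulti c (u k)) p) ≤
        C * (A ^ 2 * (jb t ^ sig δ j * jb t ^ sig δ k) ^ 2 * XY c0 δ m u t) := by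
  obtain ⟨K, hK, hpt⟩ := product_pointwise hc0
  obtain ⟨L, hL, hsph⟩ := sphere_gsq m
  refine ⟨K * (L + 32), by positivity, fun b c hb hc j k u t A h => ?_⟩
  have hT := jb_pos t
  have sb := (h.sm j).Zmulti b
  have sc := (h.sm k).Zmulti c
  have cc := (h.sc k).Zmulti c
  have hX := XY_nonneg c0 δ m u t
  have hf : Continuous fun p : Pt => ‖p.2‖ * pdNorm (Zmulti b (u j)) p :=
    (by fun_prop : Continuous fun p : Pt => ‖p.2‖).mul sb.pdNorm_continuous
  have h1 := hsph c hc (fun p => ‖p.2‖ * pdNorm (Zmulti b (u j)) p) (u k) t _ hf (h.sm k) (h.sc k)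
    (h.sph1 j b hb)
  have h2 := h.interior hδ hδ' hb hc j k
  have c1 : CS t fun p : Pt => (‖p.2‖ * pdNorm (Zmulti b (u j)) p) ^ 2 * gsq (Zmulti c (u k)) p :=
    (CS.gsq sc cc).mul_left (hf.pow 2)
  have c2 : CS t fun p => (jb t)⁻¹ * (cw (cspeed c0 j) p * psi (cspeed c0 k) p *
      (gsq (Zmulti b (u j)) p * gsq (Zmulti c (u k)) p)) :=
    ((CS.gsq_mul sb sc cc).mul_left ((cw_continuous _).mul (psi_continuous _))).const_mul _
  have c3 := c1.add c2
  have c4 : CS t fun p => t ^ 2 * (gsq (Zmulti b (u j)) p * gsq (Zmulti c (u k)) p) :=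
    (CS.gsq_mul sb sc cc).const_mul _
  have h3 := In_mono c4 (c3.const_mul K) fun x => by
    have q := mul_le_mul_of_nonneg_right (hpt j k t x h.ht)
      (mul_nonneg (gsq_nonneg (Zmulti b (u j)) (t, x)) (gsq_nonneg (Zmulti c (u k)) (t, x)))
    have e := pdNorm_sq (Zmulti b (u j)) (t, x)
    simp only [mul_pow, e]
    linarith
  rw [In_const_mul, In_const_mul, In_add c1 c2] at h3
  refine h3.trans ?_
  rw [mul_assoc K]
  refine mul_le_mul_of_nonneg_left ?_ hK
  have h4 := NQ_le_XY c0 δ m u t k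
  have h5 := mul_le_mul_of_nonneg_left h4 (show 0 ≤ L * (A * jb t ^ sig δ j) ^ 2 by positivity)
  have h6 : 1 ≤ (jb t ^ sig δ j * jb t ^ sig δ k) ^ 2 :=
    one_le_pow₀ (one_le_mul_of_one_le_of_one_le (one_le_tau hδ t j) (one_le_tau hδ t k))
  have h7 := mul_le_mul_of_nonneg_right h6 (show 0 ≤ 32 * A ^ 2 * XY c0 δ m u t by positivity)
  linarith

lemma product_est {c0 δ : ℝ} (hc0 : 0 < c0) (hδ : 0 < δ) (hδ' : δ < 1 / 24) {m : ℕ} (hm : m ≤ 2) :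
    ∃ C, 0 ≤ C ∧ ∀ (b c : Fin 7 → ℕ), ∑ l, b l + ∑ l, c l ≤ m → ∀ (j k : Fin 3)
      (u : Fin 3 → Fn) (t A : ℝ), Adm c0 δ u t A →
      t ^ 2 * In t (fun p => gsq (Zmulti b (u j)) p * gsq (Zmulti c (u k)) p) ≤
        C * (A ^ 2 * (jb t ^ sig δ j * jb t ^ sig δ k) ^ 2 * XY c0 δ m u t) := by
  obtain ⟨C, hC, h⟩ := product_est_low hc0 hδ hδ' m
  refine ⟨C, hC, fun b c hbc j k u t A hA => ?_⟩
  by_cases hb : ∑ l, b l ≤ 1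
  · exact h b c hb (by omega) j k u t A hA
  · have := h c b (by omega) (by omega) k j u t A hA
    rw [mul_comm (jb t ^ sig δ k)] at this
    simpa only [mul_comm (gsq (Zmulti c (u k)) _)] using this

lemma CS.nullQ {t : ℝ} {v w : Fn} (hv : Sm v) (hw : Sm w) (hs : SC t w) (H : Fin 4 → Fin 4 → ℝ) :
    CS t (nullQ H v w) :=
  CS.sum _ fun α _ => CS.sum _ fun β _ =>
    (CS.pd hw hs β).mul_left (continuous_const.mul (hv.pdc α))

lemma form_est {c0 δ : ℝ} (hc0 : 0 < c0) (hδ : 0 < δ) (hδ' : δ < 1 / 24) {m : ℕ} (hm : m ≤ 2)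
    (H : Fin 4 → Fin 4 → ℝ) :
    ∃ C, 0 ≤ C ∧ ∀ (b c : Fin 7 → ℕ), ∑ l, b l + ∑ l, c l ≤ m → ∀ (j k : Fin 3)
      (u : Fin 3 → Fn) (t A : ℝ), Adm c0 δ u t A →
      t ^ 2 * In t (fun p => nullQ H (Zmulti b (u j)) (Zmulti c (u k)) p ^ 2) ≤
        C * (A ^ 2 * (jb t ^ sig δ j * jb t ^ sig δ k) ^ 2 * XY c0 δ m u t) := by
  obtain ⟨C, hC, h⟩ := product_est hc0 hδ hδ' hm
  have hF := frob_nonneg H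
  refine ⟨frob H * C, by positivity, fun b c hbc j k u t A hA => ?_⟩
  have sb := (hA.sm j).Zmulti b
  have sc := (hA.sm k).Zmulti c
  have cc := (hA.sc k).Zmulti c
  have c1 : CS t fun p => nullQ H (Zmulti b (u j)) (Zmulti c (u k)) p ^ 2 :=
    (CS.nullQ sb sc cc H).sq
  have c2 : CS t fun p => frob H * (gsq (Zmulti b (u j)) p * gsq (Zmulti c (u k)) p) :=
    (CS.gsq_mul sb sc cc).const_mul (frob H)
  have h1 := In_mono c1 c2 fun x => nullQ_sq_le H _ _ (t, x)
  rw [In_const_mul] at h1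
  have h2 := mul_le_mul_of_nonneg_left h1 (sq_nonneg t)
  have h3 := mul_le_mul_of_nonneg_left (h b c hbc j k u t A hA) hF
  linarith

lemma CS.zsq {t : ℝ} {v : Fn} (hv : Sm v) (hs : SC t v) : CS t (zsq v) :=
  CS.sum _ fun l _ => CS.sq (CS.of_sm (hv.Zop l) (hs.Zop l))

lemma sqrt_norm_continuous : Continuous fun p : Pt => Real.sqrt ‖p.2‖ := by fun_prop

lemma edge_est {c0 δ : ℝ} (hδ : 0 < δ) (hδ' : δ < 1 / 24) (m : ℕ) :
    ∃ C, 0 ≤ C ∧ ∀ (b c : Fin 7 → ℕ), ∑ l, b l ≤ 2 → ∑ l, c l ≤ m → ∀ (j k : Fin 3)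
      (u : Fin 3 → Fn) (t A : ℝ), Adm c0 δ u t A →
      In t (fun p => (jb t)⁻¹ * (‖p.2‖ * (zsq (Zmulti b (u j)) p +
        cw (cspeed c0 j) p ^ 2 * gsq (Zmulti b (u j)) p) * gsq (Zmulti c (u k)) p)) ≤
        C * (A ^ 2 * XY c0 δ m u t) := by
  obtain ⟨L, hL, hsph⟩ := sphere_gsq m
  refine ⟨8 * L, by positivity, fun b c hb hc j k u t A h => ?_⟩
  have hT := jb_pos t
  have sb := (h.sm j).Zmulti b
  have cb := (h.sc j).Zmulti b
  have sc := (h.sm k).Zmulti c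
  have cc := (h.sc k).Zmulti c
  have hX := XY_nonneg c0 δ m u t
  have f1 : ∀ l : Fin 7, Continuous fun p : Pt => Real.sqrt ‖p.2‖ * Zop l (Zmulti b (u j)) p :=
    fun l => sqrt_norm_continuous.mul (sb.Zop l).continuous
  have f2 : Continuous fun p : Pt =>
      Real.sqrt ‖p.2‖ * jb (cspeed c0 j * p.1 - ‖p.2‖) * pdNorm (Zmulti b (u j)) p :=
    (sqrt_norm_continuous.mul (cw_continuous _)).mul sb.pdNorm_continuous
  have h1 : ∀ l : Fin 7, _ := fun l =>
    hsph c hc _ (u k) t _ (f1 l) (h.sm k) (h.sc k) (h.sph3 j b l hb)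
  have h2 := hsph c hc _ (u k) t _ f2 (h.sm k) (h.sc k) (h.sph2 j b hb)
  have c1 : ∀ l : Fin 7, CS t fun p : Pt =>
      (Real.sqrt ‖p.2‖ * Zop l (Zmulti b (u j)) p) ^ 2 * gsq (Zmulti c (u k)) p :=
    fun l => (CS.gsq sc cc).mul_left ((f1 l).pow 2)
  have c1s : CS t fun p : Pt => ∑ l : Fin 7,
      (Real.sqrt ‖p.2‖ * Zop l (Zmulti b (u j)) p) ^ 2 * gsq (Zmulti c (u k)) p :=
    CS.sum _ fun l _ => c1 l
  have c2 : CS t fun p : Pt => (Real.sqrt ‖p.2‖ * jb (cspeed c0 j * p.1 - ‖p.2‖) *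
      pdNorm (Zmulti b (u j)) p) ^ 2 * gsq (Zmulti c (u k)) p :=
    (CS.gsq sc cc).mul_left (f2.pow 2)
  have e : (fun p : Pt => (jb t)⁻¹ * (‖p.2‖ * (zsq (Zmulti b (u j)) p +
        cw (cspeed c0 j) p ^ 2 * gsq (Zmulti b (u j)) p) * gsq (Zmulti c (u k)) p)) =
      fun p : Pt => (jb t)⁻¹ * ((∑ l : Fin 7,
        (Real.sqrt ‖p.2‖ * Zop l (Zmulti b (u j)) p) ^ 2 * gsq (Zmulti c (u k)) p) +
        (Real.sqrt ‖p.2‖ * jb (cspeed c0 j * p.1 - ‖p.2‖) *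
      pdNorm (Zmulti b (u j)) p) ^ 2 * gsq (Zmulti c (u k)) p) := by
    funext p
    simp only [mul_pow, pdNorm_sq, Real.sq_sqrt (norm_nonneg p.2), zsq, cw]
    rw [← Finset.sum_mul, ← Finset.mul_sum]
    ring
  rw [e, In_const_mul, In_add c1s c2, In_sum _ fun l _ => c1 l]
  have h3 : ∑ l : Fin 7, In t (fun p : Pt =>
      (Real.sqrt ‖p.2‖ * Zop l (Zmulti b (u j)) p) ^ 2 * gsq (Zmulti c (u k)) p) ≤
      7 * (L * (A * jb t ^ (sig δ j + δ)) ^ 2 * NQ (m + 1) (u k) t) := by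
    refine (Finset.sum_le_sum fun l _ => h1 l).trans_eq ?_
    simp
  have h4 := mul_le_mul_of_nonneg_left (NQ_le_XY c0 δ m u t k)
    (show 0 ≤ L * (A * jb t ^ (sig δ j + δ)) ^ 2 by positivity)
  have h5 := mul_le_mul_of_nonneg_right (tau_six hδ hδ' t j k)
    (show 0 ≤ 8 * (L * A ^ 2 * XY c0 δ m u t) by positivity)
  rw [tau_add] at h2 h3 h4
  have h6 : (∑ l : Fin 7, In t (fun p : Pt =>
      (Real.sqrt ‖p.2‖ * Zop l (Zmulti b (u j)) p) ^ 2 * gsq (Zmulti c (u k)) p)) +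
      In t (fun p : Pt => (Real.sqrt ‖p.2‖ * jb (cspeed c0 j * p.1 - ‖p.2‖) *
      pdNorm (Zmulti b (u j)) p) ^ 2 * gsq (Zmulti c (u k)) p) ≤
      8 * (L * (A * (jb t ^ sig δ j * jb t ^ δ)) ^ 2 * ((jb t ^ sig δ k) ^ 2 * XY c0 δ m u t)) := by
    linarith
  have h7 := mul_le_mul_of_nonneg_left h6 (inv_nonneg.2 hT.le)
  linarith

lemma jb_le_two {t : ℝ} (h0 : 0 < t) (h : t ≤ 1) : jb t ≤ 2 := by
  refine (pow_le_pow_iff_left₀ (jb_pos _).le two_pos.le two_ne_zero).1 ?_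
  rw [jb_sq]
  nlinarith

lemma null_est {c0 δ : ℝ} (hc0 : 0 < c0) (hδ : 0 < δ) (hδ' : δ < 1 / 24) {m : ℕ} (hm : m ≤ 2)
    {H : Fin 4 → Fin 4 → ℝ} (hH : IsNull H) :
    ∃ C, 0 ≤ C ∧ ∀ (b c : Fin 7 → ℕ), ∑ l, b l + ∑ l, c l ≤ m → ∀ (j k : Fin 3),
      cspeed c0 j = 1 → cspeed c0 k = 1 → ∀ (u : Fin 3 → Fn) (t A : ℝ), Adm c0 δ u t A →
      t ^ 2 * In t (fun p => nullQ H (Zmulti b (u j)) (Zmulti c (u k)) p ^ 2) ≤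
        C * (A ^ 2 * XY c0 δ m u t) := by
  obtain ⟨C1, hC1, e1⟩ := form_est hc0 hδ hδ' hm H
  obtain ⟨C2, hC2, e2⟩ := edge_est (c0 := c0) hδ hδ' m
  obtain ⟨K, hK, hpt⟩ := null_pointwise hH
  refine ⟨2 * C1 + K * (32 + 2 * C2), by positivity, fun b c hbc j k hj hk u t A h => ?_⟩
  have hT := jb_pos t
  have hX := XY_nonneg c0 δ m u t
  have hAX : 0 ≤ A ^ 2 * XY c0 δ m u t := by positivity
  rcases le_total t 1 with ht | ht
  · have h1 := e1 b c hbc j k u t A h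
    have h2 : (jb t ^ sig δ j * jb t ^ sig δ k) ^ 2 ≤ 2 := by
      have p1 := one_le_tau hδ t j
      have p2 := one_le_tau hδ t k
      have p3 : 1 ≤ jb t ^ δ := Real.one_le_rpow (one_le_jb t) hδ.le
      calc (jb t ^ sig δ j * jb t ^ sig δ k) ^ 2 ≤ (jb t ^ δ * jb t ^ δ) ^ 2 := by
            have := tau_le hδ t j
            have := tau_le hδ t k
            gcongr
        _ = (jb t ^ δ) ^ 4 := by ring
        _ ≤ (jb t ^ δ) ^ 6 := pow_le_pow_right₀ p3 (by norm_num)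
        _ ≤ jb t := delta_pow_six hδ' t
        _ ≤ 2 := jb_le_two h.ht ht
    have h3 := mul_le_mul_of_nonneg_left h2 (show 0 ≤ C1 * (A ^ 2 * XY c0 δ m u t) by positivity)
    have h4 : 0 ≤ K * (32 + 2 * C2) * (A ^ 2 * XY c0 δ m u t) := by positivity
    linarith
  · have sb := (h.sm j).Zmulti b
    have cb := (h.sc j).Zmulti b
    have sc := (h.sm k).Zmulti c
    have cc := (h.sc k).Zmulti c
    have g1 := e2 b c (by omega) (by omega) j k u t A h
    have g2 := e2 c b (by omega) (by omega) k j u t A h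
    have g3 : In t (fun p => (jb t)⁻¹ * (cw 1 p * psi 1 p *
        (gsq (Zmulti b (u j)) p * gsq (Zmulti c (u k)) p))) ≤ 32 * A ^ 2 * XY c0 δ m u t := by
      by_cases hb : ∑ l, b l ≤ 1
      · have := h.interior hδ hδ' hb (show ∑ l, c l ≤ m by omega) j k
        rwa [hj, hk] at this
      · have := h.interior hδ hδ' (show ∑ l, c l ≤ 1 by omega) (show ∑ l, b l ≤ m by omega) k j
        rw [hj, hk] at this
        simpa only [mul_comm (gsq (Zmulti c (u k)) _)] using this
    rw [hj] at g1
    rw [hk] at g2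
    have nc : Continuous fun p : Pt => ‖p.2‖ := by fun_prop
    have q : ∀ {v w : Fn}, Sm v → SC t v → Sm w → CS t fun p : Pt => (jb t)⁻¹ * (‖p.2‖ *
        (zsq v p + cw 1 p ^ 2 * gsq v p) * gsq w p) := by
      intro v w sv cv sw
      have gw : Continuous (gsq w) := continuous_finsetSum _ fun α _ => (sw.pdc α).pow 2
      exact ((((CS.zsq sv cv).add ((CS.gsq sv cv).mul_left
        ((cw_continuous 1).pow 2))).mul_left nc).mul_right gw).const_mul _
    have c1 := q sb cb sc
    have c2 := q sc cc sb
    have c3 : CS t fun p => (jb t)⁻¹ * (cw 1 p * psi 1 p *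
        (gsq (Zmulti b (u j)) p * gsq (Zmulti c (u k)) p)) :=
      ((CS.gsq_mul sb sc cc).mul_left ((cw_continuous _).mul (psi_continuous _))).const_mul _
    have c4 : CS t fun p => t ^ 2 * nullQ H (Zmulti b (u j)) (Zmulti c (u k)) p ^ 2 :=
      (CS.nullQ sb sc cc H).sq.const_mul _
    have h3 := In_mono c4 ((c3.add (c1.add c2)).const_mul K) fun x => by
      have := hpt (Zmulti b (u j)) (Zmulti c (u k)) t x ht
      simp only [mul_add] at this ⊢
      exact this
    rw [In_const_mul, In_const_mul, In_add c3 (c1.add c2), In_add c1 c2] at h3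
    refine h3.trans ?_
    have h4 : 0 ≤ 2 * C1 * (A ^ 2 * XY c0 δ m u t) := by positivity
    have h5 := mul_le_mul_of_nonneg_left (add_le_add g3 (add_le_add g1 g2)) hK
    linarith

lemma Adm.decay {c0 δ : ℝ} (hc0 : 0 < c0) : ∃ K, 0 ≤ K ∧ ∀ (b : Fin 7 → ℕ), ∑ l, b l ≤ 1 →
    ∀ (k : Fin 3) (u : Fin 3 → Fn) (t A : ℝ), Adm c0 δ u t A → ∀ x : Sp,
      jb t ^ 2 * gsq (Zmulti b (u k)) (t, x) ≤
        K * (A ^ 2 * (jb t ^ sig δ k * jb t ^ δ) ^ 2) := by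
  have hκ : 0 < min 1 c0 / 2 := by positivity
  set κ := min 1 c0 / 2 with hk
  have hμ : 0 < min 1 κ := lt_min one_pos hκ
  refine ⟨((min 1 κ ^ 2)⁻¹ + 2 + 2 * (κ ^ 2)⁻¹) * 2, by positivity, fun b hb k u t A h x => ?_⟩
  have i1 := h.inf1 k b hb x
  have i2 := h.inf2 k b hb x
  rw [tau_add] at i1 i2
  have h1 := mul_le_mul_of_nonneg_right
    (weight_decay (c := cspeed c0 k) (r := ‖x‖) hκ (cspeed_ge c0 k) h.ht)
    (gsq_nonneg (Zmulti b (u k)) (t, x))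
  have h2 := mul_le_mul_of_nonneg_left (add_le_add i1 i2)
    (show 0 ≤ (min 1 κ ^ 2)⁻¹ + 2 + 2 * (κ ^ 2)⁻¹ by positivity)
  linarith

section Span

variable {X : Type*}

lemma zop_span {S S' : Set (X → Fn)} (hS : ∀ s ∈ S, ∀ x, Sm (s x)) (l : Fin 7)
    (h : ∀ s ∈ S, (fun x => Zop l (s x)) ∈ Submodule.span ℝ S') {f : X → Fn}
    (hf : f ∈ Submodule.span ℝ S) :
    (∀ x, Sm (f x)) ∧ (fun x => Zop l (f x)) ∈ Submodule.span ℝ S' := by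
  induction hf using Submodule.span_induction with
  | mem s hs => exact ⟨hS s hs, h s hs⟩
  | zero =>
    refine ⟨fun x => contDiff_const, ?_⟩
    have e : (fun x : X => Zop l ((0 : X → Fn) x)) = 0 := by
      funext x p; exact Zop_const l 0 p
    rw [e]
    exact Submodule.zero_mem _
  | add f g _ _ hf hg =>
    refine ⟨fun x => (hf.1 x).add (hg.1 x), ?_⟩
    have e : (fun x : X => Zop l ((f + g) x)) = (fun x => Zop l (f x)) + fun x => Zop l (g x) := by
      funext x p; exact Zop_add (hf.1 x) (hg.1 x) l p
    rw [e]
    exact Submodule.add_mem _ hf.2 hg.2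
  | smul r f _ hf =>
    refine ⟨fun x => contDiff_const.mul (hf.1 x), ?_⟩
    have e : (fun x : X => Zop l ((r • f) x)) = r • fun x => Zop l (f x) := by
      funext x p; exact Zop_const_mul (hf.1 x) l r p
    rw [e]
    exact Submodule.smul_mem _ _ hf.2

lemma zmulti_span {S : ℕ → Set (X → Fn)} (hS : ∀ n, ∀ s ∈ S n, ∀ x, Sm (s x))
    (h : ∀ n l, ∀ s ∈ S n, (fun x => Zop l (s x)) ∈ Submodule.span ℝ (S (n + 1))) {f : X → Fn}
    (hf : f ∈ Submodule.span ℝ (S 0)) (n : ℕ) : ∀ a : Fin 7 → ℕ, ∑ i, a i = n →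
    (fun x => Zmulti a (f x)) ∈ Submodule.span ℝ (S n) := by
  induction n with
  | zero =>
    intro a ha
    have : a = 0 := by
      funext i
      exact (Finset.sum_eq_zero_iff.1 ha) i (Finset.mem_univ i)
    subst this
    simpa only [Zmulti_zero] using hf
  | succ n ih =>
    intro a ha
    have hne : a ≠ 0 := by
      rintro rfl
      simp at ha
    obtain ⟨i, b, rfl, hb⟩ := exists_split a hne
    rw [sum_add_single] at ha
    simp only [Zmulti_succ b i hb]
    exact (zop_span (hS n) i (h n i) (ih b (by omega))).2

/-- The functionals `Z^b g` of order at most `n`. -/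
def zset (n : ℕ) (g : X → Fn) : Set (X → Fn) :=
  {f | ∃ b : Fin 7 → ℕ, ∑ i, b i ≤ n ∧ f = fun x => Zmulti b (g x)}

lemma zset_sm {n : ℕ} {g : X → Fn} (hg : ∀ x, Sm (g x)) : ∀ s ∈ zset n g, ∀ x, Sm (s x) := by
  rintro _ ⟨b, _, rfl⟩ x
  exact (hg x).Zmulti b

lemma sum_mem_span {ι : Type*} (s : Finset ι) {S : Set (X → Fn)} {c : ι → ℝ} {f : ι → X → Fn}
    (h : ∀ i ∈ s, f i ∈ Submodule.span ℝ S) :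
    (fun x p => ∑ i ∈ s, c i * f i x p) ∈ Submodule.span ℝ S := by
  have e : (fun x p => ∑ i ∈ s, c i * f i x p) = ∑ i ∈ s, c i • f i := by
    funext x p
    rw [Finset.sum_apply, Finset.sum_apply]
    rfl
  rw [e]
  exact Submodule.sum_mem _ fun i hi => Submodule.smul_mem _ _ (h i hi)

lemma zset_step {g : X → Fn} (hg : ∀ x, Sm (g x)) (n : ℕ) (l : Fin 7) :
    ∀ s ∈ zset n g, (fun x => Zop l (s x)) ∈ Submodule.span ℝ (zset (n + 1) g) := by
  rintro _ ⟨b, hb, rfl⟩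
  obtain ⟨s, hs⟩ := Zop_Zmulti n l b hb
  have e : (fun x => Zop l (Zmulti b (g x))) =
      fun x p => ∑ b ∈ idxSet 7 (n + 1), s b * Zmulti b (g x) p := by
    funext x p; exact hs (g x) (hg x) p
  rw [e]
  exact sum_mem_span _ (f := fun b x => Zmulti b (g x)) fun b hb =>
    Submodule.subset_span ⟨b, mem_idxSet.1 hb, rfl⟩

lemma zset_mono {n n' : ℕ} (h : n ≤ n') (g : X → Fn) : zset n g ⊆ zset n' g := by
  rintro _ ⟨b, hb, rfl⟩
  exact ⟨b, hb.trans h, rfl⟩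

lemma boxOp_zmulti_span {v : X → Fn} (hv : ∀ x, Sm (v x)) (c : ℝ) (n : ℕ) :
    ∀ a : Fin 7 → ℕ, ∑ i, a i = n → (fun x => boxOp c (Zmulti a (v x))) ∈
      Submodule.span ℝ (zset n fun x => boxOp c (v x)) := by
  have hb : ∀ x, Sm (boxOp c (v x)) := fun x => (hv x).boxOp c
  induction n with
  | zero =>
    intro a ha
    have : a = 0 := by
      funext i
      exact (Finset.sum_eq_zero_iff.1 ha) i (Finset.mem_univ i)
    subst this
    exact Submodule.subset_span ⟨0, by simp, by simp only [Zmulti_zero]⟩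
  | succ n ih =>
    intro a ha
    have hne : a ≠ 0 := by
      rintro rfl
      simp at ha
    obtain ⟨i, b, rfl, hord⟩ := exists_split a hne
    rw [sum_add_single] at ha
    simp only [Zmulti_succ b i hord]
    have e : (fun x => boxOp c (Zop i (Zmulti b (v x)))) =
        (fun x => Zop i (boxOp c (Zmulti b (v x)))) +
          (zdef i : ℝ) • fun x => boxOp c (Zmulti b (v x)) := by
      funext x p; exact boxOp_Zop ((hv x).Zmulti b) c i p
    rw [e]
    have h1 := ih b (by omega)
    exact Submodule.add_mem _ (zop_span (zset_sm hb) i (zset_step hb n i) h1).2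
      (Submodule.smul_mem _ _ (Submodule.span_mono (zset_mono n.le_succ _) h1))

/-- The bilinear functionals of order at most `n` with coefficients in a given class. -/
def qset (P : (Fin 4 → Fin 4 → ℝ) → Prop) (v w : X → Fn) (n : ℕ) : Set (X → Fn) :=
  {f | ∃ (H : Fin 4 → Fin 4 → ℝ) (b c : Fin 7 → ℕ), P H ∧ ∑ i, b i + ∑ i, c i ≤ n ∧
    f = fun x => nullQ H (Zmulti b (v x)) (Zmulti c (w x))}

lemma qset_sm {P : (Fin 4 → Fin 4 → ℝ) → Prop} {v w : X → Fn} (hv : ∀ x, Sm (v x))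
    (hw : ∀ x, Sm (w x)) (n : ℕ) : ∀ s ∈ qset P v w n, ∀ x, Sm (s x) := by
  rintro _ ⟨H, b, c, _, _, rfl⟩ x
  exact Sm.nullQ ((hv x).Zmulti b) ((hw x).Zmulti c) H

lemma nullQ_sum_left {ι : Type*} (s : Finset ι) (H : Fin 4 → Fin 4 → ℝ) {v : ι → Fn}
    (hv : ∀ i ∈ s, Sm (v i)) (c : ι → ℝ) (w : Fn) (p : Pt) :
    nullQ H (fun q => ∑ i ∈ s, c i * v i q) w p = ∑ i ∈ s, c i * nullQ H (v i) w p := by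
  have h : ∀ α, pd α (fun q => ∑ i ∈ s, c i * v i q) p = ∑ i ∈ s, c i * pd α (v i) p := by
    intro α
    rw [pd_sum s fun i hi => contDiff_const.mul (hv i hi)]
    exact Finset.sum_congr rfl fun i hi => pd_const_mul (hv i hi) α _ p
  simp only [nullQ, h, Finset.mul_sum, Finset.sum_mul]
  symm
  rw [Finset.sum_comm]
  refine Finset.sum_congr rfl fun α _ => ?_
  rw [Finset.sum_comm]
  exact Finset.sum_congr rfl fun β _ => Finset.sum_congr rfl fun i _ => by ring

lemma nullQ_sum_right {ι : Type*} (s : Finset ι) (H : Fin 4 → Fin 4 → ℝ) {w : ι → Fn}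
    (hw : ∀ i ∈ s, Sm (w i)) (c : ι → ℝ) (v : Fn) (p : Pt) :
    nullQ H v (fun q => ∑ i ∈ s, c i * w i q) p = ∑ i ∈ s, c i * nullQ H v (w i) p := by
  have h : ∀ (H : Fin 4 → Fin 4 → ℝ) (v w : Fn), nullQ H v w p = nullQ (fun α β => H β α) w v p := by
    intro H v w
    simp only [nullQ]
    rw [Finset.sum_comm]
    exact Finset.sum_congr rfl fun α _ => Finset.sum_congr rfl fun β _ => by ring
  rw [h, nullQ_sum_left s _ hw]
  exact Finset.sum_congr rfl fun i _ => by rw [h]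

lemma qset_step {P : (Fin 4 → Fin 4 → ℝ) → Prop} (hP : ∀ H, P H → ∀ l, P (dH l H)) {v w : X → Fn}
    (hv : ∀ x, Sm (v x)) (hw : ∀ x, Sm (w x)) (n : ℕ) (l : Fin 7) :
    ∀ s ∈ qset P v w n, (fun x => Zop l (s x)) ∈ Submodule.span ℝ (qset P v w (n + 1)) := by
  rintro _ ⟨H, b, c, hH, hbc, rfl⟩
  obtain ⟨s, hs⟩ := Zop_Zmulti _ l b le_rfl
  obtain ⟨s', hs'⟩ := Zop_Zmulti _ l c le_rfl
  have e : (fun x => Zop l (nullQ H (Zmulti b (v x)) (Zmulti c (w x)))) =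
      (fun x p => ∑ d ∈ idxSet 7 (∑ i, b i + 1), s d * nullQ H (Zmulti d (v x)) (Zmulti c (w x)) p) +
      (fun x p => ∑ d ∈ idxSet 7 (∑ i, c i + 1), s' d * nullQ H (Zmulti b (v x)) (Zmulti d (w x)) p) +
      fun x => nullQ (dH l H) (Zmulti b (v x)) (Zmulti c (w x)) := by
    funext x p
    rw [Zop_nullQ ((hv x).Zmulti b) ((hw x).Zmulti c)]
    have e1 : Zop l (Zmulti b (v x)) =
        fun p => ∑ d ∈ idxSet 7 (∑ i, b i + 1), s d * Zmulti d (v x) p := funext (hs _ (hv x))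
    have e2 : Zop l (Zmulti c (w x)) =
        fun p => ∑ d ∈ idxSet 7 (∑ i, c i + 1), s' d * Zmulti d (w x) p := funext (hs' _ (hw x))
    rw [e1, e2, nullQ_sum_left _ H fun d _ => (hv x).Zmulti d,
      nullQ_sum_right _ H fun d _ => (hw x).Zmulti d]
    rfl
  rw [e]
  refine Submodule.add_mem _ (Submodule.add_mem _ ?_ ?_) ?_
  · exact sum_mem_span _ (f := fun d x => nullQ H (Zmulti d (v x)) (Zmulti c (w x))) fun d hd =>
      Submodule.subset_span ⟨H, d, c, hH, by have := mem_idxSet.1 hd; omega, rfl⟩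
  · exact sum_mem_span _ (f := fun d x => nullQ H (Zmulti b (v x)) (Zmulti d (w x))) fun d hd =>
      Submodule.subset_span ⟨H, b, d, hH, by have := mem_idxSet.1 hd; omega, rfl⟩
  · exact Submodule.subset_span ⟨dH l H, b, c, hP H hH l, by omega, rfl⟩

/-- A first derivative of `Z^b u_j`, labelled by `((j, α), b)`. -/
def fac (u : X → Fin 3 → Fn) (q : (Fin 3 × Fin 4) × (Fin 7 → ℕ)) : X → Fn :=
  fun x => pd q.1.2 (Zmulti q.2 (u x q.1.1))

/-- Products of at least `k` first derivatives carrying at most `n` generators. -/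
def cset (u : X → Fin 3 → Fn) (k n : ℕ) : Set (X → Fn) :=
  {f | ∃ M : Multiset ((Fin 3 × Fin 4) × (Fin 7 → ℕ)), k ≤ M.card ∧
    (M.map fun q => ∑ i, q.2 i).sum ≤ n ∧ f = (M.map (fac u)).prod}

lemma fac_sm {u : X → Fin 3 → Fn} (hu : ∀ x i, Sm (u x i)) (q : (Fin 3 × Fin 4) × (Fin 7 → ℕ))
    (x : X) : Sm (fac u q x) :=
  ((hu x _).Zmulti _).pd _

lemma prod_fac_sm {u : X → Fin 3 → Fn} (hu : ∀ x i, Sm (u x i))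
    (M : Multiset ((Fin 3 × Fin 4) × (Fin 7 → ℕ))) (x : X) : Sm ((M.map (fac u)).prod x) := by
  induction M using Multiset.induction_on with
  | empty => exact contDiff_const
  | cons q M ih =>
    rw [Multiset.map_cons, Multiset.prod_cons]
    exact (fac_sm hu q x).mul ih

lemma mul_span {S S' : Set (X → Fn)} {g : X → Fn} (h : ∀ s ∈ S, g * s ∈ Submodule.span ℝ S')
    {f : X → Fn} (hf : f ∈ Submodule.span ℝ S) : g * f ∈ Submodule.span ℝ S' := by
  induction hf using Submodule.span_induction with
  | mem s hs => exact h s hs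
  | zero => rw [mul_zero]; exact Submodule.zero_mem _
  | add f g' _ _ hf hg => rw [mul_add]; exact Submodule.add_mem _ hf hg
  | smul r f _ hf => rw [mul_smul_comm]; exact Submodule.smul_mem _ _ hf

lemma fac_step {u : X → Fin 3 → Fn} (hu : ∀ x i, Sm (u x i)) (l : Fin 7)
    (q : (Fin 3 × Fin 4) × (Fin 7 → ℕ)) :
    (fun x => Zop l (fac u q x)) ∈
      Submodule.span ℝ {f | ∃ q', ∑ i, q'.2 i ≤ ∑ i, q.2 i + 1 ∧ f = fac u q'} := by
  obtain ⟨⟨j, β⟩, b⟩ := q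
  obtain ⟨s, hs⟩ := Zop_Zmulti _ l b le_rfl
  have e : (fun x => Zop l (fac u ((j, β), b) x)) =
      (fun x p => ∑ d ∈ idxSet 7 (∑ i, b i + 1), s d * fac u ((j, β), d) x p) +
      fun x p => ∑ α : Fin 4, -(zA l α β : ℝ) * fac u ((j, α), b) x p := by
    funext x p
    have e1 : Zop l (Zmulti b (u x j)) =
        fun p => ∑ d ∈ idxSet 7 (∑ i, b i + 1), s d * Zmulti d (u x j) p := funext (hs _ (hu x j))
    have h1 : Zop l (fac u ((j, β), b) x) p = pd β (Zop l (Zmulti b (u x j))) p -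
        ∑ α : Fin 4, (zA l α β : ℝ) * pd α (Zmulti b (u x j)) p := Zop_pd ((hu x j).Zmulti b) β l p
    rw [h1, e1, pd_sum _ fun d _ => contDiff_const.mul ((hu x j).Zmulti d)]
    simp only [pd_const_mul ((hu x j).Zmulti _)]
    change _ = (∑ d ∈ idxSet 7 (∑ i, b i + 1), s d * pd β (Zmulti d (u x j)) p) +
      ∑ α : Fin 4, -(zA l α β : ℝ) * pd α (Zmulti b (u x j)) p
    simp only [neg_mul, Finset.sum_neg_distrib]
    rfl
  rw [e]
  refine Submodule.add_mem _ ?_ ?_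
  · exact sum_mem_span _ (f := fun d => fac u ((j, β), d)) fun d hd =>
      Submodule.subset_span ⟨((j, β), d), mem_idxSet.1 hd, rfl⟩
  · exact sum_mem_span _ (f := fun α => fac u ((j, α), b)) fun α _ =>
      Submodule.subset_span ⟨((j, α), b), Nat.le_succ _, rfl⟩

lemma cset_step {u : X → Fin 3 → Fn} (hu : ∀ x i, Sm (u x i)) (l : Fin 7)
    (M : Multiset ((Fin 3 × Fin 4) × (Fin 7 → ℕ))) :
    (fun x => Zop l ((M.map (fac u)).prod x)) ∈
      Submodule.span ℝ (cset u M.card ((M.map fun q => ∑ i, q.2 i).sum + 1)) := by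
  induction M using Multiset.induction_on with
  | empty =>
    have e : (fun x => Zop l ((((0 : Multiset ((Fin 3 × Fin 4) × (Fin 7 → ℕ))).map (fac u)).prod :
        X → Fn) x)) = 0 := by
      funext x p; exact Zop_const l 1 p
    rw [e]
    exact Submodule.zero_mem _
  | cons q M ih =>
    simp only [Multiset.map_cons, Multiset.prod_cons, Multiset.sum_cons, Multiset.card_cons]
    have e : (fun x => Zop l ((fac u q * (M.map (fac u)).prod) x)) =
        (M.map (fac u)).prod * (fun x => Zop l (fac u q x)) +
        fac u q * fun x => Zop l ((M.map (fac u)).prod x) := by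
      funext x p
      refine (Zop_mul (fac_sm hu q x) (prod_fac_sm hu M x) l p).trans ?_
      simp only [Pi.add_apply, Pi.mul_apply]
      ring
    rw [e]
    refine Submodule.add_mem _ (mul_span ?_ (fac_step hu l q)) (mul_span ?_ ih)
    · rintro _ ⟨q', hq', rfl⟩
      refine Submodule.subset_span ⟨q' ::ₘ M, by simp, ?_, ?_⟩
      · rw [Multiset.map_cons, Multiset.sum_cons]; omega
      · rw [Multiset.map_cons, Multiset.prod_cons, mul_comm]
    · rintro _ ⟨M', hM', hs, rfl⟩
      refine Submodule.subset_span ⟨q ::ₘ M', by simpa using hM', ?_, ?_⟩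
      · rw [Multiset.map_cons, Multiset.sum_cons]; omega
      · rw [Multiset.map_cons, Multiset.prod_cons]

end Span

/-- Triples of smooth functions. -/
abbrev SU : Type := {u : Fin 3 → Fn // ∀ i, Sm (u i)}

/-- The quadratic and higher estimate required of the terms of the `i`-th equation. -/
def Good (c0 δ : ℝ) (m : ℕ) (i : Fin 3) (f : SU → Fn) : Prop :=
  ∃ C, 0 ≤ C ∧ ∀ (u : SU) (t A : ℝ), Adm c0 δ u.1 t A → CS t (f u) ∧
    t ^ 2 * In t (fun p => f u p ^ 2) ≤ C * (A ^ 2 * (jb t ^ sig δ i) ^ 2 * XY c0 δ m u.1 t)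

lemma Good.span {c0 δ : ℝ} {m : ℕ} {i : Fin 3} {S : Set (SU → Fn)}
    (h : ∀ s ∈ S, Good c0 δ m i s) {f : SU → Fn} (hf : f ∈ Submodule.span ℝ S) :
    Good c0 δ m i f := by
  induction hf using Submodule.span_induction with
  | mem s hs => exact h s hs
  | zero =>
    refine ⟨0, le_rfl, fun u t A hA => ⟨⟨continuous_const, SC.zero t⟩, ?_⟩⟩
    have e : (fun p => (0 : SU → Fn) u p ^ 2) = fun p : Pt => 0 * (0 : ℝ) := by
      funext p; simp
    rw [e, In_const_mul]
    simp
  | add f g _ _ hf hg =>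
    obtain ⟨C, hC, hf⟩ := hf
    obtain ⟨C', hC', hg⟩ := hg
    refine ⟨2 * C + 2 * C', by positivity, fun u t A hA => ?_⟩
    obtain ⟨cf, bf⟩ := hf u t A hA
    obtain ⟨cg, bg⟩ := hg u t A hA
    have c1 : CS t ((f + g) u) := cf.add cg
    refine ⟨c1, ?_⟩
    have c2 : CS t fun p => 2 * f u p ^ 2 := cf.sq.const_mul 2
    have c3 : CS t fun p => 2 * g u p ^ 2 := cg.sq.const_mul 2
    have h1 := In_mono c1.sq (c2.add c3) fun x => by
      have e : (f + g) u (t, x) = f u (t, x) + g u (t, x) := rfl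
      rw [e]
      nlinarith [sq_nonneg (f u (t, x) - g u (t, x))]
    rw [In_add c2 c3, In_const_mul, In_const_mul] at h1
    have h2 := mul_le_mul_of_nonneg_left h1 (sq_nonneg t)
    linarith
  | smul r f _ hf =>
    obtain ⟨C, hC, hf⟩ := hf
    refine ⟨r ^ 2 * C, by positivity, fun u t A hA => ?_⟩
    obtain ⟨cf, bf⟩ := hf u t A hA
    refine ⟨cf.const_mul r, ?_⟩
    have e : (fun p => (r • f) u p ^ 2) = fun p => r ^ 2 * f u p ^ 2 := by
      funext p
      exact mul_pow r (f u p) 2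
    rw [e, In_const_mul]
    have h2 := mul_le_mul_of_nonneg_left bf (sq_nonneg r)
    linarith

lemma good_form {c0 δ : ℝ} (hc0 : 0 < c0) (hδ : 0 < δ) (hδ' : δ < 1 / 24) {m : ℕ} (hm : m ≤ 2)
    {i j k : Fin 3} (hs : sig δ j + sig δ k ≤ sig δ i) (H : Fin 4 → Fin 4 → ℝ) {b c : Fin 7 → ℕ}
    (hbc : ∑ l, b l + ∑ l, c l ≤ m) :
    Good c0 δ m i fun u => nullQ H (Zmulti b (u.1 j)) (Zmulti c (u.1 k)) := by
  obtain ⟨C, hC, h⟩ := form_est hc0 hδ hδ' hm H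
  refine ⟨C, hC, fun u t A hA => ⟨CS.nullQ ((u.2 j).Zmulti b) ((u.2 k).Zmulti c)
    ((hA.sc k).Zmulti c) H, (h b c hbc j k u.1 t A hA).trans ?_⟩⟩
  have hT := jb_pos t
  have hX := XY_nonneg c0 δ m u.1 t
  have h1 : jb t ^ sig δ j * jb t ^ sig δ k ≤ jb t ^ sig δ i := by
    rw [← Real.rpow_add hT]
    exact Real.rpow_le_rpow_of_exponent_le (one_le_jb t) hs
  gcongr

lemma good_null {c0 δ : ℝ} (hc0 : 0 < c0) (hδ : 0 < δ) (hδ' : δ < 1 / 24) {m : ℕ} (hm : m ≤ 2)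
    {i j k : Fin 3} (hj : cspeed c0 j = 1) (hk : cspeed c0 k = 1) {H : Fin 4 → Fin 4 → ℝ}
    (hH : IsNull H) {b c : Fin 7 → ℕ} (hbc : ∑ l, b l + ∑ l, c l ≤ m) :
    Good c0 δ m i fun u => nullQ H (Zmulti b (u.1 j)) (Zmulti c (u.1 k)) := by
  obtain ⟨C, hC, h⟩ := null_est hc0 hδ hδ' hm hH
  refine ⟨C, hC, fun u t A hA => ⟨CS.nullQ ((u.2 j).Zmulti b) ((u.2 k).Zmulti c)
    ((hA.sc k).Zmulti c) H, (h b c hbc j k hj hk u.1 t A hA).trans ?_⟩⟩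
  have hX := XY_nonneg c0 δ m u.1 t
  have h1 : 1 ≤ (jb t ^ sig δ i) ^ 2 := one_le_pow₀ (one_le_tau hδ t i)
  have h2 := mul_le_mul_of_nonneg_right h1 (show 0 ≤ C * (A ^ 2 * XY c0 δ m u.1 t) by positivity)
  linarith

lemma good_zero {c0 δ : ℝ} {m : ℕ} {i j k : Fin 3} {H : Fin 4 → Fin 4 → ℝ}
    (hH : ∀ α β, H α β = 0) {b c : Fin 7 → ℕ} :
    Good c0 δ m i fun u => nullQ H (Zmulti b (u.1 j)) (Zmulti c (u.1 k)) := by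
  have e : (fun u : SU => nullQ H (Zmulti b (u.1 j)) (Zmulti c (u.1 k))) = 0 := by
    funext u p
    simp [nullQ, hH]
  rw [e]
  exact Good.span (S := ∅) (by simp) (Submodule.zero_mem _)

lemma prod_fac_le {X : Type*} {u : X → Fin 3 → Fn} {x : X} {p : Pt} {B : ℝ}
    (M : Multiset ((Fin 3 × Fin 4) × (Fin 7 → ℕ))) (h : ∀ q ∈ M, |fac u q x p| ≤ B) :
    |(M.map (fac u)).prod x p| ≤ B ^ M.card := by
  induction M using Multiset.induction_on with
  | empty => simp
  | cons q M ih =>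
    have h1 := ih fun q hq => h q (Multiset.mem_cons_of_mem hq)
    have h2 := h q (Multiset.mem_cons_self q M)
    rw [Multiset.map_cons, Multiset.prod_cons, Multiset.card_cons, pow_succ, mul_comm (B ^ _)]
    have e : (fac u q * (M.map (fac u)).prod) x p = fac u q x p * (M.map (fac u)).prod x p := rfl
    rw [e, abs_mul]
    exact mul_le_mul h2 h1 (abs_nonneg _) ((abs_nonneg _).trans h2)

lemma exists_top_factor {m : ℕ} (hm : m ≤ 2) {M : Multiset ((Fin 3 × Fin 4) × (Fin 7 → ℕ))}
    (hc : 3 ≤ M.card) (hs : (M.map fun q => ∑ i, q.2 i).sum ≤ m) :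
    ∃ q M', M = q ::ₘ M' ∧ 2 ≤ M'.card ∧ ∑ i, q.2 i ≤ m ∧ ∀ q' ∈ M', ∑ i, q'.2 i ≤ 1 := by
  have hle : ∀ (N : Multiset ((Fin 3 × Fin 4) × (Fin 7 → ℕ))), ∀ q' ∈ N,
      ∑ i, q'.2 i ≤ (N.map fun q => ∑ i, q.2 i).sum := fun N q' h =>
    Multiset.single_le_sum (fun _ _ => Nat.zero_le _) _ (Multiset.mem_map_of_mem _ h)
  by_cases h : ∃ q ∈ M, 2 ≤ ∑ i, q.2 i
  · obtain ⟨q, hq, h2⟩ := h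
    obtain ⟨M', rfl⟩ := Multiset.exists_cons_of_mem hq
    rw [Multiset.card_cons] at hc
    rw [Multiset.map_cons, Multiset.sum_cons] at hs
    refine ⟨q, M', rfl, by omega, by omega, fun q' hq' => ?_⟩
    have := hle M' q' hq'
    omega
  · push Not at h
    obtain ⟨q, hq⟩ := Multiset.card_pos_iff_exists_mem.1 (show 0 < M.card by omega)
    have h3 := hle M q hq
    obtain ⟨M', rfl⟩ := Multiset.exists_cons_of_mem hq
    rw [Multiset.card_cons] at hc
    refine ⟨q, M', rfl, by omega, by omega, fun q' hq' => ?_⟩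
    have := h q' (Multiset.mem_cons_of_mem hq')
    omega

lemma good_product {c0 δ : ℝ} (hc0 : 0 < c0) (hδ : 0 < δ) (hδ' : δ < 1 / 24) {m : ℕ} (hm : m ≤ 2)
    {i : Fin 3} : ∀ s ∈ cset (fun u : SU => u.1) 3 m, Good c0 δ m i s := by
  rintro _ ⟨M, hM, hs, rfl⟩
  obtain ⟨⟨⟨j, α⟩, b⟩, M', rfl, hM', hb, h1⟩ := exists_top_factor hm hM hs
  obtain ⟨K, hK, hd⟩ := Adm.decay (δ := δ) hc0
  set n := M'.card with hn
  refine ⟨(Real.sqrt K ^ n) ^ 2, by positivity, fun u t A hA => ?_⟩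
  have hT := jb_pos t
  have hX := XY_nonneg c0 δ m u.1 t
  have hd0 : 0 < jb t ^ δ := Real.rpow_pos_of_pos hT δ
  have hd1 : 1 ≤ jb t ^ δ := Real.one_le_rpow (one_le_jb t) hδ.le
  have hd6 := delta_pow_six hδ' t
  have su : ∀ (u : SU) (i : Fin 3), Sm (u.1 i) := fun u => u.2
  have sb := (u.2 j).Zmulti b
  have cb := (hA.sc j).Zmulti b
  set d := jb t ^ δ with hdd
  set T := jb t with hTT
  have hA0 := hA.hA
  have hA1 := hA.hA1
  set e := A * d ^ 2 * T⁻¹ with he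
  have e0 : 0 ≤ e := by positivity
  have hdT : d ^ 2 ≤ T := (pow_le_pow_right₀ hd1 (by norm_num)).trans hd6
  have e1 : e ≤ 1 := by
    rw [he, ← div_eq_mul_inv, div_le_one hT]
    exact (mul_le_of_le_one_left (by positivity) hA1).trans hdT
  have hf : ∀ x : Sp, ∀ q ∈ M', |fac (fun u : SU => u.1) q u (t, x)| ≤ Real.sqrt K * e := by
    intro x q hq
    refine abs_le_of_sq_le_sq ?_ (by positivity)
    have h2 := hd q.2 (h1 q hq) q.1.1 u.1 t A hA x
    have h3 : fac (fun u : SU => u.1) q u (t, x) ^ 2 ≤ gsq (Zmulti q.2 (u.1 q.1.1)) (t, x) :=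
      pd_sq_le_gsq _ _ _
    have h4 : jb t ^ sig δ q.1.1 ≤ d := tau_le hδ t _
    have h5 : K * (A ^ 2 * (jb t ^ sig δ q.1.1 * d) ^ 2) ≤ K * (A ^ 2 * (d * d) ^ 2) := by gcongr
    rw [mul_pow, Real.sq_sqrt hK, he, mul_pow, mul_pow, inv_pow, ← mul_assoc, ← div_eq_mul_inv,
      le_div_iff₀ (by positivity)]
    have h6 := mul_le_mul_of_nonneg_left h3 (sq_nonneg T)
    linarith
  have hcp : Continuous ((M'.map (fac fun u : SU => u.1)).prod u) := (prod_fac_sm su M' u).continuous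
  have c1 : CS t ((((((j, α), b) ::ₘ M').map (fac fun u : SU => u.1)).prod) u) := by
    rw [Multiset.map_cons, Multiset.prod_cons]
    exact (CS.pd sb cb α).mul_right hcp
  refine ⟨c1, ?_⟩
  have h2 := In_mono c1.sq ((CS.gsq sb cb).const_mul ((Real.sqrt K ^ n * e ^ 2) ^ 2)) fun x => by
    have h3 := prod_fac_le M' (hf x)
    have h4 : (Real.sqrt K * e) ^ n ≤ Real.sqrt K ^ n * e ^ 2 := by
      rw [mul_pow]
      exact mul_le_mul_of_nonneg_left (pow_le_pow_of_le_one e0 e1 hM') (by positivity)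
    have h5 := sq_le_sq' (neg_le_of_abs_le (h3.trans h4)) (le_of_abs_le (h3.trans h4))
    have h6 : pd α (Zmulti b (u.1 j)) (t, x) ^ 2 ≤ gsq (Zmulti b (u.1 j)) (t, x) :=
      pd_sq_le_gsq _ _ _
    rw [Multiset.map_cons, Multiset.prod_cons]
    have h7 : (fac (fun u : SU => u.1) ((j, α), b) * (M'.map (fac fun u : SU => u.1)).prod) u (t, x)
      = (M'.map (fac fun u : SU => u.1)).prod u (t, x) * pd α (Zmulti b (u.1 j)) (t, x) := mul_comm _ _
    rw [h7, mul_pow]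
    exact mul_le_mul h5 h6 (sq_nonneg _) (sq_nonneg _)
  rw [In_const_mul] at h2
  have h3 := gsq_le_NQ (hb.trans m.le_succ) (u.1 j) t
  have h4 := NQ_le_XY c0 δ m u.1 t j
  have h5 : (jb t ^ sig δ j) ^ 2 ≤ d ^ 2 := by
    have := tau_le hδ t j
    have := one_le_tau hδ t j
    gcongr
  have h6 : t ^ 2 ≤ T ^ 2 := sq_le_sq_jb t
  have h7 : 1 ≤ (jb t ^ sig δ i) ^ 2 := one_le_pow₀ (one_le_tau hδ t i)
  have h8 : t ^ 2 * (e ^ 4 * (jb t ^ sig δ j) ^ 2) ≤ A ^ 2 * (jb t ^ sig δ i) ^ 2 := by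
    calc t ^ 2 * (e ^ 4 * (jb t ^ sig δ j) ^ 2) ≤ T ^ 2 * (e ^ 4 * d ^ 2) := by gcongr
      _ = A ^ 4 * (d ^ 10 / T ^ 2) := by rw [he]; field_simp
      _ ≤ A ^ 2 * 1 := by
          refine mul_le_mul (pow_le_pow_of_le_one hA0 hA1 (by norm_num)) ?_ (by positivity)
            (by positivity)
          rw [div_le_one (by positivity)]
          calc d ^ 10 ≤ d ^ 12 := pow_le_pow_right₀ hd1 (by norm_num)
            _ = (d ^ 6) ^ 2 := by ring
            _ ≤ T ^ 2 := by gcongr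
      _ ≤ A ^ 2 * (jb t ^ sig δ i) ^ 2 := by gcongr
  have h9 := mul_le_mul_of_nonneg_left h2 (sq_nonneg t)
  refine h9.trans ?_
  have h10 := mul_le_mul_of_nonneg_left (h3.trans h4)
    (show 0 ≤ t ^ 2 * (Real.sqrt K ^ n * e ^ 2) ^ 2 by positivity)
  have h11 := mul_le_mul_of_nonneg_right h8
    (show 0 ≤ (Real.sqrt K ^ n) ^ 2 * XY c0 δ m u.1 t by positivity)
  linarith

lemma Zmulti_congr {U : Set Pt} (hU : IsOpen U) {v w : Fn} (h : ∀ p ∈ U, v p = w p) (n : ℕ) :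
    ∀ a : Fin 7 → ℕ, ∑ i, a i = n → ∀ p ∈ U, Zmulti a v p = Zmulti a w p := by
  induction n with
  | zero =>
    intro a ha
    have : a = 0 := by
      funext i
      exact (Finset.sum_eq_zero_iff.1 ha) i (Finset.mem_univ i)
    subst this
    simpa only [Zmulti_zero] using h
  | succ n ih =>
    intro a ha p hp
    have hne : a ≠ 0 := by
      rintro rfl
      simp at ha
    obtain ⟨i, b, rfl, hb⟩ := exists_split a hne
    rw [sum_add_single] at ha
    rw [Zmulti_succ b i hb, Zmulti_succ b i hb]
    refine Zop_congr ?_ i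
    filter_upwards [hU.mem_nhds hp] with q hq
    exact ih b (by omega) q hq

lemma Good.add {c0 δ : ℝ} {m : ℕ} {i : Fin 3} {f g : SU → Fn} (hf : Good c0 δ m i f)
    (hg : Good c0 δ m i g) : Good c0 δ m i (f + g) :=
  Good.span (S := {f | Good c0 δ m i f}) (fun _ h => h)
    (Submodule.add_mem _ (Submodule.subset_span hf) (Submodule.subset_span hg))

lemma Good.smul {c0 δ : ℝ} {m : ℕ} {i : Fin 3} {f : SU → Fn} (hf : Good c0 δ m i f) (r : ℝ) :
    Good c0 δ m i (r • f) :=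
  Good.span (S := {f | Good c0 δ m i f}) (fun _ h => h)
    (Submodule.smul_mem _ r (Submodule.subset_span hf))

lemma Good.zero {c0 δ : ℝ} {m : ℕ} {i : Fin 3} : Good c0 δ m i 0 :=
  Good.span (S := ∅) (by simp) (Submodule.zero_mem _)

/-- A class of bilinear forms, stable under commutation with the generators, whose members are
admissible as coefficients of `∂u_j ∂u_k` in the `i`-th equation. -/
def GoodClass (c0 δ : ℝ) (m : ℕ) (i j k : Fin 3) (P : (Fin 4 → Fin 4 → ℝ) → Prop) : Prop :=
  (∀ H, P H → ∀ l, P (dH l H)) ∧ ∀ H, P H → ∀ b c : Fin 7 → ℕ, ∑ l, b l + ∑ l, c l ≤ m →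
    Good c0 δ m i fun u => nullQ H (Zmulti b (u.1 j)) (Zmulti c (u.1 k))

lemma goodClass_all {c0 δ : ℝ} (hc0 : 0 < c0) (hδ : 0 < δ) (hδ' : δ < 1 / 24) {m : ℕ} (hm : m ≤ 2)
    {i j k : Fin 3} (hs : sig δ j + sig δ k ≤ sig δ i) (H : Fin 4 → Fin 4 → ℝ) :
    ∃ P, P H ∧ GoodClass c0 δ m i j k P :=
  ⟨fun _ => True, trivial, fun _ _ _ => trivial, fun H _ _ _ hbc =>
    good_form hc0 hδ hδ' hm hs H hbc⟩

lemma goodClass_null {c0 δ : ℝ} (hc0 : 0 < c0) (hδ : 0 < δ) (hδ' : δ < 1 / 24) {m : ℕ}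
    (hm : m ≤ 2) {i j k : Fin 3} (hj : cspeed c0 j = 1) (hk : cspeed c0 k = 1)
    {H : Fin 4 → Fin 4 → ℝ} (hH : nullCond 1 H) : ∃ P, P H ∧ GoodClass c0 δ m i j k P :=
  ⟨IsNull, isNull_of_nullCond hH, fun _ h l => h.dH l, fun _ h _ _ hbc =>
    good_null hc0 hδ hδ' hm hj hk h hbc⟩

lemma goodClass_zero {c0 δ : ℝ} {m : ℕ} {i j k : Fin 3} {H : Fin 4 → Fin 4 → ℝ}
    (hH : ∀ α β, H α β = 0) : ∃ P, P H ∧ GoodClass c0 δ m i j k P :=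
  ⟨fun H => ∀ α β, H α β = 0, hH, fun _ h l => dH_zero h l, fun _ h _ _ _ => good_zero h⟩

lemma exists_goodClass {c0 δ : ℝ} (hc0 : 0 < c0) (hδ : 0 < δ) (hδ' : δ < 1 / 24) {F : Coef}
    (hTri : LowerTri F) (h1 : nullCond 1 (F 0 0 0)) (h2 : nullCond 1 (F 1 0 0))
    (h3 : nullCond 1 (F 1 0 1)) (h4 : nullCond 1 (F 2 0 0)) (h5 : nullCond 1 (F 2 0 1))
    (h6 : ∀ α β, F 1 0 2 α β = 0) (h7 : ∀ α β, F 2 0 2 α β = 0) {m : ℕ} (hm : m ≤ 2)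
    (i j k : Fin 3) : ∃ P, P (F i j k) ∧ GoodClass c0 δ m i j k P := by
  by_cases hkj : (k : ℕ) < j
  · exact goodClass_zero (hTri i j k hkj)
  fin_cases j <;> fin_cases k <;> fin_cases i <;>
    simp only [Fin.zero_eta, Fin.mk_one, Fin.reduceFinMk] at hkj ⊢ <;>
    first
    | exact absurd (by decide) hkj
    | exact goodClass_null hc0 hδ hδ' hm rfl rfl ‹_›
    | exact goodClass_zero ‹_›
    | exact goodClass_all hc0 hδ hδ' hm (by simp [sig, hδ.le]) _

lemma cubicEval_span {X : Type*} {u : X → Fin 3 → Fn} {C : MvPolynomial (Fin 3 × Fin 4) ℝ}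
    (hC : CubicLike C) : (fun x => cubicEval C (u x)) ∈ Submodule.span ℝ (cset u 3 0) := by
  classical
  have e : (fun x => cubicEval C (u x)) = fun x p => ∑ d ∈ C.support, C.coeff d *
      ((d.toMultiset.map fun q => (q, (0 : Fin 7 → ℕ))).map (fac u)).prod x p := by
    funext x p
    rw [cubicEval, MvPolynomial.eval_eq]
    refine Finset.sum_congr rfl fun d _ => congrArg _ ?_
    have h1 : (((d.toMultiset.map fun q => (q, (0 : Fin 7 → ℕ))).map (fac u)).prod x p) =
        (d.toMultiset.map fun q => pd q.2 (u x q.1) p).prod := by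
      generalize d.toMultiset = M
      induction M using Multiset.induction_on with
      | empty => rfl
      | cons q M ih =>
        rw [Multiset.map_cons, Multiset.map_cons, Multiset.prod_cons, Multiset.map_cons,
          Multiset.prod_cons, ← ih]
        change fac u (q, 0) x p * _ = _
        simp only [fac, Zmulti_zero]
    rw [h1, Finsupp.toMultiset_map, Finsupp.prod_toMultiset, Finsupp.prod_mapDomain_index]
    · rfl
    · simp
    · simp [pow_add]
  rw [e]
  refine sum_mem_span _ fun d hd => Submodule.subset_span
    ⟨d.toMultiset.map fun q => (q, (0 : Fin 7 → ℕ)), ?_, ?_, rfl⟩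
  · rw [Multiset.card_map, Finsupp.card_toMultiset]
    exact hC d hd
  · rw [Multiset.map_map]
    simp

lemma Zmulti_rhs_good {c0 δ : ℝ} (hc0 : 0 < c0) (hδ : 0 < δ) (hδ' : δ < 1 / 24) {F : Coef}
    {Cub : Fin 3 → MvPolynomial (Fin 3 × Fin 4) ℝ} (hCub : ∀ i, CubicLike (Cub i)) {m : ℕ}
    (hm : m ≤ 2) {i : Fin 3} (hF : ∀ j k, ∃ P, P (F i j k) ∧ GoodClass c0 δ m i j k P)
    {a : Fin 7 → ℕ} (ha : ∑ l, a l ≤ m) :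
    Good c0 δ m i fun u => Zmulti a (rhs F Cub u.1 i) := by
  choose P hP hG using hF
  have hu : ∀ (u : SU) (i : Fin 3), Sm (u.1 i) := fun u => u.2
  let S : ℕ → Set (SU → Fn) := fun n =>
    (⋃ j, ⋃ k, qset (P j k) (fun u : SU => u.1 j) (fun u : SU => u.1 k) n) ∪
      cset (fun u : SU => u.1) 3 n
  have hq : ∀ n j k, qset (P j k) (fun u : SU => u.1 j) (fun u : SU => u.1 k) n ⊆ S n :=
    fun n j k s hs => Or.inl (Set.mem_iUnion₂.2 ⟨j, k, hs⟩)
  have hc : ∀ n, cset (fun u : SU => u.1) 3 n ⊆ S n := fun n s hs => Or.inr hs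
  have hS : ∀ n, ∀ s ∈ S n, ∀ x, Sm (s x) := by
    rintro n s (hs | ⟨M, _, _, rfl⟩)
    · obtain ⟨j, k, hs⟩ := Set.mem_iUnion₂.1 hs
      exact qset_sm (fun u => hu u j) (fun u => hu u k) n s hs
    · exact prod_fac_sm hu M
  have hstep : ∀ n l, ∀ s ∈ S n, (fun x => Zop l (s x)) ∈ Submodule.span ℝ (S (n + 1)) := by
    rintro n l s (hs | ⟨M, hM, hn, rfl⟩)
    · obtain ⟨j, k, hs⟩ := Set.mem_iUnion₂.1 hs
      exact Submodule.span_mono (hq _ j k)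
        (qset_step (hG j k).1 (fun u => hu u j) (fun u => hu u k) n l s hs)
    · refine Submodule.span_mono (fun s hs => hc _ ?_) (cset_step hu l M)
      obtain ⟨M', hM', hn', rfl⟩ := hs
      exact ⟨M', hM.trans hM', by omega, rfl⟩
  have h0 : (fun u : SU => rhs F Cub u.1 i) ∈ Submodule.span ℝ (S 0) := by
    have e : (fun u : SU => rhs F Cub u.1 i) =
        (∑ j, ∑ k, fun u : SU => nullQ (F i j k) (Zmulti 0 (u.1 j)) (Zmulti 0 (u.1 k))) +
          fun u : SU => cubicEval (Cub i) u.1 := by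
      funext u p
      simp only [rhs, Pi.add_apply, Finset.sum_apply, Zmulti_zero, nullQ]
    rw [e]
    refine Submodule.add_mem _ (Submodule.sum_mem _ fun j _ => Submodule.sum_mem _ fun k _ => ?_)
      (Submodule.span_mono (hc 0) (cubicEval_span (hCub i)))
    exact Submodule.subset_span (hq 0 j k ⟨F i j k, 0, 0, hP j k, by simp, rfl⟩)
  refine Good.span ?_ (zmulti_span hS hstep h0 _ a rfl)
  rintro s (hs | ⟨M, hM, hn, rfl⟩)
  · obtain ⟨j, k, H, b, c, hH, hbc, rfl⟩ := Set.mem_iUnion₂.1 hs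
    exact (hG j k).2 H hH b c (hbc.trans ha)
  · exact good_product hc0 hδ hδ' hm _ ⟨M, hM, hn.trans ha, rfl⟩

lemma boxOp_bound {c0 δ : ℝ} (hc0 : 0 < c0) (hδ : 0 < δ) (hδ' : δ < 1 / 24) {F : Coef}
    {Cub : Fin 3 → MvPolynomial (Fin 3 × Fin 4) ℝ} (hCub : ∀ i, CubicLike (Cub i)) {m : ℕ}
    (hm : m ≤ 2) {i : Fin 3} (hF : ∀ j k, ∃ P, P (F i j k) ∧ GoodClass c0 δ m i j k P) :
    ∃ C, 0 ≤ C ∧ ∀ (T : ℝ) (u : Fin 3 → Fn), LocalSolution c0 F Cub T u → ∀ t ∈ Ioo 0 T,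
      ∀ A, Adm c0 δ u t A →
        t ^ 2 * ∑ a ∈ idxSet 7 m, In t (fun p => boxOp (cspeed c0 i) (Zmulti a (u i)) p ^ 2) ≤
          C * (A ^ 2 * (jb t ^ sig δ i) ^ 2 * XY c0 δ m u t) := by
  have key : ∀ f ∈ Submodule.span ℝ (zset m fun u : SU => boxOp (cspeed c0 i) (u.1 i)),
      ∃ g, Good c0 δ m i g ∧ ∀ (u : SU) (T : ℝ), LocalSolution c0 F Cub T u.1 →
        ∀ t ∈ Ioo 0 T, ∀ x, f u (t, x) = g u (t, x) := by
    intro f hf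
    induction hf using Submodule.span_induction with
    | mem s hs =>
      obtain ⟨b, hb, rfl⟩ := hs
      refine ⟨_, Zmulti_rhs_good hc0 hδ hδ' hCub hm hF hb, fun u T hu t ht x => ?_⟩
      refine Zmulti_congr (U := Ioo 0 T ×ˢ univ) (isOpen_Ioo.prod isOpen_univ) ?_ _ b rfl _
        ⟨ht, mem_univ x⟩
      rintro ⟨s, y⟩ ⟨hs, -⟩
      exact hu.2.2 i s hs y
    | zero => exact ⟨0, Good.zero, fun _ _ _ _ _ _ => rfl⟩
    | add f g _ _ hf hg =>
      obtain ⟨f', hf, ef⟩ := hf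
      obtain ⟨g', hg, eg⟩ := hg
      refine ⟨f' + g', hf.add hg, fun u T hu t ht x => ?_⟩
      exact congrArg₂ (· + ·) (ef u T hu t ht x) (eg u T hu t ht x)
    | smul r f _ hf =>
      obtain ⟨f', hf, ef⟩ := hf
      exact ⟨r • f', hf.smul r, fun u T hu t ht x => congrArg (r * ·) (ef u T hu t ht x)⟩
  have key2 : ∀ a : Fin 7 → ℕ, ∃ C, 0 ≤ C ∧ (a ∈ idxSet 7 m → ∀ (T : ℝ) (u : Fin 3 → Fn),
      LocalSolution c0 F Cub T u → ∀ t ∈ Ioo 0 T, ∀ A, Adm c0 δ u t A →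
        t ^ 2 * In t (fun p => boxOp (cspeed c0 i) (Zmulti a (u i)) p ^ 2) ≤
          C * (A ^ 2 * (jb t ^ sig δ i) ^ 2 * XY c0 δ m u t)) := by
    intro a
    by_cases ha : a ∈ idxSet 7 m
    · have hu : ∀ u : SU, Sm (u.1 i) := fun u => u.2 i
      have h1 := boxOp_zmulti_span hu (cspeed c0 i) _ a rfl
      obtain ⟨g, ⟨C, hC, hg⟩, eg⟩ := key _
        (Submodule.span_mono (zset_mono (mem_idxSet.1 ha) _) h1)
      refine ⟨C, hC, fun _ T u hu t ht A hA => ?_⟩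
      refine le_trans (le_of_eq ?_) (hg ⟨u, hA.sm⟩ t A hA).2
      refine congrArg _ (integral_congr_ae (Filter.Eventually.of_forall fun x => ?_))
      exact congrArg (· ^ 2) (eg ⟨u, hA.sm⟩ T hu t ht x)
    · exact ⟨0, le_rfl, fun h => absurd h ha⟩
  choose C hC h using key2
  refine ⟨∑ a ∈ idxSet 7 m, C a, Finset.sum_nonneg fun a _ => hC a, fun T u hu t ht A hA => ?_⟩
  rw [Finset.mul_sum, Finset.sum_mul]
  exact Finset.sum_le_sum fun a ha => h a ha T u hu t ht A hA

lemma Mmu_nonneg (μ : ℕ) (c : ℝ) (v : Fn) (t : ℝ) : 0 ≤ Mmu μ c v t :=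
  Finset.sum_nonneg fun _ _ => Finset.sum_nonneg fun _ _ => Finset.sum_nonneg fun _ _ =>
    Real.sqrt_nonneg _

lemma Nnorm_nonneg (κ : ℕ) (c : ℝ) (v : Fn) (t : ℝ) : 0 ≤ Nnorm κ c v t := Real.sqrt_nonneg _

lemma Mmu_le (c : ℝ) (m : ℕ) {v : Fn} {t : ℝ} (hv : Sm v) (hs : SC t v) :
    Mmu (m + 2) c v t ≤ ((idxSet 7 m).card * 12 * Real.sqrt 3) * Real.sqrt (MQ c m v t) := by
  have h1 : ∀ a ∈ idxSet 7 m, ∀ (α : Fin 4) (j : Fin 3),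
      L2 (fun x => jb (c * t - ‖x‖) * pd α (px j (Zmulti a v)) (t, x)) ≤
        Real.sqrt 3 * Real.sqrt (MQ c m v t) := by
    intro a ha α j
    rw [← Real.sqrt_mul (by norm_num)]
    refine Real.sqrt_le_sqrt ?_
    have cs : CS t fun p => psi c p * hess (Zmulti a v) p :=
      CS.mul_left (CS.hess (hv.Zmulti a) (hs.Zmulti a)) (Sm.psi c).continuous
    have h2 : In t (fun p => 3 * (psi c p * hess (Zmulti a v) p)) ≤ 3 * MQ c m v t := by
      rw [In_const_mul]
      exact mul_le_mul_of_nonneg_left (hess_le_MQ (mem_idxSet.1 ha) c v t) (by norm_num)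
    refine le_trans (integral_mono_of_nonneg (Filter.Eventually.of_forall fun x => sq_nonneg _)
      (cs.const_mul 3).int (Filter.Eventually.of_forall fun x => ?_)) h2
    have h3 : pd α (pd j.succ (Zmulti a v)) (t, x) ^ 2 ≤ hess (Zmulti a v) (t, x) :=
      (Finset.single_le_sum (f := fun j : Fin 3 => pd α (pd j.succ (Zmulti a v)) (t, x) ^ 2)
        (fun _ _ => sq_nonneg _) (Finset.mem_univ j)).trans
      (Finset.single_le_sum
        (f := fun α => ∑ j : Fin 3, pd α (pd j.succ (Zmulti a v)) (t, x) ^ 2)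
        (fun _ _ => Finset.sum_nonneg fun _ _ => sq_nonneg _) (Finset.mem_univ α))
    have h4 := le_psi c (t, x)
    have h5 := mul_le_mul h4 h3 (sq_nonneg _) ((sq_nonneg _).trans h4)
    simp only [mul_pow, px_eq_pd]
    linarith
  have h2 : Mmu (m + 2) c v t ≤ ∑ a ∈ idxSet 7 m, ∑ α : Fin 4, ∑ j : Fin 3,
      Real.sqrt 3 * Real.sqrt (MQ c m v t) :=
    Finset.sum_le_sum fun a ha => Finset.sum_le_sum fun α _ => Finset.sum_le_sum fun j _ =>
      h1 a ha α j
  refine h2.trans_eq ?_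
  simp only [Finset.sum_const, Finset.card_univ, Fintype.card_fin, nsmul_eq_mul]
  push_cast
  ring

lemma NQ_le {c : ℝ} (hc : 0 < c) (m : ℕ) {v : Fn} {t : ℝ} (hv : Sm v) (hs : SC t v) :
    NQ (m + 1) v t ≤ 2 * (1 + 1 / c ^ 2) * Nnorm (m + 2) c v t ^ 2 := by
  have h1 : ∀ a, In t (gsq (Zmulti a v)) ≤ 2 * (1 + 1 / c ^ 2) * energy c (Zmulti a v) t := by
    intro a
    have sa := hv.Zmulti a
    have ca := hs.Zmulti a
    have e : 2 * (1 + 1 / c ^ 2) * energy c (Zmulti a v) t = In t fun p => (1 + 1 / c ^ 2) *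
        (pd 0 (Zmulti a v) p ^ 2 + c ^ 2 * ∑ j : Fin 3, pd j.succ (Zmulti a v) p ^ 2) := by
      rw [In_const_mul]
      simp only [energy, In, px_eq_pd, pt_eq_pd]
      ring
    rw [e]
    refine In_mono (CS.gsq sa ca) (CS.const_mul (CS.add (CS.pd sa ca 0).sq
      (CS.const_mul (CS.sum _ fun j _ => (CS.pd sa ca _).sq) _)) _) fun x => ?_
    rw [MultiSpeedWave.gsq, Fin.sum_univ_succ]
    have h0 := sq_nonneg (pd 0 (Zmulti a v) (t, x))
    have h3 : 0 ≤ ∑ j : Fin 3, pd j.succ (Zmulti a v) (t, x) ^ 2 :=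
      Finset.sum_nonneg fun _ _ => sq_nonneg _
    generalize pd 0 (Zmulti a v) (t, x) ^ 2 = y at *
    generalize ∑ j : Fin 3, pd j.succ (Zmulti a v) (t, x) ^ 2 = z at *
    have h4 : (1 + 1 / c ^ 2) * (y + c ^ 2 * z) = y + z + (c ^ 2 * z + 1 / c ^ 2 * y) := by
      field_simp
      ring
    rw [h4]
    have : 0 ≤ c ^ 2 * z + 1 / c ^ 2 * y := by positivity
    linarith
  have h2 : 0 ≤ ∑ a ∈ idxSet 7 (m + 1), energy c (Zmulti a v) t := by
    refine Finset.sum_nonneg fun a _ => mul_nonneg (by norm_num) (integral_nonneg fun x => ?_)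
    exact add_nonneg (sq_nonneg _) (mul_nonneg (sq_nonneg _)
      (Finset.sum_nonneg fun _ _ => sq_nonneg _))
  rw [Nnorm, show m + 2 - 1 = m + 1 from rfl, Real.sq_sqrt h2, Finset.mul_sum]
  exact Finset.sum_le_sum fun a _ => h1 a

lemma calM_eq (c0 δ : ℝ) (κ : ℕ) (u : Fin 3 → Fn) (t : ℝ) :
    calM c0 δ κ u t = ∑ k, jb t ^ (-(sig δ k)) * Mmu κ (cspeed c0 k) (u k) t := by
  rw [Fin.sum_univ_three]
  simp [calM, sig, cspeed]

lemma calN_eq (c0 δ : ℝ) (κ : ℕ) (u : Fin 3 → Fn) (t : ℝ) :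
    calN c0 δ κ u t = ∑ k, jb t ^ (-(sig δ k)) * Nnorm κ (cspeed c0 k) (u k) t := by
  rw [Fin.sum_univ_three]
  simp [calN, sig, cspeed]

lemma jb_rpow_nonneg (t s : ℝ) : 0 ≤ jb t ^ s := Real.rpow_nonneg (jb_pos t).le s

lemma calM_nonneg (c0 δ : ℝ) (κ : ℕ) (u : Fin 3 → Fn) (t : ℝ) : 0 ≤ calM c0 δ κ u t := by
  rw [calM_eq]
  exact Finset.sum_nonneg fun k _ => mul_nonneg (jb_rpow_nonneg _ _) (Mmu_nonneg _ _ _ _)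

lemma calN_nonneg (c0 δ : ℝ) (κ : ℕ) (u : Fin 3 → Fn) (t : ℝ) : 0 ≤ calN c0 δ κ u t := by
  rw [calN_eq]
  exact Finset.sum_nonneg fun k _ => mul_nonneg (jb_rpow_nonneg _ _) (Nnorm_nonneg _ _ _ _)

/-- The weighted square of the second-derivative norms. -/
def MX (c0 δ : ℝ) (m : ℕ) (u : Fin 3 → Fn) (t : ℝ) : ℝ :=
  ∑ k : Fin 3, (jb t ^ (-(sig δ k))) ^ 2 * MQ (cspeed c0 k) m (u k) t

/-- The weighted square of the energy norms. -/
def NX (δ : ℝ) (m : ℕ) (u : Fin 3 → Fn) (t : ℝ) : ℝ :=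
  ∑ k : Fin 3, (jb t ^ (-(sig δ k))) ^ 2 * NQ (m + 1) (u k) t

lemma XY_eq (c0 δ : ℝ) (m : ℕ) (u : Fin 3 → Fn) (t : ℝ) :
    XY c0 δ m u t = MX c0 δ m u t + NX δ m u t := by
  simp only [XY, MX, NX, mul_add, Finset.sum_add_distrib]

lemma calM_le (c0 δ : ℝ) (m : ℕ) : ∃ K, 0 ≤ K ∧ ∀ (u : Fin 3 → Fn) (t : ℝ), (∀ i, Sm (u i)) →
    (∀ i, SC t (u i)) → calM c0 δ (m + 2) u t ≤ K * Real.sqrt (MX c0 δ m u t) := by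
  refine ⟨3 * ((idxSet 7 m).card * 12 * Real.sqrt 3), by positivity, fun u t hu hs => ?_⟩
  rw [calM_eq]
  set K : ℝ := (idxSet 7 m).card * 12 * Real.sqrt 3 with hK
  have K0 : 0 ≤ K := by positivity
  have h : ∀ k : Fin 3, jb t ^ (-(sig δ k)) * Mmu (m + 2) (cspeed c0 k) (u k) t ≤
      K * Real.sqrt (MX c0 δ m u t) := by
    intro k
    have hJ := jb_rpow_nonneg t (-(sig δ k))
    have h1 := mul_le_mul_of_nonneg_left (Mmu_le (cspeed c0 k) m (hu k) (hs k)) hJ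
    have h2 : jb t ^ (-(sig δ k)) * Real.sqrt (MQ (cspeed c0 k) m (u k) t) ≤
        Real.sqrt (MX c0 δ m u t) := by
      refine Real.le_sqrt_of_sq_le ?_
      rw [mul_pow, Real.sq_sqrt (MQ_nonneg _ _ _ _)]
      exact Finset.single_le_sum (f := fun k : Fin 3 => (jb t ^ (-(sig δ k))) ^ 2 *
        MQ (cspeed c0 k) m (u k) t) (fun k _ => mul_nonneg (sq_nonneg _) (MQ_nonneg _ _ _ _))
        (Finset.mem_univ k)
    have h3 := mul_le_mul_of_nonneg_left h2 K0
    linarith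
  have h4 := Finset.sum_le_sum fun k (_ : k ∈ Finset.univ) => h k
  simp only [Finset.sum_const, Finset.card_univ, Fintype.card_fin, nsmul_eq_mul] at h4
  push_cast at h4
  linarith

lemma NX_le {c0 : ℝ} (hc0 : 0 < c0) (δ : ℝ) (m : ℕ) : ∃ K, 0 ≤ K ∧ ∀ (u : Fin 3 → Fn) (t : ℝ),
    (∀ i, Sm (u i)) → (∀ i, SC t (u i)) → NX δ m u t ≤ K * calN c0 δ (m + 2) u t ^ 2 := by
  have hp : ∀ k, 0 ≤ 2 * (1 + 1 / cspeed c0 k ^ 2) := fun k => by positivity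
  refine ⟨∑ k, 2 * (1 + 1 / cspeed c0 k ^ 2), Finset.sum_nonneg fun k _ => hp k,
    fun u t hu hs => ?_⟩
  rw [Finset.sum_mul]
  refine Finset.sum_le_sum fun k _ => ?_
  have h1 := mul_le_mul_of_nonneg_left (NQ_le (cspeed_pos hc0 k) m (hu k) (hs k))
    (sq_nonneg (jb t ^ (-(sig δ k))))
  refine h1.trans ?_
  have h0 := fun k => mul_nonneg (jb_rpow_nonneg t (-(sig δ k)))
    (Nnorm_nonneg (m + 2) (cspeed c0 k) (u k) t)
  have h2 : jb t ^ (-(sig δ k)) * Nnorm (m + 2) (cspeed c0 k) (u k) t ≤ calN c0 δ (m + 2) u t := by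
    rw [calN_eq]
    exact Finset.single_le_sum (f := fun k : Fin 3 => jb t ^ (-(sig δ k)) *
      Nnorm (m + 2) (cspeed c0 k) (u k) t) (fun k _ => h0 k) (Finset.mem_univ k)
  have h3 := mul_le_mul_of_nonneg_left (pow_le_pow_left₀ (h0 k) h2 2) (hp k)
  rw [mul_pow] at h3
  linarith

lemma MX_le {c0 δ : ℝ} (hc0 : 0 < c0) {m : ℕ}
    {P : (Fin 3 → Fn) → ℝ → Prop}
    (hbox : ∀ i, ∃ C, 0 ≤ C ∧ ∀ (u : Fin 3 → Fn) (t : ℝ), P u t → ∀ A, Adm c0 δ u t A →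
      t ^ 2 * ∑ a ∈ idxSet 7 m, In t (fun p => boxOp (cspeed c0 i) (Zmulti a (u i)) p ^ 2) ≤
        C * (A ^ 2 * (jb t ^ sig δ i) ^ 2 * XY c0 δ m u t)) :
    ∃ C, 0 ≤ C ∧ ∀ (u : Fin 3 → Fn) (t : ℝ), P u t → ∀ A, Adm c0 δ u t A →
      MX c0 δ m u t ≤ C * NX δ m u t + C * A ^ 2 * XY c0 δ m u t := by
  choose C hC h using hbox
  choose D hD h' using fun i => ks_sum (cspeed_pos hc0 i) m
  set E := ∑ i, D i * (1 + C i) with hE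
  have hp : ∀ i, 0 ≤ D i * (1 + C i) := fun i => mul_nonneg (hD i) (by linarith [hC i])
  have E0 : 0 ≤ E := Finset.sum_nonneg fun i _ => hp i
  have hle : ∀ i, D i * (1 + C i) ≤ E := fun i =>
    Finset.single_le_sum (f := fun i => D i * (1 + C i)) (fun i _ => hp i) (Finset.mem_univ i)
  refine ⟨3 * E, by linarith, fun u t hu A hA => ?_⟩
  have hX := XY_nonneg c0 δ m u t
  have key : ∀ i, (jb t ^ (-(sig δ i))) ^ 2 * MQ (cspeed c0 i) m (u i) t ≤
      E * ((jb t ^ (-(sig δ i))) ^ 2 * NQ (m + 1) (u i) t) + E * (A ^ 2 * XY c0 δ m u t) := by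
    intro i
    have h1 := h i u t hu A hA
    have h2 := h' i (u i) t (hA.sm i) (hA.sc i) hA.ht
    have hN := NQ_nonneg (m + 1) (u i) t
    have hT := Real.rpow_pos_of_pos (jb_pos t) (sig δ i)
    rw [Real.rpow_neg (jb_pos t).le]
    set τ := jb t ^ sig δ i with hτ
    have h3 := mul_le_mul_of_nonneg_left h1 (hD i)
    have h4 : (τ⁻¹) ^ 2 * MQ (cspeed c0 i) m (u i) t ≤ (τ⁻¹) ^ 2 *
        (D i * NQ (m + 1) (u i) t + D i * (C i * (A ^ 2 * τ ^ 2 * XY c0 δ m u t))) := by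
      refine mul_le_mul_of_nonneg_left ?_ (sq_nonneg _)
      linarith
    have h5 : (τ⁻¹) ^ 2 *
        (D i * NQ (m + 1) (u i) t + D i * (C i * (A ^ 2 * τ ^ 2 * XY c0 δ m u t))) =
        D i * ((τ⁻¹) ^ 2 * NQ (m + 1) (u i) t) + D i * C i * (A ^ 2 * XY c0 δ m u t) := by
      field_simp
    have hDi : D i ≤ E := by
      have := mul_nonneg (hD i) (hC i)
      linarith [hle i]
    have hCi : D i * C i ≤ E := by linarith [hle i, hD i]
    have h6 := mul_le_mul_of_nonneg_right hDi
      (show 0 ≤ (τ⁻¹) ^ 2 * NQ (m + 1) (u i) t by positivity)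
    have h7 := mul_le_mul_of_nonneg_right hCi (show 0 ≤ A ^ 2 * XY c0 δ m u t by positivity)
    linarith
  have h8 := Finset.sum_le_sum fun i (_ : i ∈ Finset.univ) => key i
  rw [Finset.sum_add_distrib, ← Finset.mul_sum] at h8
  simp only [Finset.sum_const, Finset.card_univ, Fintype.card_fin, nsmul_eq_mul] at h8
  push_cast at h8
  have hN : 0 ≤ NX δ m u t := Finset.sum_nonneg fun k _ =>
    mul_nonneg (sq_nonneg _) (NQ_nonneg _ _ _)
  have h9 := mul_nonneg E0 hN
  change MX c0 δ m u t ≤ E * NX δ m u t + _ at h8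
  linarith

lemma calM_le_calN {c0 δ : ℝ} (hc0 : 0 < c0) (hδ : 0 < δ) (hδ' : δ < 1 / 24)
    {F : Coef} {Cub : Fin 3 → MvPolynomial (Fin 3 × Fin 4) ℝ} (hCub : ∀ i, CubicLike (Cub i))
    {m : ℕ} (hm : m ≤ 2) (hF : ∀ i j k, ∃ P, P (F i j k) ∧ GoodClass c0 δ m i j k P) :
    ∃ ε K, 0 < ε ∧ 0 < K ∧ ∀ (T : ℝ) (u : Fin 3 → Fn), LocalSolution c0 F Cub T u →
      ∀ t ∈ Ioo 0 T, bigBracket c0 δ u t ≤ ε →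
        calM c0 δ (m + 2) u t ≤ K * calN c0 δ (m + 2) u t := by
  obtain ⟨C, hC, h⟩ := MX_le (δ := δ) hc0
    (P := fun u t => ∃ T, LocalSolution c0 F Cub T u ∧ t ∈ Ioo 0 T) fun i => by
      obtain ⟨C, hC, h⟩ := boxOp_bound hc0 hδ hδ' hCub hm (hF i)
      exact ⟨C, hC, fun u t ⟨T, hu, ht⟩ A hA => h T u hu t ht A hA⟩
  obtain ⟨K1, hK1, h1⟩ := calM_le c0 δ m
  obtain ⟨K2, hK2, h2⟩ := NX_le hc0 δ m
  have e0 : 0 < 1 / (2 * C + 1) := by positivity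
  refine ⟨1 / (2 * C + 1), K1 * Real.sqrt ((2 * C + 1) * K2) + 1, e0, by positivity,
    fun T u hu t ht hA => ?_⟩
  have su : ∀ i, Sm (u i) := hu.1
  have sc : ∀ i, SC t (u i) := hu.sc hc0 hCub ht
  obtain ⟨A0, hadm⟩ := bigBracket_nonneg_and_adm (c0 := c0) (δ := δ) su sc ht.1
  set A := bigBracket c0 δ u t with hAd
  have e1 : 1 / (2 * C + 1) ≤ 1 := by
    rw [div_le_one (by positivity)]
    linarith
  have h3 := h u t ⟨T, hu, ht⟩ A (hadm (hA.trans e1))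
  have hX := XY_nonneg c0 δ m u t
  have hCA : C * A ^ 2 ≤ 1 / 2 := by
    have h4 : A ^ 2 ≤ A := by nlinarith
    have h5 : C * A ^ 2 ≤ C * (1 / (2 * C + 1)) := mul_le_mul_of_nonneg_left (h4.trans hA) hC
    refine h5.trans ?_
    rw [mul_one_div, div_le_div_iff₀ (by positivity) (by norm_num)]
    linarith
  have h4 := mul_le_mul_of_nonneg_right hCA hX
  have h5 := XY_eq c0 δ m u t
  have h6 : MX c0 δ m u t ≤ (2 * C + 1) * NX δ m u t := by linarith
  have hN := calN_nonneg c0 δ (m + 2) u t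
  have h7 : MX c0 δ m u t ≤ (2 * C + 1) * K2 * calN c0 δ (m + 2) u t ^ 2 := by
    have := mul_le_mul_of_nonneg_left (h2 u t su sc) (show 0 ≤ 2 * C + 1 by positivity)
    linarith
  have h8 := Real.sqrt_le_sqrt h7
  rw [Real.sqrt_mul (by positivity), Real.sqrt_sq hN] at h8
  have h9 := mul_le_mul_of_nonneg_left h8 hK1
  have h10 := h1 u t su sc
  linarith

/-- Proposition 3.1: bound for the auxiliary norms `ℳ_μ` (μ = 3,4). -/
theorem M_bound (c0 δ : ℝ) (hc0 : 0 < c0) (hδ : 0 < δ) (hδ' : δ < 1/24)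
    (F : Coef) (Cub : Fin 3 → MvPolynomial (Fin 3 × Fin 4) ℝ)
    (hTri : LowerTri F) (hCub : ∀ i, CubicLike (Cub i))
    (h1 : nullCond 1 (F 0 0 0))
    (h2 : nullCond 1 (F 1 0 0)) (h3 : nullCond 1 (F 1 0 1))
    (h4 : nullCond 1 (F 2 0 0)) (h5 : nullCond 1 (F 2 0 1))
    (h6 : ∀ (α β : Fin 4), F 1 0 2 α β = 0)
    (h7 : ∀ (α β : Fin 4), F 2 0 2 α β = 0) :
    ∃ CKS C31 C32 C33 : ℝ, 0 < CKS ∧ 0 < C31 ∧ 0 < C32 ∧ 0 < C33 ∧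
      ∀ (T : ℝ) (u : Fin 3 → Fn), LocalSolution c0 F Cub T u →
        ∀ μ ∈ ({3, 4} : Set ℕ), ∀ t ∈ Set.Ioo (0:ℝ) T,
          calM c0 δ μ u t ≤
            CKS * calN c0 δ μ u t
            + C31 * bigBracket c0 δ u t * calN c0 δ μ u t
            + C32 * bigBracket c0 δ u t ^ 2 * calN c0 δ 3 u t
            + C33 * bigBracket c0 δ u t * calM c0 δ μ u t := by
  have hF : ∀ m ≤ 2, ∀ i j k, ∃ P, P (F i j k) ∧ GoodClass c0 δ m i j k P := fun m hm i j k =>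
    exists_goodClass hc0 hδ hδ' hTri h1 h2 h3 h4 h5 h6 h7 hm i j k
  obtain ⟨ε, K, hε, hK, hb⟩ := calM_le_calN hc0 hδ hδ' hCub one_le_two (hF 1 one_le_two)
  obtain ⟨ε', K', hε', hK', hb'⟩ := calM_le_calN hc0 hδ hδ' hCub le_rfl (hF 2 le_rfl)
  refine ⟨K + K', 1, 1, 1 / min ε ε', by positivity, one_pos, one_pos,
    one_div_pos.2 (lt_min hε hε'), fun T u hu μ hμ t ht => ?_⟩
  have hA := (bigBracket_nonneg_and_adm (c0 := c0) (δ := δ) hu.1 (hu.sc hc0 hCub ht) ht.1).1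
  have hN := calN_nonneg c0 δ μ u t
  have hN3 := calN_nonneg c0 δ 3 u t
  have hM := calM_nonneg c0 δ μ u t
  have hmin := lt_min hε hε'
  set A := bigBracket c0 δ u t with hAd
  have t1 : 0 ≤ 1 * A * calN c0 δ μ u t := by positivity
  have t2 : 0 ≤ 1 * A ^ 2 * calN c0 δ 3 u t := by positivity
  rcases le_or_gt A (min ε ε') with h | h
  · have t3 : 0 ≤ 1 / min ε ε' * A * calM c0 δ μ u t := by positivity
    have key : calM c0 δ μ u t ≤ (K + K') * calN c0 δ μ u t := by
      rcases hμ with rfl | rfl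
      · have := hb T u hu t ht (h.trans (min_le_left _ _))
        have := mul_nonneg hK'.le hN
        linarith
      · have := hb' T u hu t ht (h.trans (min_le_right _ _))
        have := mul_nonneg hK.le hN
        linarith
    linarith
  · have t3 : 0 ≤ (K + K') * calN c0 δ μ u t := by positivity
    have h8 : 1 ≤ 1 / min ε ε' * A := by
      rw [one_div, ← div_eq_inv_mul, one_le_div hmin]
      exact h.le
    have h9 := mul_le_mul_of_nonneg_right h8 hM
    linarith

end MultiSpeedWave
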